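/- Let r := √2 − 1 and L' := 4·√(2r/(1 + 2r)). Every FM-tetrahedron T (of any type) satisfies δ(T) ≤ δ(T₀), where T₀ is any weighted tetrahedron with radii (1,1,1,r) and edge lengths dist(A,B) = L', dist(A,C) = dist(B,C) = 2, and dist(A,D) = dist(B,D) = dist(C,D) = 1 + r; numerically δ(T₀) = 0.812542027810834866943600528883352220… . -/

import Mathlib

open MeasureTheory Metric

noncomputable def tetra (A B C D : EuclideanSpace ℝ (Fin 3)) :
    Set (EuclideanSpace ℝ (Fin 3)) :=
  convexHull ℝ {A, B, C, D}

noncomputable def density (A B C D : EuclideanSpace ℝ (Fin 3)) (rA rB rC rD : ℝ) : ℝ :=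
  (volume (tetra A B C D ∩
    (closedBall A rA ∪ closedBall B rB ∪ closedBall C rC ∪ closedBall D rD))).toReal /
  (volume (tetra A B C D)).toReal

section FMproof
open scoped Pointwise
set_option linter.unusedSimpArgs false
set_option linter.unusedVariables false

/-- Coefficients of a ternary quadratic form (a Gram matrix). -/
structure GQ where
  (A B C F G H : ℝ)

/-- The quadratic form. -/
def GQ.q (g : GQ) (x y z : ℝ) : ℝ :=
  g.A * x ^ 2 + g.B * y ^ 2 + g.C * z ^ 2 + 2 * (g.F * (y * z) + g.G * (x * z) + g.H * (x * y))

/-- The open positive quadrant. -/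
def quad : Set (ℝ × ℝ) := Set.Ioi 0 ×ˢ Set.Ioi 0

/-- The (normalised) solid-angle integral. -/
noncomputable def GQ.J (g : GQ) : ENNReal :=
  ∫⁻ p in quad, ENNReal.ofReal ((g.q p.1 p.2 1) ^ (-(3 / 2) : ℝ))

/-- The part of the positive octant where the form is at most `ρ ^ 2`. -/
def GQ.sec (g : GQ) (ρ : ℝ) : Set (ℝ × ℝ × ℝ) :=
  {p | 0 < p.1 ∧ 0 < p.2.1 ∧ 0 < p.2.2 ∧ g.q p.2.1 p.2.2 p.1 ≤ ρ ^ 2}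

lemma GQ.q_smul (g : GQ) (t x y z : ℝ) : g.q (t * x) (t * y) (t * z) = t ^ 2 * g.q x y z := by
  unfold GQ.q; ring

lemma GQ.continuous_q (g : GQ) : Continuous fun p : ℝ × ℝ × ℝ => g.q p.2.1 p.2.2 p.1 := by
  unfold GQ.q; fun_prop

lemma GQ.continuous_q1 (g : GQ) : Continuous fun p : ℝ × ℝ => g.q p.1 p.2 1 := by
  unfold GQ.q; fun_prop

lemma measurableSet_quad : MeasurableSet quad := measurableSet_Ioi.prod measurableSet_Ioi

lemma GQ.measurableSet_sec (g : GQ) (ρ : ℝ) : MeasurableSet (g.sec ρ) := by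
  have e : g.sec ρ = {p : ℝ × ℝ × ℝ | 0 < p.1} ∩ ({p : ℝ × ℝ × ℝ | 0 < p.2.1} ∩
      ({p : ℝ × ℝ × ℝ | 0 < p.2.2} ∩ {p : ℝ × ℝ × ℝ | g.q p.2.1 p.2.2 p.1 ≤ ρ ^ 2})) := by
    ext p; simp [GQ.sec]
  rw [e]
  have h1 : Measurable fun p : ℝ × ℝ × ℝ => p.1 := by fun_prop
  have h2 : Measurable fun p : ℝ × ℝ × ℝ => p.2.1 := by fun_prop
  have h3 : Measurable fun p : ℝ × ℝ × ℝ => p.2.2 := by fun_prop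
  exact (measurableSet_lt measurable_const h1).inter
    ((measurableSet_lt measurable_const h2).inter
    ((measurableSet_lt measurable_const h3).inter
    (measurableSet_le g.continuous_q.measurable measurable_const)))

lemma lintegral_sq_Ioc (R : ℝ) (hR : 0 ≤ R) :
    ∫⁻ z in Set.Ioc 0 R, ENNReal.ofReal (z ^ 2) = ENNReal.ofReal (R ^ 3 / 3) := by
  have h1 : ∫ z in (0:ℝ)..R, z ^ 2 = R ^ 3 / 3 := by
    rw [integral_pow]; norm_num
  rw [← ofReal_integral_eq_lintegral_ofReal, ← intervalIntegral.integral_of_le hR, h1]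
  · exact ((continuous_pow 2).intervalIntegrable 0 R).1
  · exact Filter.Eventually.of_forall fun x => sq_nonneg x

lemma GQ.volume_sec (g : GQ) (ρ : ℝ) (hρ : 0 < ρ)
    (hpos : ∀ x y, 0 < x → 0 < y → 0 < g.q x y 1) :
    volume (g.sec ρ) = ENNReal.ofReal (ρ ^ 3 / 3) * g.J := by
  have hm := g.measurableSet_sec ρ
  rw [Measure.volume_eq_prod, Measure.prod_apply hm]
  -- rewrite the sections
  have hsec : ∀ z : ℝ, volume (Prod.mk z ⁻¹' g.sec ρ) =
      ∫⁻ p in quad, (Set.Ioc 0 (ρ / Real.sqrt (g.q p.1 p.2 1))).indicator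
        (fun z => ENNReal.ofReal (z ^ 2)) z := by
    intro z
    rcases le_or_gt z 0 with hz | hz
    · have : Prod.mk z ⁻¹' g.sec ρ = ∅ := by
        ext p; simp only [Set.mem_preimage, GQ.sec, Set.mem_ofPred_eq, Set.mem_empty_iff_false,
          iff_false]; intro h; exact absurd h.1 (not_lt.2 hz)
      rw [this, measure_empty]
      symm
      have : ∀ p : ℝ × ℝ, (Set.Ioc 0 (ρ / Real.sqrt (g.q p.1 p.2 1))).indicator
        (fun z => ENNReal.ofReal (z ^ 2)) z = 0 := by
        intro p
        apply Set.indicator_of_notMem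
        intro h; exact absurd h.1 (not_lt.2 hz)
      simp [this]
    · have hset : Prod.mk z ⁻¹' g.sec ρ =
          z • (quad ∩ {p | z ≤ ρ / Real.sqrt (g.q p.1 p.2 1)}) := by
        ext p
        rw [Set.mem_smul_set_iff_inv_smul_mem₀ hz.ne']
        simp only [Set.mem_preimage, GQ.sec, Set.mem_ofPred_eq, Set.mem_inter_iff, quad,
          Set.mem_prod, Set.mem_Ioi, Prod.smul_fst, Prod.smul_snd, smul_eq_mul]
        have hzi : 0 < z⁻¹ := inv_pos.2 hz
        have e1 : 0 < z⁻¹ * p.1 ↔ 0 < p.1 := by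
          constructor
          · intro h; exact (pos_iff_pos_of_mul_pos h).1 hzi
          · intro h; positivity
        have e2 : 0 < z⁻¹ * p.2 ↔ 0 < p.2 := by
          constructor
          · intro h; exact (pos_iff_pos_of_mul_pos h).1 hzi
          · intro h; positivity
        rw [e1, e2]
        constructor
        · rintro ⟨-, h1, h2, h3⟩
          refine ⟨⟨h1, h2⟩, ?_⟩
          have hq := hpos _ _ (e1.2 h1) (e2.2 h2)
          have hs := Real.sqrt_pos.2 hq
          rw [le_div_iff₀ hs]
          apply le_of_sq_le_sq _ hρ.le
          rw [mul_pow, Real.sq_sqrt hq.le, ← g.q_smul]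
          rw [mul_inv_cancel_left₀ hz.ne', mul_inv_cancel_left₀ hz.ne', mul_one]
          exact h3
        · rintro ⟨⟨h1, h2⟩, h3⟩
          refine ⟨hz, h1, h2, ?_⟩
          have hq := hpos _ _ (e1.2 h1) (e2.2 h2)
          have hs := Real.sqrt_pos.2 hq
          rw [le_div_iff₀ hs] at h3
          have h4 := pow_le_pow_left₀ (by positivity) h3 2
          rw [mul_pow, Real.sq_sqrt hq.le, ← g.q_smul] at h4
          rwa [mul_inv_cancel_left₀ hz.ne', mul_inv_cancel_left₀ hz.ne', mul_one] at h4
      have hmS : MeasurableSet {p : ℝ × ℝ | z ≤ ρ / Real.sqrt (g.q p.1 p.2 1)} := by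
        refine measurableSet_le measurable_const ?_
        have := g.continuous_q1.measurable
        fun_prop
      rw [hset, Measure.addHaar_smul, ← setLIntegral_one, ← lintegral_const_mul' _ _ (by simp),
        Set.inter_comm, ← Measure.restrict_restrict hmS, ← lintegral_indicator hmS]
      congr 1
      ext p
      simp only [Set.indicator, Set.mem_ofPred_eq, Set.mem_Ioc, hz, true_and, mul_one]
      split_ifs with h
      · congr 1
        simp [abs_of_pos hz]
      · rfl
  simp_rw [hsec]
  rw [lintegral_lintegral_swap]
  · unfold GQ.J
    rw [← lintegral_const_mul' _ _ (by simp)]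
    refine setLIntegral_congr_fun measurableSet_quad ?_
    rintro ⟨x, y⟩ ⟨hx, hy⟩
    have hq := hpos x y hx hy
    have hs := Real.sqrt_pos.2 hq
    simp only
    rw [lintegral_indicator measurableSet_Ioc, lintegral_sq_Ioc _ (by positivity),
      ← ENNReal.ofReal_mul (by positivity)]
    congr 1
    have : (g.q x y 1) ^ (-(3 / 2) : ℝ) = (Real.sqrt (g.q x y 1) ^ 3)⁻¹ := by
      rw [Real.rpow_neg hq.le, Real.sqrt_eq_rpow, ← Real.rpow_natCast, ← Real.rpow_mul hq.le]
      norm_num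
    rw [this]
    field_simp
  · have hmm : MeasurableSet {w : ℝ × (ℝ × ℝ) | 0 < w.1 ∧ w.1 ≤ ρ / Real.sqrt (g.q w.2.1 w.2.2 1)} := by
      have h := g.continuous_q1.measurable
      have h2 : Measurable fun w : ℝ × (ℝ × ℝ) => g.q w.2.1 w.2.2 1 := h.comp measurable_snd
      have h1 : Measurable fun w : ℝ × (ℝ × ℝ) => w.1 := by fun_prop
      have h3 : Measurable fun w : ℝ × (ℝ × ℝ) => ρ / Real.sqrt (g.q w.2.1 w.2.2 1) := by fun_prop
      have e := (measurableSet_lt measurable_const h1 (f := fun _ => (0:ℝ))).inter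
        (measurableSet_le h1 h3)
      convert e using 1
      ext w; simp
    have : (Function.uncurry fun (z : ℝ) (p : ℝ × ℝ) =>
        (Set.Ioc 0 (ρ / Real.sqrt (g.q p.1 p.2 1))).indicator
        (fun z => ENNReal.ofReal (z ^ 2)) z) =
        {w : ℝ × (ℝ × ℝ) | 0 < w.1 ∧ w.1 ≤ ρ / Real.sqrt (g.q w.2.1 w.2.2 1)}.indicator
        (fun w => ENNReal.ofReal (w.1 ^ 2)) := by
      ext ⟨z, p⟩
      simp [Function.uncurry, Set.indicator]
    rw [this]
    refine (Measurable.indicator (by fun_prop) hmm).aemeasurable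

lemma rpow_neg_three_half {t : ℝ} (ht : 0 < t) : t ^ (-(3 / 2) : ℝ) = 1 / (t * Real.sqrt t) := by
  rw [Real.rpow_neg ht.le, one_div]
  congr 1
  rw [Real.sqrt_eq_rpow, show (3 / 2 : ℝ) = 1 + 1 / 2 by norm_num, Real.rpow_add ht, Real.rpow_one]

/-- If `f` has nonnegative derivative on `[0, ∞)` and tends to `l`, then the lintegral of that derivative is
`l - f 0`. -/
lemma lintegral_Ioi_of_hasDerivAt {f f' : ℝ → ℝ} {l : ℝ}
    (hd : ∀ x, 0 ≤ x → HasDerivAt f (f' x) x) (hp : ∀ x, 0 < x → 0 ≤ f' x)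
    (hl : Filter.Tendsto f Filter.atTop (nhds l)) :
    ∫⁻ x in Set.Ioi 0, ENNReal.ofReal (f' x) = ENNReal.ofReal (l - f 0) := by
  have h1 := integrableOn_Ioi_deriv_of_nonneg' (a := 0) (fun x hx => hd x hx) (fun x hx => hp x hx) hl
  have h2 := integral_Ioi_of_hasDerivAt_of_nonneg' (a := 0) (fun x hx => hd x hx)
    (fun x hx => hp x hx) hl
  rw [← h2, ofReal_integral_eq_lintegral_ofReal h1]
  filter_upwards [ae_restrict_mem measurableSet_Ioi] with x hx using hp x hx

lemma tendsto_sqrt_quad (a β γ : ℝ) (ha : 0 < a) :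
    Filter.Tendsto (fun u : ℝ => Real.sqrt (a ^ 2 * u ^ 2 + 2 * β * u + γ) / u) Filter.atTop
      (nhds a) := by
  have h1 : Filter.Tendsto (fun u : ℝ => Real.sqrt (a ^ 2 + 2 * β * u⁻¹ + γ * (u⁻¹ * u⁻¹)))
      Filter.atTop (nhds (Real.sqrt (a ^ 2 + 2 * β * 0 + γ * (0 * 0)))) := by
    have := tendsto_inv_atTop_zero (𝕜 := ℝ)
    exact (((tendsto_const_nhds.add (this.const_mul _)).add ((this.mul this).const_mul _))).sqrt
  have h2 : Real.sqrt (a ^ 2 + 2 * β * 0 + γ * (0 * 0)) = a := by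
    simp [Real.sqrt_sq ha.le]
  rw [h2] at h1
  refine h1.congr' ?_
  filter_upwards [Filter.eventually_gt_atTop 0] with u hu
  rw [eq_div_iff hu.ne']
  have e3 : ∀ X : ℝ, X * u = X * Real.sqrt (u ^ 2) := fun X => by rw [Real.sqrt_sq hu.le]
  rw [e3, ← Real.sqrt_mul' _ (sq_nonneg u)]
  congr 1
  field_simp

lemma inner_lintegral (a β γ : ℝ) (ha : 0 < a) (hγ : 0 < γ) (hd : 0 < a ^ 2 * γ - β ^ 2) :
    ∫⁻ u in Set.Ioi 0, ENNReal.ofReal ((a ^ 2 * u ^ 2 + 2 * β * u + γ) ^ (-(3 / 2) : ℝ)) =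
      ENNReal.ofReal (1 / (Real.sqrt γ * (a * Real.sqrt γ + β))) := by
  have hq : ∀ u : ℝ, 0 < a ^ 2 * u ^ 2 + 2 * β * u + γ := by
    intro u
    have : 0 < a ^ 2 * (a ^ 2 * u ^ 2 + 2 * β * u + γ) := by nlinarith [sq_nonneg (a ^ 2 * u + β)]
    exact (pos_iff_pos_of_mul_pos this).1 (by positivity)
  set s := Real.sqrt γ with hs
  have hs0 : 0 < s := Real.sqrt_pos.2 hγ
  have hs2 : s ^ 2 = γ := Real.sq_sqrt hγ.le
  have hlt : |β| < a * s := by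
    apply abs_lt_of_sq_lt_sq _ (by positivity)
    rw [mul_pow, hs2]; linarith
  have hb1 := (abs_lt.1 hlt).1
  have hb2 := (abs_lt.1 hlt).2
  rw [lintegral_Ioi_of_hasDerivAt (f := fun u => (a ^ 2 * u + β) /
    ((a ^ 2 * γ - β ^ 2) * Real.sqrt (a ^ 2 * u ^ 2 + 2 * β * u + γ)))
    (l := a / (a ^ 2 * γ - β ^ 2))]
  · congr 1
    simp only [mul_zero, ne_eq, OfNat.ofNat_ne_zero, not_false_eq_true, zero_pow, zero_add]
    rw [← hs, ← hs2]
    have e1 : a ^ 2 * s ^ 2 - β ^ 2 = (a * s - β) * (a * s + β) := by ring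
    rw [e1]
    have n1 : a * s - β ≠ 0 := by linarith
    have n2 : a * s + β ≠ 0 := by linarith
    field_simp
  · intro x _
    have hx := hq x
    have hsx := Real.sqrt_pos.2 hx
    have d1 : HasDerivAt (fun u : ℝ => a ^ 2 * u ^ 2 + 2 * β * u + γ)
        (2 * (a ^ 2 * x + β)) x := by
      have := (((hasDerivAt_pow 2 x).const_mul (a ^ 2)).add
        ((hasDerivAt_id x).const_mul (2 * β))).add_const γ
      refine this.congr_deriv ?_
      simp; ring
    have d2 := (d1.sqrt hx.ne').const_mul (a ^ 2 * γ - β ^ 2)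
    have d3 : HasDerivAt (fun u : ℝ => a ^ 2 * u + β) (a ^ 2) x := by
      have := ((hasDerivAt_id x).const_mul (a ^ 2)).add_const β
      refine this.congr_deriv (by simp)
    refine (d3.div d2 (by positivity)).congr_deriv ?_
    rw [rpow_neg_three_half hx]
    set S := Real.sqrt (a ^ 2 * x ^ 2 + 2 * β * x + γ)
    have hS2 : S ^ 2 = a ^ 2 * x ^ 2 + 2 * β * x + γ := Real.sq_sqrt hx.le
    rw [← hS2]
    have hd' := hd.ne'
    field_simp
    rw [hS2]
    ring
  · intro x _
    exact Real.rpow_nonneg (hq x).le _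
  · have h1 := tendsto_sqrt_quad a β γ ha
    have h2 : Filter.Tendsto (fun u : ℝ => a ^ 2 + β * u⁻¹) Filter.atTop (nhds (a ^ 2 + β * 0)) :=
      tendsto_const_nhds.add ((tendsto_inv_atTop_zero (𝕜 := ℝ)).const_mul _)
    have h3 := h2.div (h1.const_mul (a ^ 2 * γ - β ^ 2)) (by positivity)
    have e : (a ^ 2 + β * 0) / ((a ^ 2 * γ - β ^ 2) * a) = a / (a ^ 2 * γ - β ^ 2) := by
      have hd' := hd.ne'
      field_simp; ring
    rw [e] at h3
    refine h3.congr' ?_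
    filter_upwards [Filter.eventually_gt_atTop 0] with u hu
    have hx := hq u
    have hsx := Real.sqrt_pos.2 hx
    have hd' := hd.ne'
    simp only [Pi.div_apply]
    field_simp

/-- The closed form of the solid angle integral for a positive definite form. -/
lemma J_closed (a b c F G H W : ℝ) (ha : 0 < a) (hb : 0 < b) (hc : 0 < c)
    (hF : |F| < b * c) (hH : |H| < a * b) (hW : 0 < W)
    (hW2 : W ^ 2 = a ^ 2 * b ^ 2 * c ^ 2 + 2 * F * G * H - a ^ 2 * F ^ 2 - b ^ 2 * G ^ 2
      - c ^ 2 * H ^ 2) :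
    (GQ.mk (a ^ 2) (b ^ 2) (c ^ 2) F G H).J =
      ENNReal.ofReal (2 / W * (Real.pi / 2 -
        Real.arctan ((a * b * c + a * F + b * G + c * H) / W))) := by
  have hF1 := (abs_lt.1 hF).1
  have hH1 := (abs_lt.1 hH).1
  have hH2 := (abs_lt.1 hH).2
  have hγ : ∀ v : ℝ, 0 ≤ v → 0 < b ^ 2 * v ^ 2 + 2 * F * v + c ^ 2 := by
    intro v hv
    rcases hv.eq_or_lt with h | h
    · rw [← h]; nlinarith
    · nlinarith [sq_nonneg (b * v - c), mul_pos h (by linarith : 0 < F + b * c)]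
  have hdd : ∀ v : ℝ, 0 < a ^ 2 * (b ^ 2 * v ^ 2 + 2 * F * v + c ^ 2) - (H * v + G) ^ 2 := by
    intro v
    have k1 : 0 < a ^ 2 * b ^ 2 - H ^ 2 := by nlinarith
    have : 0 < (a ^ 2 * b ^ 2 - H ^ 2) *
        (a ^ 2 * (b ^ 2 * v ^ 2 + 2 * F * v + c ^ 2) - (H * v + G) ^ 2) := by
      have e : (a ^ 2 * b ^ 2 - H ^ 2) *
        (a ^ 2 * (b ^ 2 * v ^ 2 + 2 * F * v + c ^ 2) - (H * v + G) ^ 2) =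
        ((a ^ 2 * b ^ 2 - H ^ 2) * v + (a ^ 2 * F - G * H)) ^ 2 + a ^ 2 * W ^ 2 := by
        rw [hW2]; ring
      rw [e]; positivity
    exact (pos_iff_pos_of_mul_pos this).1 k1
  have hq1 := (GQ.mk (a ^ 2) (b ^ 2) (c ^ 2) F G H).continuous_q1.measurable
  unfold GQ.J quad
  rw [Measure.volume_eq_prod, ← Measure.prod_restrict, lintegral_prod_symm' _ (by fun_prop)]
  have hinner : ∀ v ∈ Set.Ioi (0:ℝ), ∫⁻ u in Set.Ioi 0, ENNReal.ofReal
      (((GQ.mk (a ^ 2) (b ^ 2) (c ^ 2) F G H).q (u, v).1 (u, v).2 1) ^ (-(3 / 2) : ℝ)) =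
      ENNReal.ofReal (1 / (Real.sqrt (b ^ 2 * v ^ 2 + 2 * F * v + c ^ 2) *
        (a * Real.sqrt (b ^ 2 * v ^ 2 + 2 * F * v + c ^ 2) + (H * v + G)))) := by
    intro v hv
    rw [← inner_lintegral a (H * v + G) _ ha (hγ v (le_of_lt hv)) (hdd v)]
    congr 1
    ext u
    congr 2
    unfold GQ.q; ring
  rw [setLIntegral_congr_fun measurableSet_Ioi hinner]
  have hab : 0 < a * b + H := by linarith
  have hpos : ∀ v : ℝ, 0 ≤ v → 0 < a * Real.sqrt (b ^ 2 * v ^ 2 + 2 * F * v + c ^ 2) + (H * v + G) := by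
    intro v hv
    have hs := Real.sqrt_pos.2 (hγ v hv)
    have hs2 := Real.sq_sqrt (hγ v hv).le
    have : |H * v + G| < a * Real.sqrt (b ^ 2 * v ^ 2 + 2 * F * v + c ^ 2) := by
      apply abs_lt_of_sq_lt_sq _ (by positivity)
      rw [mul_pow, hs2]; linarith [hdd v]
    linarith [(abs_lt.1 this).1]
  rw [lintegral_Ioi_of_hasDerivAt (f := fun v => 2 / W * Real.arctan (((a * b + H) *
    (Real.sqrt (b ^ 2 * v ^ 2 + 2 * F * v + c ^ 2) + b * v) + b * G + a * F) / W))
    (l := 2 / W * (Real.pi / 2))]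
  · congr 1
    simp only [mul_zero, ne_eq, OfNat.ofNat_ne_zero, not_false_eq_true, zero_pow, zero_add, add_zero,
      Real.sqrt_sq hc.le]
    rw [mul_sub]
    congr 4
    ring
  · intro v hv
    have hx := hγ v hv
    have hsx := Real.sqrt_pos.2 hx
    have d1 : HasDerivAt (fun v : ℝ => b ^ 2 * v ^ 2 + 2 * F * v + c ^ 2)
        (2 * (b ^ 2 * v + F)) v := by
      have := (((hasDerivAt_pow 2 v).const_mul (b ^ 2)).add
        ((hasDerivAt_id v).const_mul (2 * F))).add_const (c ^ 2)
      refine this.congr_deriv ?_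
      simp; ring
    have d2 := d1.sqrt hx.ne'
    have d3 := d2.add ((hasDerivAt_id v).const_mul b)
    have d4 := ((((d3.const_mul (a * b + H)).add_const (b * G)).add_const (a * F)).div_const W).arctan.const_mul (2 / W)
    refine d4.congr_deriv ?_
    have hp := hpos v hv
    simp only [Pi.add_apply, id]
    set S := Real.sqrt (b ^ 2 * v ^ 2 + 2 * F * v + c ^ 2)
    have hS2 : S ^ 2 = b ^ 2 * v ^ 2 + 2 * F * v + c ^ 2 := Real.sq_sqrt hx.le
    have key : 2 * (a * b + H) * (b * (S + b * v) + F) * (a * S + (H * v + G)) =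
        W ^ 2 + ((a * b + H) * (S + b * v) + b * G + a * F) ^ 2 := by
      rw [hW2]
      linear_combination (a ^ 2 * b ^ 2 - H ^ 2) * hS2
    have hk : 0 < W ^ 2 + ((a * b + H) * (S + b * v) + b * G + a * F) ^ 2 := by positivity
    have e1 : 1 / (1 + (((a * b + H) * (S + b * v) + b * G + a * F) / W) ^ 2) =
        W ^ 2 / (W ^ 2 + ((a * b + H) * (S + b * v) + b * G + a * F) ^ 2) := by
      field_simp
    have e2 : (a * b + H) * (2 * (b ^ 2 * v + F) / (2 * S) + b * 1) =
        (a * b + H) * (b * (S + b * v) + F) / S := by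
      field_simp; ring
    rw [e1, e2, ← key]
    rw [← key] at hk
    have hk2 : 0 < 2 * (a * b + H) * (b * (S + b * v) + F) := (pos_iff_pos_of_mul_pos hk).2 hp
    have hk3 : 0 < b * (S + b * v) + F := (pos_iff_pos_of_mul_pos hk2).1 (by linarith)
    field_simp
  · intro v hv
    have hp := hpos v hv.le
    positivity
  · refine Filter.Tendsto.const_mul _ ?_
    refine (Real.tendsto_arctan_atTop.mono_right nhdsWithin_le_nhds).comp ?_
    refine Filter.Tendsto.atTop_div_const hW ?_
    refine Filter.tendsto_atTop_add_const_right _ _ ?_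
    refine Filter.tendsto_atTop_add_const_right _ _ ?_
    refine Filter.Tendsto.const_mul_atTop hab ?_
    refine Filter.tendsto_atTop_mono (f := fun v => b * v) ?_ (Filter.tendsto_id.const_mul_atTop hb)
    intro v
    have := Real.sqrt_nonneg (b ^ 2 * v ^ 2 + 2 * F * v + c ^ 2)
    linarith

/-- Positivity of the form on the positive quadrant. -/
def GQ.ok (g : GQ) : Prop := ∀ x y, 0 < x → 0 < y → 0 < g.q x y 1

/-- Entrywise order. -/
def GQ.leq (g h : GQ) : Prop :=
  g.A ≤ h.A ∧ g.B ≤ h.B ∧ g.C ≤ h.C ∧ g.F ≤ h.F ∧ g.G ≤ h.G ∧ g.H ≤ h.H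

lemma GQ.leq.q_le {g h : GQ} (l : g.leq h) {x y : ℝ} (hx : 0 < x) (hy : 0 < y) :
    g.q x y 1 ≤ h.q x y 1 := by
  obtain ⟨h1, h2, h3, h4, h5, h6⟩ := l
  unfold GQ.q
  gcongr

lemma GQ.leq.ok {g h : GQ} (l : g.leq h) (hg : g.ok) : h.ok :=
  fun x y hx hy => (hg x y hx hy).trans_le (l.q_le hx hy)

lemma GQ.leq.J_le {g h : GQ} (l : g.leq h) (hg : g.ok) : h.J ≤ g.J := by
  unfold GQ.J
  refine setLIntegral_mono' measurableSet_quad ?_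
  rintro ⟨x, y⟩ ⟨hx, hy⟩
  apply ENNReal.ofReal_le_ofReal
  exact Real.rpow_le_rpow_of_nonpos (hg x y hx hy) (l.q_le hx hy) (by norm_num)

lemma rpow_convex {s t α β : ℝ} (hs : 0 < s) (ht : 0 < t) (hα : 0 ≤ α) (hβ : 0 ≤ β)
    (h1 : α + β = 1) : (α * s + β * t) ^ (-(3 / 2) : ℝ) ≤
      α * s ^ (-(3 / 2) : ℝ) + β * t ^ (-(3 / 2) : ℝ) := by
  have hst : 0 < α * s + β * t := by
    rcases hα.eq_or_lt with h | h
    · have : β = 1 := by linarith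
      rw [← h, this]; linarith
    · have := mul_nonneg hβ ht.le
      have := mul_pos h hs
      linarith
  rw [Real.rpow_def_of_pos hs, Real.rpow_def_of_pos ht, Real.rpow_def_of_pos hst]
  have hl : α * Real.log s + β * Real.log t ≤ Real.log (α * s + β * t) :=
    strictConcaveOn_log_Ioi.concaveOn.2 hs ht hα hβ h1
  have he := convexOn_exp.2 (Set.mem_univ (Real.log s * -(3 / 2)))
    (Set.mem_univ (Real.log t * -(3 / 2))) hα hβ h1
  simp only [smul_eq_mul] at he
  refine le_trans (Real.exp_le_exp.2 ?_) he
  linarith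

/-- Convex combination of two forms. -/
def GQ.comb (α β : ℝ) (g h : GQ) : GQ :=
  ⟨α * g.A + β * h.A, α * g.B + β * h.B, α * g.C + β * h.C, α * g.F + β * h.F,
    α * g.G + β * h.G, α * g.H + β * h.H⟩

lemma GQ.comb_q (α β : ℝ) (g h : GQ) (x y z : ℝ) :
    (GQ.comb α β g h).q x y z = α * g.q x y z + β * h.q x y z := by
  unfold GQ.comb GQ.q; ring

lemma GQ.comb_ok {α β : ℝ} {g h : GQ} (hα : 0 ≤ α) (hβ : 0 ≤ β) (h1 : α + β = 1)
    (hg : g.ok) (hh : h.ok) : (GQ.comb α β g h).ok := by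
  intro x y hx hy
  rw [GQ.comb_q]
  have e1 := hg x y hx hy
  have e2 := hh x y hx hy
  rcases hα.eq_or_lt with h | h
  · have : β = 1 := by linarith
    rw [← h, this]; linarith
  · have := mul_nonneg hβ e2.le
    have := mul_pos h e1
    linarith

lemma GQ.comb_J {α β : ℝ} {g h : GQ} (hα : 0 ≤ α) (hβ : 0 ≤ β) (h1 : α + β = 1)
    (hg : g.ok) (hh : h.ok) :
    (GQ.comb α β g h).J ≤ ENNReal.ofReal α * g.J + ENNReal.ofReal β * h.J := by
  have m1 := g.continuous_q1.measurable
  have m2 := h.continuous_q1.measurable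
  unfold GQ.J
  rw [← lintegral_const_mul _ (by fun_prop), ← lintegral_const_mul _ (by fun_prop),
    ← lintegral_add_left (by fun_prop)]
  refine setLIntegral_mono' measurableSet_quad ?_
  rintro ⟨x, y⟩ ⟨hx, hy⟩
  have e1 := hg x y hx hy
  have e2 := hh x y hx hy
  rw [← ENNReal.ofReal_mul hα, ← ENNReal.ofReal_mul hβ, ← ENNReal.ofReal_add]
  · apply ENNReal.ofReal_le_ofReal
    rw [GQ.comb_q]
    exact rpow_convex e1 e2 hα hβ h1
  · exact mul_nonneg hα (Real.rpow_nonneg e1.le _)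
  · exact mul_nonneg hβ (Real.rpow_nonneg e2.le _)

/-- Half-angle form of the solid angle. -/
lemma half_angle (D W : ℝ) (hW : 0 < W) :
    Real.pi / 2 - Real.arctan (D / W) = 2 * Real.arctan (W / (D + Real.sqrt (D ^ 2 + W ^ 2))) := by
  set φ := Real.pi / 2 - Real.arctan (D / W) with hφ
  have h1 := Real.arctan_lt_pi_div_two (D / W)
  have h2 := Real.neg_pi_div_two_lt_arctan (D / W)
  have hc : Real.cos φ = (D / W) / Real.sqrt (1 + (D / W) ^ 2) := by
    rw [hφ, Real.cos_pi_div_two_sub, Real.sin_arctan]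
  have hs : Real.sin φ = 1 / Real.sqrt (1 + (D / W) ^ 2) := by
    rw [hφ, Real.sin_pi_div_two_sub, Real.cos_arctan]
  have hN : Real.sqrt (1 + (D / W) ^ 2) = Real.sqrt (D ^ 2 + W ^ 2) / W := by
    rw [eq_div_iff hW.ne']
    have : W = Real.sqrt (W ^ 2) := (Real.sqrt_sq hW.le).symm
    nth_rw 2 [this]
    rw [← Real.sqrt_mul (by positivity)]
    congr 1
    field_simp
    ring
  have hNp : |D| < Real.sqrt (D ^ 2 + W ^ 2) := by
    rw [← Real.sqrt_sq_eq_abs]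
    apply Real.sqrt_lt_sqrt (sq_nonneg D)
    nlinarith
  have hNp2 := neg_abs_le D
  have hN0 : 0 < Real.sqrt (D ^ 2 + W ^ 2) := lt_of_le_of_lt (abs_nonneg D) hNp
  rw [hN] at hc hs
  have key : Real.arctan (W / (D + Real.sqrt (D ^ 2 + W ^ 2))) = φ / 2 := by
    apply Real.arctan_eq_of_tan_eq
    · have hch : 0 < Real.cos (φ / 2) := by
        apply Real.cos_pos_of_mem_Ioo
        constructor <;> linarith
      have e1 : Real.sin φ = 2 * Real.sin (φ / 2) * Real.cos (φ / 2) := by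
        rw [← Real.sin_two_mul]; congr 1; ring
      have e2 : Real.cos φ = 2 * Real.cos (φ / 2) ^ 2 - 1 := by
        rw [← Real.cos_two_mul]; congr 1; ring
      rw [Real.tan_eq_sin_div_cos, div_eq_div_iff hch.ne' (by linarith)]
      set N := Real.sqrt (D ^ 2 + W ^ 2)
      have e3 : 2 * Real.sin (φ / 2) * Real.cos (φ / 2) * N = W := by
        rw [← e1, hs]; field_simp
      have e4 : (2 * Real.cos (φ / 2) ^ 2 - 1) * N = D := by
        rw [← e2, hc]; field_simp
      have e5 : D + N = 2 * Real.cos (φ / 2) ^ 2 * N := by rw [← e4]; ring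
      rw [e5]
      rw [← e3]; ring
    · constructor <;> linarith
  rw [key]; ring

/-- Monotonicity criterion on `[0, ∞)`. -/
lemma nonneg_of_deriv {f f' : ℝ → ℝ} (h0 : f 0 = 0) (hd : ∀ x, HasDerivAt f (f' x) x)
    (hp : ∀ x, 0 ≤ f' x) {t : ℝ} (ht : 0 ≤ t) : 0 ≤ f t := by
  rw [← h0]
  exact monotone_of_hasDerivAt_nonneg hd hp ht

lemma arctan_le_pade {t : ℝ} (ht : 0 ≤ t) : Real.arctan t ≤
    t * ((945 + 735 * t ^ 2 + 64 * (t ^ 2) ^ 2) / (945 + 1050 * t ^ 2 + 225 * (t ^ 2) ^ 2)) := by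
  have := nonneg_of_deriv (f := fun t => (945 * t + 735 * t ^ 3 + 64 * t ^ 5) /
    (945 + 1050 * t ^ 2 + 225 * t ^ 4) - Real.arctan t)
    (f' := fun t => (64 * t ^ 10) * 225 / (225 * (1 + t ^ 2) * (945 + 1050 * t ^ 2 + 225 * t ^ 4) ^ 2) * 225)
    (by simp) ?_ ?_ ht
  · have e : t * ((945 + 735 * t ^ 2 + 64 * (t ^ 2) ^ 2) / (945 + 1050 * t ^ 2 + 225 * (t ^ 2) ^ 2))
      = (945 * t + 735 * t ^ 3 + 64 * t ^ 5) / (945 + 1050 * t ^ 2 + 225 * t ^ 4) := by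
      rw [mul_div_assoc']; congr 1 <;> ring
    rw [e]; linarith
  · intro x
    have hq : 0 < 945 + 1050 * x ^ 2 + 225 * x ^ 4 := by positivity
    have d1 : HasDerivAt (fun t : ℝ => 945 * t + 735 * t ^ 3 + 64 * t ^ 5)
        (945 + 735 * (3 * x ^ 2) + 64 * (5 * x ^ 4)) x := by
      refine ((((hasDerivAt_id x).const_mul 945).add ((hasDerivAt_pow 3 x).const_mul 735)).add
        ((hasDerivAt_pow 5 x).const_mul 64)).congr_deriv ?_
      simp
    have d2 : HasDerivAt (fun t : ℝ => 945 + 1050 * t ^ 2 + 225 * t ^ 4)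
        (1050 * (2 * x) + 225 * (4 * x ^ 3)) x := by
      refine ((((hasDerivAt_pow 2 x).const_mul 1050).const_add 945).add
        ((hasDerivAt_pow 4 x).const_mul 225)).congr_deriv ?_
      simp
    refine ((d1.div d2 hq.ne').sub (Real.hasDerivAt_arctan x)).congr_deriv ?_
    have h2 : 0 < 1 + x ^ 2 := by positivity
    field_simp
    ring
  · intro x; positivity

lemma pade_anti {u v : ℝ} (hu : 0 ≤ u) (huv : u ≤ v) :
    (945 + 735 * v + 64 * v ^ 2) / (945 + 1050 * v + 225 * v ^ 2) ≤
    (945 + 735 * u + 64 * u ^ 2) / (945 + 1050 * u + 225 * u ^ 2) := by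
  have hv : 0 ≤ v := hu.trans huv
  rw [div_le_div_iff₀ (by positivity) (by positivity)]
  nlinarith [mul_nonneg hu hv, mul_nonneg (sub_nonneg.2 huv) hu, mul_nonneg (sub_nonneg.2 huv) hv,
    mul_nonneg (sub_nonneg.2 huv) (mul_nonneg hu hv), sub_nonneg.2 huv]

lemma arctan_ge_pade {t : ℝ} (ht : 0 ≤ t) :
    t * ((105 + 55 * t ^ 2) / (105 + 90 * t ^ 2 + 9 * (t ^ 2) ^ 2)) ≤ Real.arctan t := by
  have := nonneg_of_deriv (f := fun t => Real.arctan t - (105 * t + 55 * t ^ 3) /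
    (105 + 90 * t ^ 2 + 9 * t ^ 4))
    (f' := fun t => (9 * t ^ 8) * 64 / ((1 + t ^ 2) * (105 + 90 * t ^ 2 + 9 * t ^ 4) ^ 2))
    (by simp) ?_ ?_ ht
  · have e : t * ((105 + 55 * t ^ 2) / (105 + 90 * t ^ 2 + 9 * (t ^ 2) ^ 2))
      = (105 * t + 55 * t ^ 3) / (105 + 90 * t ^ 2 + 9 * t ^ 4) := by
      rw [mul_div_assoc']; congr 1 <;> ring
    rw [e]; linarith
  · intro x
    have hq : 0 < 105 + 90 * x ^ 2 + 9 * x ^ 4 := by positivity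
    have d1 : HasDerivAt (fun t : ℝ => 105 * t + 55 * t ^ 3)
        (105 + 55 * (3 * x ^ 2)) x := by
      refine (((hasDerivAt_id x).const_mul 105).add ((hasDerivAt_pow 3 x).const_mul 55)).congr_deriv ?_
      simp
    have d2 : HasDerivAt (fun t : ℝ => 105 + 90 * t ^ 2 + 9 * t ^ 4)
        (90 * (2 * x) + 9 * (4 * x ^ 3)) x := by
      refine ((((hasDerivAt_pow 2 x).const_mul 90).const_add 105).add
        ((hasDerivAt_pow 4 x).const_mul 9)).congr_deriv ?_
      simp
    refine ((Real.hasDerivAt_arctan x).sub (d1.div d2 hq.ne')).congr_deriv ?_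
    have h2 : 0 < 1 + x ^ 2 := by positivity
    field_simp
    ring
  · intro x; positivity

lemma ok_of_pd (a b c F G H : ℝ) (ha : 0 < a) (hH : |H| < a * b)
    (hW2 : 0 < a ^ 2 * b ^ 2 * c ^ 2 + 2 * F * G * H - a ^ 2 * F ^ 2 - b ^ 2 * G ^ 2
      - c ^ 2 * H ^ 2) :
    (GQ.mk (a ^ 2) (b ^ 2) (c ^ 2) F G H).ok := by
  intro x y _ _
  have hH1 := (abs_lt.1 hH).1
  have hH2 := (abs_lt.1 hH).2
  have k1 : 0 < a ^ 2 * b ^ 2 - H ^ 2 := by nlinarith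
  have : 0 < (a ^ 2 * b ^ 2 - H ^ 2) * (a ^ 2 * (GQ.mk (a ^ 2) (b ^ 2) (c ^ 2) F G H).q x y 1) := by
    have e : (a ^ 2 * b ^ 2 - H ^ 2) * (a ^ 2 * (GQ.mk (a ^ 2) (b ^ 2) (c ^ 2) F G H).q x y 1) =
      (a ^ 2 * b ^ 2 - H ^ 2) * (a ^ 2 * x + H * y + G) ^ 2 +
      ((a ^ 2 * b ^ 2 - H ^ 2) * y + (a ^ 2 * F - G * H)) ^ 2 +
      a ^ 2 * (a ^ 2 * b ^ 2 * c ^ 2 + 2 * F * G * H - a ^ 2 * F ^ 2 - b ^ 2 * G ^ 2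
      - c ^ 2 * H ^ 2) := by
      unfold GQ.q; ring
    rw [e]; positivity
  have h2 := (pos_iff_pos_of_mul_pos this).1 k1
  exact (pos_iff_pos_of_mul_pos h2).1 (by positivity)

lemma J_half (a b c F G H : ℝ) (ha : 0 < a) (hb : 0 < b) (hc : 0 < c)
    (hF : |F| < b * c) (hH : |H| < a * b) {d D : ℝ}
    (hd : d = a ^ 2 * b ^ 2 * c ^ 2 + 2 * F * G * H - a ^ 2 * F ^ 2 - b ^ 2 * G ^ 2
      - c ^ 2 * H ^ 2) (hd0 : 0 < d) (hD : D = a * b * c + a * F + b * G + c * H) :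
    (GQ.mk (a ^ 2) (b ^ 2) (c ^ 2) F G H).J =
      ENNReal.ofReal (4 / Real.sqrt d *
        Real.arctan (Real.sqrt d / (D + Real.sqrt (D ^ 2 + d)))) := by
  have hW : 0 < Real.sqrt d := Real.sqrt_pos.2 hd0
  have hW2 : Real.sqrt d ^ 2 = d := Real.sq_sqrt hd0.le
  rw [J_closed a b c F G H (Real.sqrt d) ha hb hc hF hH hW (hW2.trans hd), half_angle _ _ hW, ← hD,
    hW2]
  congr 1
  ring

lemma J_upper (a b c F G H d D n m u : ℝ) (ha : 0 < a) (hb : 0 < b) (hc : 0 < c)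
    (hF : |F| < b * c) (hH : |H| < a * b)
    (hd : d = a ^ 2 * b ^ 2 * c ^ 2 + 2 * F * G * H - a ^ 2 * F ^ 2 - b ^ 2 * G ^ 2
      - c ^ 2 * H ^ 2) (hd0 : 0 < d) (hD : D = a * b * c + a * F + b * G + c * H)
    (hn : n ^ 2 ≤ D ^ 2 + d) (hm : D ^ 2 + d ≤ m ^ 2) (hm0 : 0 ≤ m)
    (hDn : 0 < D + n) (hu0 : 0 ≤ u) (hu : u * (D + m) ^ 2 ≤ d) :
    (GQ.mk (a ^ 2) (b ^ 2) (c ^ 2) F G H).J ≤ ENNReal.ofReal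
      (4 * ((945 + 735 * u + 64 * u ^ 2) / (945 + 1050 * u + 225 * u ^ 2)) / (D + n)) := by
  rw [J_half a b c F G H ha hb hc hF hH hd hd0 hD]
  apply ENNReal.ofReal_le_ofReal
  set W := Real.sqrt d with hWd
  have hW : 0 < W := Real.sqrt_pos.2 hd0
  have hW2 : W ^ 2 = d := Real.sq_sqrt hd0.le
  set N := Real.sqrt (D ^ 2 + d) with hN
  have h1 : n ≤ N := Real.le_sqrt_of_sq_le hn
  have h2 : N ≤ m := Real.sqrt_le_iff.2 ⟨hm0, hm⟩
  have hDN : 0 < D + N := by linarith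
  set t := W / (D + N) with ht
  have ht0 : 0 < t := by positivity
  have hut : u ≤ t ^ 2 := by
    rw [ht, div_pow, le_div_iff₀ (by positivity), hW2]
    refine le_trans ?_ hu
    gcongr
  calc 4 / W * Real.arctan t ≤ 4 / W * (t * ((945 + 735 * t ^ 2 + 64 * (t ^ 2) ^ 2) /
        (945 + 1050 * t ^ 2 + 225 * (t ^ 2) ^ 2))) := by
        gcongr; exact arctan_le_pade ht0.le
    _ ≤ 4 / W * (t * ((945 + 735 * u + 64 * u ^ 2) / (945 + 1050 * u + 225 * u ^ 2))) := by
        gcongr 4 / W * (t * ?_); exact pade_anti hu0 hut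
    _ = 4 * ((945 + 735 * u + 64 * u ^ 2) / (945 + 1050 * u + 225 * u ^ 2)) / (D + N) := by
        rw [ht]; field_simp
    _ ≤ _ := by
        gcongr

lemma pade_anti2 {u v : ℝ} (hu : 0 ≤ u) (huv : u ≤ v) :
    (105 + 55 * v) / (105 + 90 * v + 9 * v ^ 2) ≤
    (105 + 55 * u) / (105 + 90 * u + 9 * u ^ 2) := by
  have hv : 0 ≤ v := hu.trans huv
  rw [div_le_div_iff₀ (by positivity) (by positivity)]
  nlinarith [mul_nonneg hu hv, mul_nonneg (sub_nonneg.2 huv) hu, mul_nonneg (sub_nonneg.2 huv) hv,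
    mul_nonneg (sub_nonneg.2 huv) (mul_nonneg hu hv), sub_nonneg.2 huv]

lemma J_lower (a b c F G H d D m u : ℝ) (ha : 0 < a) (hb : 0 < b) (hc : 0 < c)
    (hF : |F| < b * c) (hH : |H| < a * b)
    (hd : d = a ^ 2 * b ^ 2 * c ^ 2 + 2 * F * G * H - a ^ 2 * F ^ 2 - b ^ 2 * G ^ 2
      - c ^ 2 * H ^ 2) (hd0 : 0 < d) (hD : D = a * b * c + a * F + b * G + c * H)
    (n : ℝ) (hn : n ^ 2 ≤ D ^ 2 + d) (hm : D ^ 2 + d ≤ m ^ 2) (hm0 : 0 ≤ m)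
    (hDn : 0 < D + n) (hu : d ≤ u * (D + n) ^ 2) :
    ENNReal.ofReal (4 * ((105 + 55 * u) / (105 + 90 * u + 9 * u ^ 2)) / (D + m)) ≤
    (GQ.mk (a ^ 2) (b ^ 2) (c ^ 2) F G H).J := by
  rw [J_half a b c F G H ha hb hc hF hH hd hd0 hD]
  apply ENNReal.ofReal_le_ofReal
  set W := Real.sqrt d with hWd
  have hW : 0 < W := Real.sqrt_pos.2 hd0
  have hW2 : W ^ 2 = d := Real.sq_sqrt hd0.le
  set N := Real.sqrt (D ^ 2 + d) with hN
  have h1 : n ≤ N := Real.le_sqrt_of_sq_le hn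
  have h2 : N ≤ m := Real.sqrt_le_iff.2 ⟨hm0, hm⟩
  have hDN : 0 < D + N := by linarith
  have hu0 : 0 ≤ u := by
    by_contra h
    push Not at h
    nlinarith [mul_pos hDn hDn]
  set t := W / (D + N) with ht
  have ht0 : 0 < t := by positivity
  have hut : t ^ 2 ≤ u := by
    rw [ht, div_pow, div_le_iff₀ (by positivity), hW2]
    refine le_trans hu ?_
    gcongr
  calc 4 * ((105 + 55 * u) / (105 + 90 * u + 9 * u ^ 2)) / (D + m)
      ≤ 4 * ((105 + 55 * u) / (105 + 90 * u + 9 * u ^ 2)) / (D + N) := by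
        gcongr
    _ = 4 / W * (t * ((105 + 55 * u) / (105 + 90 * u + 9 * u ^ 2))) := by
        rw [ht]; field_simp
    _ ≤ 4 / W * (t * ((105 + 55 * t ^ 2) / (105 + 90 * t ^ 2 + 9 * (t ^ 2) ^ 2))) := by
        gcongr 4 / W * (t * ?_); exact pade_anti2 (sq_nonneg t) hut
    _ ≤ _ := by
        gcongr; exact arctan_ge_pade ht0.le

abbrev E3 := EuclideanSpace ℝ (Fin 3)

/-- Gram form from the three edges at a vertex and the three opposite edges (all squared). -/
noncomputable def gr (A B C f g h : ℝ) : GQ :=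
  ⟨A, B, C, (B + C - f) / 2, (A + C - g) / 2, (A + B - h) / 2⟩

/-- The standard simplex in `ℝ × ℝ × ℝ`. -/
def stdS : Set (ℝ × ℝ × ℝ) :=
  {p | 0 ≤ p.1 ∧ 0 ≤ p.2.1 ∧ 0 ≤ p.2.2 ∧ p.1 + p.2.1 + p.2.2 ≤ 1}

lemma convex_stdS : Convex ℝ stdS := by
  rintro ⟨x1, x2, x3⟩ ⟨h1, h2, h3, h4⟩ ⟨y1, y2, y3⟩ ⟨k1, k2, k3, k4⟩ a b ha hb hab
  simp only at h1 h2 h3 h4 k1 k2 k3 k4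
  refine ⟨?_, ?_, ?_, ?_⟩ <;> simp only [Prod.smul_mk, Prod.mk_add_mk, smul_eq_mul]
  · positivity
  · positivity
  · positivity
  · nlinarith

lemma isClosed_stdS : IsClosed stdS := by
  have e : stdS = {p : ℝ × ℝ × ℝ | 0 ≤ p.1} ∩ ({p : ℝ × ℝ × ℝ | 0 ≤ p.2.1} ∩
      ({p : ℝ × ℝ × ℝ | 0 ≤ p.2.2} ∩ {p : ℝ × ℝ × ℝ | p.1 + p.2.1 + p.2.2 ≤ 1})) := by
    ext p; simp [stdS]
  rw [e]
  refine (isClosed_le (by fun_prop) (by fun_prop)).inter ((isClosed_le (by fun_prop) (by fun_prop)).inter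
    ((isClosed_le (by fun_prop) (by fun_prop)).inter (isClosed_le (by fun_prop) (by fun_prop))))

lemma volume_stdS_ne_top : volume stdS ≠ ⊤ := by
  have h : stdS ⊆ Set.Icc (0, 0, 0) (1, 1, 1) := by
    rintro ⟨x, y, z⟩ ⟨h1, h2, h3, h4⟩
    simp only at h1 h2 h3 h4
    simp only [Set.mem_Icc, Prod.mk_le_mk]
    refine ⟨⟨h1, h2, h3⟩, ?_, ?_, ?_⟩ <;> linarith
  exact ne_top_of_le_ne_top isCompact_Icc.measure_lt_top.ne (measure_mono h)

lemma volume_stdS_ne_zero : volume stdS ≠ 0 := by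
  have h : IsOpen (Set.Ioo (0:ℝ) (1/3) ×ˢ (Set.Ioo (0:ℝ) (1/3) ×ˢ Set.Ioo (0:ℝ) (1/3))) :=
    isOpen_Ioo.prod (isOpen_Ioo.prod isOpen_Ioo)
  have hne : (Set.Ioo (0:ℝ) (1/3) ×ˢ (Set.Ioo (0:ℝ) (1/3) ×ˢ Set.Ioo (0:ℝ) (1/3))).Nonempty :=
    ⟨(1/6, 1/6, 1/6), by norm_num⟩
  have := h.measure_pos volume hne
  refine (this.trans_le (measure_mono ?_)).ne'
  rintro ⟨x, y, z⟩ ⟨⟨h1, h2⟩, ⟨h3, h4⟩, ⟨h5, h6⟩⟩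
  refine ⟨h1.le, h3.le, h5.le, ?_⟩
  simp only at *
  linarith

lemma null_axes : volume ({p : ℝ × ℝ × ℝ | p.1 = 0} ∪ {p | p.2.1 = 0} ∪ {p | p.2.2 = 0}) = 0 := by
  have e1 : {p : ℝ × ℝ × ℝ | p.1 = 0} = {0} ×ˢ Set.univ := by ext p; simp
  have e2 : {p : ℝ × ℝ × ℝ | p.2.1 = 0} = Set.univ ×ˢ ({0} ×ˢ Set.univ) := by ext p; simp
  have e3 : {p : ℝ × ℝ × ℝ | p.2.2 = 0} = Set.univ ×ˢ (Set.univ ×ˢ {0}) := by ext p; simp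
  have hv : (volume : Measure (ℝ × ℝ × ℝ)) = (volume : Measure ℝ).prod ((volume : Measure ℝ).prod volume) := rfl
  refine measure_union_null (measure_union_null ?_ ?_) ?_
  · rw [e1, hv, Measure.prod_prod]; simp
  · rw [e2, hv, Measure.prod_prod, Measure.prod_prod]; simp
  · rw [e3, hv, Measure.prod_prod, Measure.prod_prod]; simp

/-- Data on one corner of a tetrahedron. -/
lemma corner (A B C D : E3) (haff : AffineIndependent ℝ ![A, B, C, D]) :
    ∃ K : ENNReal, K ≠ 0 ∧ K ≠ ⊤ ∧ volume (tetra A B C D) = K * volume stdS ∧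
    (gr (dist A B ^ 2) (dist A C ^ 2) (dist A D ^ 2) (dist C D ^ 2) (dist B D ^ 2)
      (dist B C ^ 2)).ok ∧
    ∀ r : ℝ, 0 < r →
    volume (tetra A B C D ∩ closedBall A r) ≤
      K * volume ((gr (dist A B ^ 2) (dist A C ^ 2) (dist A D ^ 2) (dist C D ^ 2) (dist B D ^ 2)
      (dist B C ^ 2)).sec r) ∧
    ((gr (dist A B ^ 2) (dist A C ^ 2) (dist A D ^ 2) (dist C D ^ 2) (dist B D ^ 2)
      (dist B C ^ 2)).sec r ⊆ stdS →
      K * volume ((gr (dist A B ^ 2) (dist A C ^ 2) (dist A D ^ 2) (dist C D ^ 2) (dist B D ^ 2)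
      (dist B C ^ 2)).sec r) ≤ volume (tetra A B C D ∩ closedBall A r)) := by
  set u := B - A with hu
  set v := C - A with hv
  set w := D - A with hw
  have hli : ∀ x y z : ℝ, x • u + y • v + z • w = 0 → x = 0 ∧ y = 0 ∧ z = 0 := by
    have h1 := (affineIndependent_iff_linearIndependent_vsub ℝ _ (0 : Fin 4)).1 haff
    have h2 := h1.comp (fun i : Fin 3 => (⟨i.succ, Fin.succ_ne_zero i⟩ : {x : Fin 4 // x ≠ 0}))
      (by intro i j h; simpa using h)
    rw [Fintype.linearIndependent_iff] at h2
    intro x y z h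
    have h3 := h2 ![x, y, z] (by
      rw [Fin.sum_univ_three]
      simpa [hu, hv, hw] using h)
    exact ⟨by simpa using h3 0, by simpa using h3 1, by simpa using h3 2⟩
  let f : ℝ × ℝ × ℝ →ₗ[ℝ] E3 :=
    (LinearMap.fst ℝ ℝ (ℝ × ℝ)).smulRight w +
      ((LinearMap.fst ℝ ℝ ℝ ∘ₗ LinearMap.snd ℝ ℝ (ℝ × ℝ)).smulRight u +
      (LinearMap.snd ℝ ℝ ℝ ∘ₗ LinearMap.snd ℝ ℝ (ℝ × ℝ)).smulRight v)
  have hf : ∀ p, f p = p.1 • w + (p.2.1 • u + p.2.2 • v) := fun p => rfl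
  have hinj : Function.Injective f := by
    rw [← LinearMap.ker_eq_bot, LinearMap.ker_eq_bot']
    rintro ⟨z, x, y⟩ h
    rw [hf] at h
    obtain ⟨h1, h2, h3⟩ := hli x y z (by rw [← h]; simp only; abel)
    simp [h1, h2, h3]
  let e0 : (ℝ × ℝ × ℝ) ≃ₗ[ℝ] E3 := LinearMap.linearEquivOfInjective f hinj (by simp)
  let e : (ℝ × ℝ × ℝ) ≃L[ℝ] E3 := e0.toContinuousLinearEquiv
  have he : ∀ p, e p = p.1 • w + (p.2.1 • u + p.2.2 • v) := fun p => rfl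
  set g := gr (dist A B ^ 2) (dist A C ^ 2) (dist A D ^ 2) (dist C D ^ 2) (dist B D ^ 2)
      (dist B C ^ 2) with hg
  have hnorm : ∀ p, ‖e p‖ ^ 2 = g.q p.2.1 p.2.2 p.1 := by
    intro p
    rw [he]
    have i1 : dist A B ^ 2 = inner ℝ u u := by
      rw [dist_comm, dist_eq_norm, real_inner_self_eq_norm_sq]
    have i2 : dist A C ^ 2 = inner ℝ v v := by
      rw [dist_comm, dist_eq_norm, real_inner_self_eq_norm_sq]
    have i3 : dist A D ^ 2 = inner ℝ w w := by
      rw [dist_comm, dist_eq_norm, real_inner_self_eq_norm_sq]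
    have i4 : dist C D ^ 2 = inner ℝ v v + inner ℝ w w - 2 * inner ℝ v w := by
      rw [dist_eq_norm, show C - D = v - w by simp [hv, hw], norm_sub_sq_real,
        ← real_inner_self_eq_norm_sq, ← real_inner_self_eq_norm_sq]; ring
    have i5 : dist B D ^ 2 = inner ℝ u u + inner ℝ w w - 2 * inner ℝ u w := by
      rw [dist_eq_norm, show B - D = u - w by simp [hu, hw], norm_sub_sq_real,
        ← real_inner_self_eq_norm_sq, ← real_inner_self_eq_norm_sq]; ring
    have i6 : dist B C ^ 2 = inner ℝ u u + inner ℝ v v - 2 * inner ℝ u v := by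
      rw [dist_eq_norm, show B - C = u - v by simp [hu, hv], norm_sub_sq_real,
        ← real_inner_self_eq_norm_sq, ← real_inner_self_eq_norm_sq]; ring
    rw [← real_inner_self_eq_norm_sq, hg]
    unfold gr GQ.q
    rw [i1, i2, i3, i4, i5, i6]
    simp only [inner_add_left, inner_add_right, real_inner_smul_left, real_inner_smul_right]
    rw [real_inner_comm u w, real_inner_comm v w, real_inner_comm u v]
    ring
  have hT : tetra A B C D = (fun p => A + e p) '' stdS := by
    apply Set.Subset.antisymm
    · apply convexHull_min
      · intro P hP
        simp only [Set.mem_insert_iff, Set.mem_singleton_iff] at hP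
        rcases hP with rfl | rfl | rfl | rfl
        · exact ⟨(0, 0, 0), by simp [stdS], by beta_reduce; rw [he]; simp⟩
        · exact ⟨(0, 1, 0), by simp [stdS], by beta_reduce; rw [he]; simp [hu]⟩
        · exact ⟨(0, 0, 1), by simp [stdS], by beta_reduce; rw [he]; simp [hv]⟩
        · exact ⟨(1, 0, 0), by simp [stdS], by beta_reduce; rw [he]; simp [hw]⟩
      · have h1 := (convex_stdS.linear_image e.toLinearMap).translate A
        have h2 : (fun p => A + e p) '' stdS = (fun z => A + z) '' (e.toLinearMap '' stdS) := by
          rw [Set.image_image]; rfl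
        rw [h2]; exact h1
    · rintro _ ⟨⟨z, x, y⟩, ⟨h1, h2, h3, h4⟩, rfl⟩
      simp only at h1 h2 h3 h4
      have hc := (convex_convexHull ℝ ({A, B, C, D} : Set E3)).sum_mem (t := Finset.univ)
        (w := ![1 - x - y - z, x, y, z]) (z := ![A, B, C, D]) ?_ ?_ ?_
      · have : A + e (z, x, y) = ∑ i, ![1 - x - y - z, x, y, z] i • ![A, B, C, D] i := by
          rw [Fin.sum_univ_four, he]
          simp [hu, hv, hw, sub_smul, smul_sub]
          abel
        show A + e (z, x, y) ∈ _
        rw [this]; exact hc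
      · intro i _
        fin_cases i <;> simp <;> linarith
      · rw [Fin.sum_univ_four]; simp; ring
      · intro i _
        apply subset_convexHull
        fin_cases i <;> simp
  -- Haar measure
  have hH0 : (volume : Measure (ℝ × ℝ × ℝ)).IsAddHaarMeasure := by
    have h1 : ((volume : Measure ℝ).prod (volume : Measure (ℝ × ℝ))).IsAddHaarMeasure := inferInstance
    exact h1
  have hH : ((volume : Measure (ℝ × ℝ × ℝ)).map e).IsAddHaarMeasure :=
    e.isAddHaarMeasure_map volume
  have hmap : (volume : Measure (ℝ × ℝ × ℝ)).map e =
      ((volume : Measure (ℝ × ℝ × ℝ)).map e).addHaarScalarFactor (volume : Measure E3) • (volume : Measure E3) :=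
    Measure.isAddLeftInvariant_eq_smul _ _
  have hk0 := Measure.addHaarScalarFactor_pos_of_isAddHaarMeasure
    ((volume : Measure (ℝ × ℝ × ℝ)).map e) (volume : Measure E3)
  set k := ((volume : Measure (ℝ × ℝ × ℝ)).map e).addHaarScalarFactor (volume : Measure E3)
  have hvol : ∀ s : Set (ℝ × ℝ × ℝ), volume ((fun p => A + e p) '' s) = (k : ENNReal)⁻¹ * volume s := by
    intro s
    have h1 : (fun p => A + e p) '' s = (fun P => A + P) '' (e '' s) := by
      rw [Set.image_image]
    have h2 : volume ((fun p => A + e p) '' s) = volume (e '' s) := by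
      rw [h1, Set.image_add_left, measure_preimage_add]
    have h3 : (volume : Measure (ℝ × ℝ × ℝ)).map e (e '' s) = volume s := by
      have := e.toHomeomorph.toMeasurableEquiv.map_apply (μ := (volume : Measure (ℝ × ℝ × ℝ))) (e '' s)
      have h4 : (e.toHomeomorph.toMeasurableEquiv : (ℝ × ℝ × ℝ) → E3) = e := rfl
      rw [h4] at this
      rw [this, Set.preimage_image_eq _ e.injective]
    rw [h2, ← h3, hmap, Measure.smul_apply]
    have : (k • volume (e '' s) : ENNReal) = (k : ENNReal) * volume (e '' s) := rfl
    rw [this, ← mul_assoc, ENNReal.inv_mul_cancel (by simpa using hk0.ne') (by simp), one_mul]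
  refine ⟨(k : ENNReal)⁻¹, by simp, by simpa using hk0.ne', by rw [hT, hvol], ?_, ?_⟩
  · intro x y hx hy
    have h1 := hnorm (1, x, y)
    simp only at h1
    rw [← h1]
    have : e (1, x, y) ≠ 0 := by
      intro h
      have := e.injective (h.trans (map_zero e).symm)
      simp at this
    positivity
  · intro r hr
    have hball : ∀ p, A + e p ∈ closedBall A r ↔ g.q p.2.1 p.2.2 p.1 ≤ r ^ 2 := by
      intro p
      rw [mem_closedBall, dist_eq_norm, add_sub_cancel_left, ← hnorm]
      exact (sq_le_sq₀ (norm_nonneg _) hr.le).symm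
    have hTi : tetra A B C D ∩ closedBall A r =
        (fun p => A + e p) '' (stdS ∩ {p | g.q p.2.1 p.2.2 p.1 ≤ r ^ 2}) := by
      ext P
      constructor
      · rintro ⟨h1, h2⟩
        rw [hT] at h1
        obtain ⟨p, hp, rfl⟩ := h1
        exact ⟨p, ⟨hp, by simpa using (hball p).1 h2⟩, rfl⟩
      · rintro ⟨p, ⟨hp, hp2⟩, rfl⟩
        exact ⟨by rw [hT]; exact ⟨p, hp, rfl⟩, (hball p).2 (by simpa using hp2)⟩
    rw [hTi, hvol]
    constructor
    · gcongr 1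
      calc volume (stdS ∩ {p | g.q p.2.1 p.2.2 p.1 ≤ r ^ 2}) ≤ volume (g.sec r ∪
          ({p : ℝ × ℝ × ℝ | p.1 = 0} ∪ {p | p.2.1 = 0} ∪ {p | p.2.2 = 0})) := by
            apply measure_mono
            rintro p ⟨⟨h1, h2, h3, h4⟩, h5⟩
            simp only [Set.mem_ofPred_eq] at h5
            simp only [Set.mem_union, GQ.sec, Set.mem_ofPred_eq]
            rcases h1.eq_or_lt with k1 | k1
            · right; left; left; exact k1.symm
            rcases h2.eq_or_lt with k2 | k2
            · right; left; right; exact k2.symm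
            rcases h3.eq_or_lt with k3 | k3
            · right; right; exact k3.symm
            left; exact ⟨k1, k2, k3, h5⟩
        _ ≤ volume (g.sec r) + volume ({p : ℝ × ℝ × ℝ | p.1 = 0} ∪ {p | p.2.1 = 0} ∪ {p | p.2.2 = 0}) :=
            measure_union_le _ _
        _ = _ := by rw [null_axes, add_zero]
    · intro hs
      gcongr 1
      apply measure_mono
      intro p hp
      refine ⟨hs hp, ?_⟩
      simp only [GQ.sec, Set.mem_ofPred_eq] at hp
      simpa using hp.2.2.2

/-- Weighted sum of the solid angle integrals as a function of the squared edge lengths. -/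
noncomputable def Psi (ra rb rc rd : ℝ) (x : Fin 6 → ℝ) : ENNReal :=
  ENNReal.ofReal (ra ^ 3) * (gr (x 0) (x 1) (x 2) (x 5) (x 4) (x 3)).J +
  ENNReal.ofReal (rb ^ 3) * (gr (x 0) (x 3) (x 4) (x 5) (x 2) (x 1)).J +
  ENNReal.ofReal (rc ^ 3) * (gr (x 1) (x 3) (x 5) (x 4) (x 2) (x 0)).J +
  ENNReal.ofReal (rd ^ 3) * (gr (x 2) (x 4) (x 5) (x 3) (x 1) (x 0)).J

/-- Squared edge lengths. -/
noncomputable def edges (A B C D : E3) : Fin 6 → ℝ :=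
  ![dist A B ^ 2, dist A C ^ 2, dist A D ^ 2, dist B C ^ 2, dist B D ^ 2, dist C D ^ 2]

lemma aff_swap1 {A B C D : E3} (h : AffineIndependent ℝ ![A, B, C, D]) :
    AffineIndependent ℝ ![B, A, C, D] := by
  have := h.comp_embedding (Equiv.swap (0 : Fin 4) 1).toEmbedding
  convert this using 1
  ext i; fin_cases i <;> rfl

lemma aff_swap2 {A B C D : E3} (h : AffineIndependent ℝ ![A, B, C, D]) :
    AffineIndependent ℝ ![A, C, B, D] := by
  have := h.comp_embedding (Equiv.swap (1 : Fin 4) 2).toEmbedding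
  convert this using 1
  ext i; fin_cases i <;> rfl

lemma aff_swap3 {A B C D : E3} (h : AffineIndependent ℝ ![A, B, C, D]) :
    AffineIndependent ℝ ![A, B, D, C] := by
  have := h.comp_embedding (Equiv.swap (2 : Fin 4) 3).toEmbedding
  convert this using 1
  ext i; fin_cases i <;> rfl

lemma tetra_swap1 (A B C D : E3) : tetra B A C D = tetra A B C D := by
  unfold tetra; congr 1; ext P; simp only [Set.mem_insert_iff, Set.mem_singleton_iff]; tauto

lemma tetra_swap2 (A B C D : E3) : tetra A C B D = tetra A B C D := by
  unfold tetra; congr 1; ext P; simp only [Set.mem_insert_iff, Set.mem_singleton_iff]; tauto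

lemma tetra_swap3 (A B C D : E3) : tetra A B D C = tetra A B C D := by
  unfold tetra; congr 1; ext P; simp only [Set.mem_insert_iff, Set.mem_singleton_iff]; tauto

/-- One corner in terms of `J`. -/
lemma corner' (A B C D : E3) (haff : AffineIndependent ℝ ![A, B, C, D]) (r : ℝ) (hr : 0 < r)
    (g : GQ) (hg : g = gr (dist A B ^ 2) (dist A C ^ 2) (dist A D ^ 2) (dist C D ^ 2) (dist B D ^ 2)
      (dist B C ^ 2)) :
    volume (tetra A B C D) ≠ 0 ∧ volume (tetra A B C D) ≠ ⊤ ∧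
    volume (tetra A B C D ∩ closedBall A r) * (3 * volume stdS) ≤
      volume (tetra A B C D) * (ENNReal.ofReal (r ^ 3) * g.J) ∧
    (g.sec r ⊆ stdS → volume (tetra A B C D) * (ENNReal.ofReal (r ^ 3) * g.J) ≤
      volume (tetra A B C D ∩ closedBall A r) * (3 * volume stdS)) := by
  obtain ⟨K, hK0, hK1, hT, hok, hb⟩ := corner A B C D haff
  rw [← hg] at hok hb
  obtain ⟨h1, h2⟩ := hb r hr
  have e : K * volume (g.sec r) * (3 * volume stdS) =
      volume (tetra A B C D) * (ENNReal.ofReal (r ^ 3) * g.J) := by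
    rw [g.volume_sec r hr hok, hT]
    have : ENNReal.ofReal (r ^ 3) = ENNReal.ofReal (r ^ 3 / 3) * 3 := by
      rw [show (3 : ENNReal) = ENNReal.ofReal 3 by simp, ← ENNReal.ofReal_mul (by positivity)]
      congr 1; ring
    rw [this]; ring
  refine ⟨?_, ?_, ?_, ?_⟩
  · rw [hT]; exact mul_ne_zero hK0 volume_stdS_ne_zero
  · rw [hT]; exact ENNReal.mul_ne_top hK1 volume_stdS_ne_top
  · rw [← e]; gcongr
  · intro hs
    rw [← e]; gcongr; exact h2 hs

lemma corners (A B C D : E3) (haff : AffineIndependent ℝ ![A, B, C, D]) (ra rb rc rd : ℝ)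
    (ha : 0 < ra) (hb : 0 < rb) (hc : 0 < rc) (hd : 0 < rd) (x : Fin 6 → ℝ) (hx : x = edges A B C D) :
    volume (tetra A B C D) ≠ 0 ∧ volume (tetra A B C D) ≠ ⊤ ∧
    volume (tetra A B C D ∩
      (closedBall A ra ∪ closedBall B rb ∪ closedBall C rc ∪ closedBall D rd)) * (3 * volume stdS) ≤
      volume (tetra A B C D) * Psi ra rb rc rd x ∧
    ((gr (x 0) (x 1) (x 2) (x 5) (x 4) (x 3)).sec ra ⊆ stdS →
      (gr (x 0) (x 3) (x 4) (x 5) (x 2) (x 1)).sec rb ⊆ stdS →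
      (gr (x 1) (x 3) (x 5) (x 4) (x 2) (x 0)).sec rc ⊆ stdS →
      (gr (x 2) (x 4) (x 5) (x 3) (x 1) (x 0)).sec rd ⊆ stdS →
      volume (tetra A B C D) * Psi ra rb rc rd x ≤
        (volume (tetra A B C D ∩ closedBall A ra) + volume (tetra A B C D ∩ closedBall B rb) +
        volume (tetra A B C D ∩ closedBall C rc) + volume (tetra A B C D ∩ closedBall D rd)) *
        (3 * volume stdS)) := by
  have xe : x 0 = dist A B ^ 2 ∧ x 1 = dist A C ^ 2 ∧ x 2 = dist A D ^ 2 ∧ x 3 = dist B C ^ 2 ∧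
    x 4 = dist B D ^ 2 ∧ x 5 = dist C D ^ 2 := by
    rw [hx]; exact ⟨rfl, rfl, rfl, rfl, rfl, rfl⟩
  obtain ⟨x0, x1, x2, x3, x4, x5⟩ := xe
  obtain ⟨h0, ht, hA1, hA2⟩ := corner' A B C D haff ra ha
    (gr (x 0) (x 1) (x 2) (x 5) (x 4) (x 3)) (by rw [x0, x1, x2, x3, x4, x5])
  obtain ⟨-, -, hB1, hB2⟩ := corner' B A C D (aff_swap1 haff) rb hb
    (gr (x 0) (x 3) (x 4) (x 5) (x 2) (x 1)) (by rw [x0, x1, x2, x3, x4, x5, dist_comm A B])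
  obtain ⟨-, -, hC1, hC2⟩ := corner' C A B D (aff_swap1 (aff_swap2 haff)) rc hc
    (gr (x 1) (x 3) (x 5) (x 4) (x 2) (x 0))
    (by rw [x0, x1, x2, x3, x4, x5, dist_comm A C, dist_comm B C])
  obtain ⟨-, -, hD1, hD2⟩ := corner' D A B C (aff_swap1 (aff_swap2 (aff_swap3 haff))) rd hd
    (gr (x 2) (x 4) (x 5) (x 3) (x 1) (x 0))
    (by rw [x0, x1, x2, x3, x4, x5, dist_comm A D, dist_comm B D, dist_comm C D])
  rw [tetra_swap1] at hB1 hB2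
  rw [tetra_swap1, tetra_swap2] at hC1 hC2
  rw [tetra_swap1, tetra_swap2, tetra_swap3] at hD1 hD2
  refine ⟨h0, ht, ?_, ?_⟩
  · unfold Psi
    calc _ ≤ (volume (tetra A B C D ∩ closedBall A ra) + volume (tetra A B C D ∩ closedBall B rb) +
        volume (tetra A B C D ∩ closedBall C rc) + volume (tetra A B C D ∩ closedBall D rd)) *
        (3 * volume stdS) := by
          gcongr
          rw [Set.inter_union_distrib_left, Set.inter_union_distrib_left,
            Set.inter_union_distrib_left]
          refine (measure_union_le _ _).trans ?_
          gcongr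
          refine (measure_union_le _ _).trans ?_
          gcongr
          exact measure_union_le _ _
      _ ≤ _ := by
          simp only [add_mul, mul_add]
          gcongr
  · intro k1 k2 k3 k4
    unfold Psi
    simp only [add_mul, mul_add]
    have := hA2 k1
    have := hB2 k2
    have := hC2 k3
    have := hD2 k4
    gcongr

lemma vol_union (A B C D : E3) (ra rb rc rd : ℝ) (ha : 0 < ra) (hb : 0 < rb) (hc : 0 < rc)
    (hd : 0 < rd) (hAB : ra + rb ≤ dist A B) (hAC : ra + rc ≤ dist A C) (hAD : ra + rd ≤ dist A D)
    (hBC : rb + rc ≤ dist B C) (hBD : rb + rd ≤ dist B D) (hCD : rc + rd ≤ dist C D) :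
    volume (tetra A B C D ∩ closedBall A ra) + volume (tetra A B C D ∩ closedBall B rb) +
        volume (tetra A B C D ∩ closedBall C rc) + volume (tetra A B C D ∩ closedBall D rd) ≤
    volume (tetra A B C D ∩
      (closedBall A ra ∪ closedBall B rb ∪ closedBall C rc ∪ closedBall D rd)) := by
  have hTm : MeasurableSet (tetra A B C D) := by
    apply IsCompact.measurableSet
    exact Set.Finite.isCompact_convexHull ℝ (by simp)
  have hcb : ∀ (P : E3) (r : ℝ), 0 < r → volume (tetra A B C D ∩ closedBall P r) ≤
      volume (tetra A B C D ∩ ball P r) := by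
    intro P r hr
    calc volume (tetra A B C D ∩ closedBall P r) ≤
        volume ((tetra A B C D ∩ ball P r) ∪ sphere P r) := by
          apply measure_mono
          rintro Q ⟨h1, h2⟩
          rcases (mem_closedBall.1 h2).eq_or_lt with h | h
          · right; exact h
          · left; exact ⟨h1, h⟩
      _ ≤ _ := (measure_union_le _ _).trans (by
          rw [Measure.addHaar_sphere_of_ne_zero _ _ hr.ne', add_zero])
  have hm : ∀ (P : E3) (r : ℝ), MeasurableSet (tetra A B C D ∩ ball P r) :=
    fun P r => hTm.inter measurableSet_ball
  have hdis : ∀ (P Q : E3) (r s : ℝ), r + s ≤ dist P Q →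
      Disjoint (tetra A B C D ∩ ball P r) (tetra A B C D ∩ ball Q s) :=
    fun P Q r s h => (ball_disjoint_ball h).mono Set.inter_subset_right Set.inter_subset_right
  calc _ ≤ volume (tetra A B C D ∩ ball A ra) + volume (tetra A B C D ∩ ball B rb) +
        volume (tetra A B C D ∩ ball C rc) + volume (tetra A B C D ∩ ball D rd) := by
        exact add_le_add (add_le_add (add_le_add (hcb _ _ ha) (hcb _ _ hb)) (hcb _ _ hc)) (hcb _ _ hd)
    _ = volume ((tetra A B C D ∩ ball A ra) ∪ (tetra A B C D ∩ ball B rb) ∪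
        (tetra A B C D ∩ ball C rc) ∪ (tetra A B C D ∩ ball D rd)) := by
        rw [measure_union _ (hm _ _), measure_union _ (hm _ _), measure_union _ (hm _ _)]
        · exact hdis _ _ _ _ hAB
        · rw [Set.disjoint_union_left]
          exact ⟨hdis _ _ _ _ hAC, hdis _ _ _ _ hBC⟩
        · rw [Set.disjoint_union_left, Set.disjoint_union_left]
          exact ⟨⟨hdis _ _ _ _ hAD, hdis _ _ _ _ hBD⟩, hdis _ _ _ _ hCD⟩
    _ ≤ _ := by
        rw [← Set.inter_union_distrib_left, ← Set.inter_union_distrib_left,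
          ← Set.inter_union_distrib_left]
        gcongr <;> exact ball_subset_closedBall

/-- The squared edge lengths of the optimal tetrahedron. -/
noncomputable def X0 : Fin 6 → ℝ := ![32 * (3 - Real.sqrt 2) / 7, 4, 2, 4, 2, 2]

lemma sec_sub {g : GQ} {r : ℝ} (hr : 0 < r)
    (h : ∀ x y z : ℝ, 0 < x → 0 < y → 0 < z → r ^ 2 * (x + y + z) ^ 2 ≤ g.q x y z) :
    g.sec r ⊆ stdS := by
  rintro ⟨z, x, y⟩ hp
  simp only [GQ.sec, Set.mem_ofPred_eq] at hp
  obtain ⟨hz, hx, hy, hq⟩ := hp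
  refine ⟨hz.le, hx.le, hy.le, ?_⟩
  have h1 := (h x y z hx hy hz).trans hq
  have h2 : (x + y + z) ^ 2 ≤ 1 := by
    have : 0 < r ^ 2 := by positivity
    by_contra hh
    push Not at hh
    nlinarith
  simp only
  nlinarith

lemma lower_T0 (A B C D : E3) (haff : AffineIndependent ℝ ![A, B, C, D])
    (hAB : dist A B =
      4 * Real.sqrt (2 * (Real.sqrt 2 - 1) / (1 + 2 * (Real.sqrt 2 - 1))))
    (hAC : dist A C = 2) (hBC : dist B C = 2)
    (hAD : dist A D = 1 + (Real.sqrt 2 - 1)) (hBD : dist B D = 1 + (Real.sqrt 2 - 1))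
    (hCD : dist C D = 1 + (Real.sqrt 2 - 1)) :
    volume (tetra A B C D) ≠ 0 ∧ volume (tetra A B C D) ≠ ⊤ ∧
    volume (tetra A B C D) * Psi 1 1 1 (Real.sqrt 2 - 1) X0 ≤
    volume (tetra A B C D ∩
      (closedBall A 1 ∪ closedBall B 1 ∪ closedBall C 1 ∪ closedBall D (Real.sqrt 2 - 1))) *
      (3 * volume stdS) := by
  set s := Real.sqrt 2 with hs
  have hs2 : s ^ 2 = 2 := Real.sq_sqrt (by norm_num)
  have hs0 : 0 ≤ s := Real.sqrt_nonneg 2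
  have hs1 : 1.41421 < s := by nlinarith
  have hs3 : s < 1.41422 := by nlinarith
  have hr : 0 < s - 1 := by linarith
  have hL : dist A B ^ 2 = 32 * (3 - s) / 7 := by
    rw [hAB, mul_pow, Real.sq_sqrt (div_nonneg (by linarith) (by linarith))]
    have : 1 + 2 * (s - 1) ≠ 0 := by linarith
    field_simp
    nlinarith
  have hx : X0 = edges A B C D := by
    unfold X0 edges
    rw [hL, hAC, hBC, hAD, hBD, hCD, ← hs]
    have : (1 + (s - 1)) ^ 2 = 2 := by rw [← hs2]; ring
    rw [this]; norm_num
  obtain ⟨h0, ht, -, h⟩ := corners A B C D haff 1 1 1 (s - 1) one_pos one_pos one_pos hr X0 hx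
  refine ⟨h0, ht, ?_⟩
  have hABge : 1 + 1 ≤ dist A B := by
    have : (2:ℝ) ^ 2 ≤ dist A B ^ 2 := by rw [hL]; linarith
    have := abs_le_of_sq_le_sq this dist_nonneg
    linarith [(abs_le.1 this).2]
  refine (h ?_ ?_ ?_ ?_).trans ?_
  · apply sec_sub one_pos
    intro x y z hx hy hz
    unfold gr GQ.q X0
    simp only [Matrix.cons_val]
    have p1 := mul_pos hx hy
    have p2 := mul_pos hx hz
    have p3 := mul_pos hy hz
    rw [← hs]
    nlinarith [mul_pos hx hx, mul_pos hy hy, mul_pos hz hz, mul_pos p1 (by linarith : 0 < 1.5 - s),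
      mul_pos p2 (by linarith : 0 < 1.5 - s), mul_pos (mul_pos hx hx) (by linarith : 0 < 1.5 - s)]
  · apply sec_sub one_pos
    intro x y z hx hy hz
    unfold gr GQ.q X0
    simp only [Matrix.cons_val]
    have p1 := mul_pos hx hy
    have p2 := mul_pos hx hz
    have p3 := mul_pos hy hz
    rw [← hs]
    nlinarith [mul_pos hx hx, mul_pos hy hy, mul_pos hz hz, mul_pos p1 (by linarith : 0 < 1.5 - s),
      mul_pos p2 (by linarith : 0 < 1.5 - s), mul_pos (mul_pos hx hx) (by linarith : 0 < 1.5 - s)]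
  · apply sec_sub one_pos
    intro x y z hx hy hz
    unfold gr GQ.q X0
    simp only [Matrix.cons_val]
    have p1 := mul_pos hx hy
    have p2 := mul_pos hx hz
    have p3 := mul_pos hy hz
    rw [← hs]
    nlinarith [mul_pos hx hx, mul_pos hy hy, mul_pos hz hz, mul_pos p1 (by linarith : 0 < s - 1.4),
      sq_nonneg (x - y)]
  · apply sec_sub hr
    intro x y z hx hy hz
    unfold gr GQ.q X0
    simp only [Matrix.cons_val]
    rw [← hs]
    have hk : 0 < 2 - (s - 1) ^ 2 := by nlinarith
    have h2 : 0 ≤ (2 - (s - 1) ^ 2) * ((2 * x ^ 2 + 2 * y ^ 2 + 2 * z ^ 2 + 2 * ((2 + 4 - 4) / 2 * 0 * (y * z) + (2 - 32 * (3 - s) / 7 / 2) * (x * y))) - (s - 1) ^ 2 * (x + y + z) ^ 2) := by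
      have e : (2 - (s - 1) ^ 2) * ((2 * x ^ 2 + 2 * y ^ 2 + 2 * z ^ 2 + 2 * ((2 + 4 - 4) / 2 * 0 * (y * z) + (2 - 32 * (3 - s) / 7 / 2) * (x * y))) - (s - 1) ^ 2 * (x + y + z) ^ 2) =
        ((2 - (s - 1) ^ 2) * z - (s - 1) ^ 2 * (x + y)) ^ 2 + (2 - (s - 1) ^ 2) * (2 - (2 - 32 * (3 - s) / 7 / 2)) / 2 * (x - y) ^ 2 := by
        have h3 : s ^ 3 = 2 * s := by rw [pow_succ, hs2]
        have h4 : s ^ 4 = 4 := by rw [show s ^ 4 = (s ^ 2) ^ 2 by ring, hs2]; norm_num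
        ring_nf
        rw [h3, hs2]
        try rw [h4]
        ring
      rw [e]
      have : 0 ≤ (2 - (2 - 32 * (3 - s) / 7 / 2)) := by linarith
      positivity
    have h3 := nonneg_of_mul_nonneg_right h2 hk
    linarith
  · gcongr
    exact vol_union A B C D 1 1 1 (s - 1) one_pos one_pos one_pos hr hABge (by linarith)
      (by linarith) (by linarith) (by linarith) (by linarith)

lemma density_le_of_Psi (A B C D A₀ B₀ C₀ D₀ : E3) (ra rb rc rd : ℝ)
    (ha : 0 < ra) (hb : 0 < rb) (hc : 0 < rc) (hd : 0 < rd)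
    (haff : AffineIndependent ℝ ![A, B, C, D])
    (haff₀ : AffineIndependent ℝ ![A₀, B₀, C₀, D₀])
    (hAB₀ : dist A₀ B₀ =
      4 * Real.sqrt (2 * (Real.sqrt 2 - 1) / (1 + 2 * (Real.sqrt 2 - 1))))
    (hAC₀ : dist A₀ C₀ = 2) (hBC₀ : dist B₀ C₀ = 2)
    (hAD₀ : dist A₀ D₀ = 1 + (Real.sqrt 2 - 1)) (hBD₀ : dist B₀ D₀ = 1 + (Real.sqrt 2 - 1))
    (hCD₀ : dist C₀ D₀ = 1 + (Real.sqrt 2 - 1))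
    (hPsi : Psi ra rb rc rd (edges A B C D) ≤ Psi 1 1 1 (Real.sqrt 2 - 1) X0) :
    density A B C D ra rb rc rd ≤ density A₀ B₀ C₀ D₀ 1 1 1 (Real.sqrt 2 - 1) := by
  obtain ⟨t0, tt, h1, -⟩ := corners A B C D haff ra rb rc rd ha hb hc hd _ rfl
  obtain ⟨s0, st, h2⟩ := lower_T0 A₀ B₀ C₀ D₀ haff₀ hAB₀ hAC₀ hBC₀ hAD₀ hBD₀ hCD₀
  unfold density
  rw [← ENNReal.toReal_div, ← ENNReal.toReal_div]
  have hfin : volume (tetra A₀ B₀ C₀ D₀ ∩ (closedBall A₀ 1 ∪ closedBall B₀ 1 ∪ closedBall C₀ 1 ∪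
      closedBall D₀ (Real.sqrt 2 - 1))) ≠ ⊤ :=
    ne_top_of_le_ne_top st (measure_mono Set.inter_subset_left)
  apply ENNReal.toReal_mono (ENNReal.div_ne_top hfin s0)
  rw [ENNReal.div_le_iff t0 tt, ← ENNReal.mul_div_right_comm, ENNReal.le_div_iff_mul_le (Or.inl s0) (Or.inl st)]
  have hk0 : 3 * volume stdS ≠ 0 := mul_ne_zero (by norm_num) volume_stdS_ne_zero
  have hkt : 3 * volume stdS ≠ ⊤ := ENNReal.mul_ne_top (by norm_num) volume_stdS_ne_top
  rw [← ENNReal.mul_le_mul_iff_left hk0 hkt]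
  calc _ = volume (tetra A B C D ∩
      (closedBall A ra ∪ closedBall B rb ∪ closedBall C rc ∪ closedBall D rd)) * (3 * volume stdS)
        * volume (tetra A₀ B₀ C₀ D₀) := by ring
    _ ≤ volume (tetra A B C D) * Psi 1 1 1 (Real.sqrt 2 - 1) X0 * volume (tetra A₀ B₀ C₀ D₀) := by
        refine mul_le_mul_left (h1.trans ?_) _
        exact mul_le_mul_right hPsi _
    _ = volume (tetra A₀ B₀ C₀ D₀) * Psi 1 1 1 (Real.sqrt 2 - 1) X0 * volume (tetra A B C D) := by ring
    _ ≤ _ := by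
        refine (mul_le_mul_left h2 _).trans (le_of_eq ?_)
        ring

lemma sqrt2_bounds : 1.4142135 < Real.sqrt 2 ∧ Real.sqrt 2 < 1.4142136 := by
  have hs2 : Real.sqrt 2 ^ 2 = 2 := Real.sq_sqrt (by norm_num)
  have hs0 : 0 ≤ Real.sqrt 2 := Real.sqrt_nonneg 2
  constructor <;> nlinarith

/-- Numerical lower bound for one corner of the optimal tetrahedron. -/
lemma J_lower' (g : GQ) (hok : g.ok) (a b c F G H n m u v : ℝ) (ha : 0 < a) (hb : 0 < b) (hc : 0 < c)
    (hl : g.leq (GQ.mk (a ^ 2) (b ^ 2) (c ^ 2) F G H))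
    (hF : |F| < b * c) (hH : |H| < a * b)
    (hd0 : 0 < a ^ 2 * b ^ 2 * c ^ 2 + 2 * F * G * H - a ^ 2 * F ^ 2 - b ^ 2 * G ^ 2
      - c ^ 2 * H ^ 2)
    (hn : n ^ 2 ≤ (a * b * c + a * F + b * G + c * H) ^ 2 + (a ^ 2 * b ^ 2 * c ^ 2 + 2 * F * G * H
      - a ^ 2 * F ^ 2 - b ^ 2 * G ^ 2 - c ^ 2 * H ^ 2))
    (hm : (a * b * c + a * F + b * G + c * H) ^ 2 + (a ^ 2 * b ^ 2 * c ^ 2 + 2 * F * G * H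
      - a ^ 2 * F ^ 2 - b ^ 2 * G ^ 2 - c ^ 2 * H ^ 2) ≤ m ^ 2) (hm0 : 0 ≤ m)
    (hDn : 0 < (a * b * c + a * F + b * G + c * H) + n)
    (hu : a ^ 2 * b ^ 2 * c ^ 2 + 2 * F * G * H - a ^ 2 * F ^ 2 - b ^ 2 * G ^ 2
      - c ^ 2 * H ^ 2 ≤ u * ((a * b * c + a * F + b * G + c * H) + n) ^ 2)
    (hv : v ≤ 4 * ((105 + 55 * u) / (105 + 90 * u + 9 * u ^ 2)) /
      ((a * b * c + a * F + b * G + c * H) + m)) :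
    ENNReal.ofReal v ≤ g.J :=
  (ENNReal.ofReal_le_ofReal hv).trans ((J_lower a b c F G H _ _ m u ha hb hc hF hH rfl hd0 rfl n hn hm
    hm0 hDn hu).trans (hl.J_le hok))

lemma Psi_X0_lower : ENNReal.ofReal 0.40605 ≤ Psi 1 1 1 (Real.sqrt 2 - 1) X0 := by
  obtain ⟨s1, s2⟩ := sqrt2_bounds
  have hs2 : Real.sqrt 2 ^ 2 = 2 := Real.sq_sqrt (by norm_num)
  have hA : ENNReal.ofReal 0.078704 ≤ (gr (X0 0) (X0 1) (X0 2) (X0 5) (X0 4) (X0 3)).J := by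
    apply J_lower' _ _ 2.692455 2 1.414214 2 3.624655 3.624655 25.429231 25.429232 0.001055 0.078704 <;>
      try norm_num [abs_lt]
    · unfold gr GQ.leq X0
      simp only [Matrix.cons_val]
      refine ⟨?_, ?_, ?_, ?_, ?_, ?_⟩ <;> norm_num <;> linarith
    · intro x y hx hy
      unfold gr GQ.q X0
      simp only [Matrix.cons_val]
      have : 0 < 3 - Real.sqrt 2 := by linarith
      ring_nf
      nlinarith [mul_pos hx hy, mul_pos (mul_pos hx hx) this, mul_pos hx this,
        mul_pos (mul_pos hx hy) this]
  have hB : ENNReal.ofReal 0.078704 ≤ (gr (X0 0) (X0 3) (X0 4) (X0 5) (X0 2) (X0 1)).J := hA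
  have hC : ENNReal.ofReal 0.140337 ≤ (gr (X0 1) (X0 3) (X0 5) (X0 4) (X0 2) (X0 0)).J := by
    apply J_lower' _ _ 2 2 1.414214 2 2 0.375346 14.283247 14.283248 0.003357 0.140337 <;>
      try norm_num [abs_lt]
    · unfold gr GQ.leq X0
      simp only [Matrix.cons_val]
      refine ⟨?_, ?_, ?_, ?_, ?_, ?_⟩ <;> norm_num <;> linarith
    · intro x y hx hy
      unfold gr GQ.q X0
      simp only [Matrix.cons_val]
      have : 0 < Real.sqrt 2 - 1.4 := by linarith
      nlinarith [mul_pos hx hy, mul_pos hx hx, mul_pos (mul_pos hx hy) this]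
  have hD : ENNReal.ofReal 1.526738 ≤ (gr (X0 2) (X0 4) (X0 5) (X0 3) (X0 1) (X0 0)).J := by
    apply J_lower' _ _ 1.414214 1.414214 1.414214 0 0 (-1.624654) 1.732853 1.732854 0.53101 1.526738 <;>
      try norm_num [abs_lt]
    · unfold gr GQ.leq X0
      simp only [Matrix.cons_val]
      refine ⟨?_, ?_, ?_, ?_, ?_, ?_⟩ <;> norm_num <;> linarith
    · intro x y hx hy
      unfold gr GQ.q X0
      simp only [Matrix.cons_val]
      have : 0 < Real.sqrt 2 - 1.4 := by linarith
      nlinarith [mul_pos hx hy, sq_nonneg (x - y), mul_pos (mul_pos hx hy) this]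
  have hr : 0.071067 ≤ (Real.sqrt 2 - 1) ^ 3 := by
    have : (Real.sqrt 2 - 1) ^ 3 = 5 * Real.sqrt 2 - 7 := by
      have : Real.sqrt 2 ^ 3 = 2 * Real.sqrt 2 := by rw [pow_succ, hs2]
      linear_combination this - 3 * hs2
    rw [this]; linarith
  unfold Psi
  simp only [one_pow, ENNReal.ofReal_one, one_mul]
  calc ENNReal.ofReal 0.40605 ≤ ENNReal.ofReal 0.078704 + ENNReal.ofReal 0.078704 +
      ENNReal.ofReal 0.140337 + ENNReal.ofReal 0.071067 * ENNReal.ofReal 1.526738 := by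
        rw [← ENNReal.ofReal_mul (by norm_num), ← ENNReal.ofReal_add (by norm_num) (by norm_num),
          ← ENNReal.ofReal_add (by norm_num) (by norm_num),
          ← ENNReal.ofReal_add (by norm_num) (by norm_num)]
        apply ENNReal.ofReal_le_ofReal; norm_num
    _ ≤ _ := by gcongr

/-- All four corner forms are positive on the positive octant. -/
def okAll (x : Fin 6 → ℝ) : Prop :=
  (gr (x 0) (x 1) (x 2) (x 5) (x 4) (x 3)).ok ∧ (gr (x 0) (x 3) (x 4) (x 5) (x 2) (x 1)).ok ∧
  (gr (x 1) (x 3) (x 5) (x 4) (x 2) (x 0)).ok ∧ (gr (x 2) (x 4) (x 5) (x 3) (x 1) (x 0)).ok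

lemma X0_ok : okAll X0 := by
  obtain ⟨s1, s2⟩ := sqrt2_bounds
  have hA : (gr (X0 0) (X0 1) (X0 2) (X0 5) (X0 4) (X0 3)).ok := by
    intro x y hx hy
    unfold gr GQ.q X0
    simp only [Matrix.cons_val]
    have : 0 < 3 - Real.sqrt 2 := by linarith
    ring_nf
    nlinarith [mul_pos hx hy, mul_pos (mul_pos hx hx) this, mul_pos hx this,
      mul_pos (mul_pos hx hy) this]
  refine ⟨hA, hA, ?_, ?_⟩
  · intro x y hx hy
    unfold gr GQ.q X0
    simp only [Matrix.cons_val]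
    have : 0 < Real.sqrt 2 - 1.4 := by linarith
    nlinarith [mul_pos hx hy, mul_pos hx hx, mul_pos (mul_pos hx hy) this]
  · intro x y hx hy
    unfold gr GQ.q X0
    simp only [Matrix.cons_val]
    have : 0 < Real.sqrt 2 - 1.4 := by linarith
    nlinarith [mul_pos hx hy, sq_nonneg (x - y), mul_pos (mul_pos hx hy) this]

lemma gr_comb (α β : ℝ) (a b c d e f a' b' c' d' e' f' : ℝ) :
    gr (α * a + β * a') (α * b + β * b') (α * c + β * c') (α * d + β * d') (α * e + β * e')
      (α * f + β * f') = GQ.comb α β (gr a b c d e f) (gr a' b' c' d' e' f') := by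
  unfold gr GQ.comb
  simp only [GQ.mk.injEq]
  refine ⟨trivial, trivial, trivial, ?_, ?_, ?_⟩ <;> ring

/-- The sublevel sets of `Psi`. -/
def subPsi (ra rb rc rd : ℝ) (k : ENNReal) : Set (Fin 6 → ℝ) :=
  {x | okAll x ∧ Psi ra rb rc rd x ≤ k}

lemma convex_sub (ra rb rc rd : ℝ) (k : ENNReal) : Convex ℝ (subPsi ra rb rc rd k) := by
  rintro x ⟨⟨x1, x2, x3, x4⟩, hx⟩ y ⟨⟨y1, y2, y3, y4⟩, hy⟩ α β hα hβ h1
  have e1 := GQ.comb_J hα hβ h1 x1 y1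
  have e2 := GQ.comb_J hα hβ h1 x2 y2
  have e3 := GQ.comb_J hα hβ h1 x3 y3
  have e4 := GQ.comb_J hα hβ h1 x4 y4
  constructor
  · unfold okAll
    simp only [Pi.add_apply, Pi.smul_apply, smul_eq_mul, gr_comb]
    exact ⟨GQ.comb_ok hα hβ h1 x1 y1, GQ.comb_ok hα hβ h1 x2 y2, GQ.comb_ok hα hβ h1 x3 y3,
      GQ.comb_ok hα hβ h1 x4 y4⟩
  · calc Psi ra rb rc rd (α • x + β • y)
        ≤ ENNReal.ofReal α * Psi ra rb rc rd x + ENNReal.ofReal β * Psi ra rb rc rd y := by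
          unfold Psi
          simp only [Pi.add_apply, Pi.smul_apply, smul_eq_mul, gr_comb]
          refine (add_le_add (add_le_add (add_le_add (mul_le_mul_right e1 _)
            (mul_le_mul_right e2 _)) (mul_le_mul_right e3 _)) (mul_le_mul_right e4 _)).trans
            (le_of_eq ?_)
          ring
      _ ≤ ENNReal.ofReal α * k + ENNReal.ofReal β * k := by gcongr
      _ = k := by
          rw [← add_mul, ← ENNReal.ofReal_add hα hβ, h1, ENNReal.ofReal_one, one_mul]

/-- Vertex–edge description of a simple polytope. -/
lemma mem_hull (V : Set (Fin 6 → ℝ)) (hV : V.Finite) (hne : V.Nonempty) (x : Fin 6 → ℝ)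
    (h : ∀ v ∈ V, ∃ (M : Fin 6 → Fin 6 → ℝ) (b : Fin 6 → ℝ) (n : Fin 6 → Fin 6 → ℝ),
      (∀ k, n k ∈ V) ∧ (∀ k, M k ⬝ᵥ v = b k) ∧ (∀ k j, j ≠ k → M k ⬝ᵥ n j = b k) ∧
      (∀ k, M k ⬝ᵥ n k < b k) ∧ (∀ k, M k ⬝ᵥ x ≤ b k)) : x ∈ convexHull ℝ V := by
  by_contra hx
  obtain ⟨f, u, hf, hfx⟩ := geometric_hahn_banach_closed_point (convex_convexHull ℝ V)
    (hV.isCompact_convexHull (𝕜 := ℝ)).isClosed hx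
  obtain ⟨v, hv, hmax⟩ := Set.exists_max_image V f hV hne
  obtain ⟨M, b, n, hn, h1, h2, h3, h4⟩ := h v hv
  have hfv : f v < f x := (hf v (subset_convexHull ℝ V hv)).trans hfx
  let t : Fin 6 → ℝ := fun k => (M k ⬝ᵥ x - b k) / (M k ⬝ᵥ n k - b k)
  have ht : ∀ k, 0 ≤ t k := fun k =>
    div_nonneg_of_nonpos (by linarith [h4 k]) (by linarith [h3 k])
  let Mm : Matrix (Fin 6) (Fin 6) ℝ := Matrix.of M
  let Nm : Matrix (Fin 6) (Fin 6) ℝ := Matrix.of fun i j => n j i - v i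
  have hMN : Mm * Nm = Matrix.diagonal fun k => M k ⬝ᵥ n k - b k := by
    ext i j
    have : (Mm * Nm) i j = M i ⬝ᵥ n j - M i ⬝ᵥ v := by
      rw [← dotProduct_sub]; rfl
    rw [this, h1]
    by_cases hij : i = j
    · subst hij; simp
    · rw [Matrix.diagonal_apply_ne _ hij, h2 i j (Ne.symm hij)]; ring
  have hdet : Mm.det ≠ 0 := by
    intro h0
    have := congrArg Matrix.det hMN
    rw [Matrix.det_mul, h0, zero_mul, Matrix.det_diagonal] at this
    have h5 := Finset.prod_ne_zero_iff.mpr (fun k (_ : k ∈ Finset.univ) =>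
      (by linarith [h3 k] : M k ⬝ᵥ n k - b k < 0).ne)
    exact h5 this.symm
  have hxv : x - v = Nm.mulVec t := by
    have inj := Matrix.mulVec_injective_iff_isUnit.mpr
      ((Matrix.isUnit_iff_isUnit_det Mm).mpr (isUnit_iff_ne_zero.mpr hdet))
    apply inj
    rw [Matrix.mulVec_mulVec, hMN]
    ext k
    rw [Matrix.mulVec_diagonal]
    have : Mm.mulVec (x - v) k = M k ⬝ᵥ x - M k ⬝ᵥ v := by
      rw [← dotProduct_sub]; rfl
    rw [this, h1]
    have : M k ⬝ᵥ n k - b k ≠ 0 := by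
      have := h3 k
      exact (by linarith : M k ⬝ᵥ n k - b k < 0).ne
    simp only [t]
    field_simp
  have hsum : x = v + ∑ k, t k • (n k - v) := by
    have : Nm.mulVec t = ∑ k, t k • (n k - v) := by
      ext i
      simp only [Matrix.mulVec, dotProduct, Finset.sum_apply, Pi.smul_apply, smul_eq_mul,
        Pi.sub_apply]
      apply Finset.sum_congr rfl
      intro k _
      exact mul_comm _ _
    rw [← this, ← hxv]; abel
  have : f x ≤ f v := by
    rw [hsum, map_add, map_sum]
    have : ∑ k, f (t k • (n k - v)) ≤ 0 := by
      apply Finset.sum_nonpos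
      intro k _
      rw [map_smul, map_sub, smul_eq_mul]
      exact mul_nonpos_of_nonneg_of_nonpos (ht k) (by linarith [hmax _ (hn k)])
    linarith
  linarith

/-- A linear constraint `∑ mᵢ xᵢ ≤ b` with integer coefficients. -/
structure Row where
  (m0 m1 m2 m3 m4 m5 b : ℤ)

/-- A vertex in homogeneous coordinates, together with the (packed) indices of its tight
constraints and of its neighbours. -/
structure Vtx where
  (n0 n1 n2 n3 n4 n5 w t nb : ℕ)

/-- Row evaluated at a vertex. -/
noncomputable def Row.at (r : Row) (v : Vtx) : ℤ :=
  Row.rec (fun m0 m1 m2 m3 m4 m5 b =>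
    Vtx.rec (fun n0 n1 n2 n3 n4 n5 w _ _ =>
      m0 * Int.ofNat n0 + m1 * Int.ofNat n1 + m2 * Int.ofNat n2 + m3 * Int.ofNat n3
        + m4 * Int.ofNat n4 + m5 * Int.ofNat n5 - b * Int.ofNat w) v) r

/-- List lookup. -/
noncomputable def nth {α : Type} (l : List α) (i : ℕ) (d : α) : α :=
  List.rec (motive := fun _ => ℕ → α) (fun _ => d)
    (fun a _ ih i => Nat.rec (motive := fun _ => α) a (fun n _ => ih n) i) l i

/-- Forced evaluation of a natural number. -/
noncomputable def sN {α : Type} (n : ℕ) (f : ℕ → α) : α :=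
  Nat.rec (motive := fun _ => α) (f 0) (fun n _ => f (Nat.succ n)) n

/-- Forced evaluation of an integer. -/
noncomputable def sZ {α : Type} (z : ℤ) (f : ℤ → α) : α :=
  Int.rec (motive := fun _ => α) (fun n => sN n fun n => f (Int.ofNat n))
    (fun n => sN n fun n => f (Int.negSucc n)) z

lemma sN_eq {α : Type} (n : ℕ) (f : ℕ → α) : sN n f = f n := by cases n <;> rfl

lemma sZ_eq {α : Type} (z : ℤ) (f : ℤ → α) : sZ z f = f z := by
  cases z <;> simp [sZ, sN_eq]

noncomputable def isZ (z : ℤ) : Bool :=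
  Int.rec (motive := fun _ => Bool) (fun n => Nat.beq n 0) (fun _ => false) z

noncomputable def isNeg (z : ℤ) : Bool :=
  Int.rec (motive := fun _ => Bool) (fun _ => false) (fun _ => true) z

lemma isZ_iff {z : ℤ} (h : isZ z = true) : z = 0 := by
  cases z with
  | ofNat n => simpa [isZ] using h
  | negSucc n => simp [isZ] at h

lemma isNeg_iff {z : ℤ} (h : isNeg z = true) : z < 0 := by
  cases z with
  | ofNat n => simp [isNeg] at h
  | negSucc n => exact Int.negSucc_lt_zero n

lemma nth_mem {α : Type} (l : List α) (i : ℕ) (d : α) : nth l i d ∈ l ∨ nth l i d = d := by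
  induction l generalizing i with
  | nil => right; rfl
  | cons a l ih =>
    cases i with
    | zero => left; exact List.mem_cons_self
    | succ n =>
      rcases ih n with h | h
      · left; exact List.mem_cons_of_mem _ h
      · right; exact h

noncomputable def zRow : Row := ⟨0, 0, 0, 0, 0, 0, 0⟩

/-- `k`-th base 256 digit. -/
noncomputable def dig (t k : ℕ) : ℕ := Nat.mod (Nat.div t (Nat.pow 256 k)) 256

/-- The six relations between the `k`-th neighbour `u` and the tight rows. -/
noncomputable def relN (R : List Row) (t k : ℕ) (u : Vtx) (j : ℕ) : Bool :=
  Bool.rec (isZ ((nth R (dig t j) zRow).at u)) (isNeg ((nth R (dig t j) zRow).at u)) (Nat.beq j k)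

noncomputable def l6 : List ℕ := [0, 1, 2, 3, 4, 5]

/-- Combinatorial check at a vertex. -/
noncomputable def geoV (R : List Row) (V : List Vtx) (v : Vtx) : Bool :=
  Nat.blt 0 v.w && sN v.t fun t => sN v.nb fun nb =>
    l6.all (fun j => isZ ((nth R (dig t j) zRow).at v)) &&
    l6.all fun k => Vtx.rec (fun n0 n1 n2 n3 n4 n5 w t' nb' =>
      l6.all (relN R t k ⟨n0, n1, n2, n3, n4, n5, w, t', nb'⟩)) (nth V (dig nb k) v)

/-- The real point of a vertex. -/
noncomputable def Vtx.pt (v : Vtx) : Fin 6 → ℝ :=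
  ![v.n0 / v.w, v.n1 / v.w, v.n2 / v.w, v.n3 / v.w, v.n4 / v.w, v.n5 / v.w]

noncomputable def Row.vec (r : Row) : Fin 6 → ℝ := ![r.m0, r.m1, r.m2, r.m3, r.m4, r.m5]

lemma Row.dot (r : Row) (x : Fin 6 → ℝ) : r.vec ⬝ᵥ x =
    r.m0 * x 0 + r.m1 * x 1 + r.m2 * x 2 + r.m3 * x 3 + r.m4 * x 4 + r.m5 * x 5 := by
  simp [Row.vec, dotProduct, Fin.sum_univ_six]

lemma Row.at_eq (r : Row) (v : Vtx) (hw : 0 < v.w) :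
    r.vec ⬝ᵥ v.pt - r.b = (r.at v : ℝ) / v.w := by
  have : (0 : ℝ) < v.w := by exact_mod_cast hw
  rw [Row.dot]
  simp only [Row.at, Vtx.pt, Matrix.cons_val]
  simp only [Int.ofNat_eq_natCast]
  push_cast
  field_simp

lemma geoV_w {R : List Row} {V : List Vtx} {v : Vtx} (h : geoV R V v = true) : 0 < v.w := by
  simp only [geoV, Bool.and_eq_true] at h
  have := h.1
  simp [Nat.blt] at this
  omega

lemma geo_sound (R : List Row) (V : List Vtx) (hV : V ≠ []) (h : V.all (geoV R V) = true)
    (x : Fin 6 → ℝ) (hx : ∀ r ∈ R, r.vec ⬝ᵥ x ≤ r.b) :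
    x ∈ convexHull ℝ {y | ∃ v ∈ V, v.pt = y} := by
  rw [List.all_eq_true] at h
  have hx' : ∀ i, (nth R i zRow).vec ⬝ᵥ x ≤ (nth R i zRow).b := by
    intro i
    rcases nth_mem R i zRow with h | h
    · exact hx _ h
    · rw [h, Row.dot]; simp [zRow]
  apply mem_hull
  · have : {y | ∃ v ∈ V, v.pt = y} = Vtx.pt '' {v | v ∈ V} := by
      ext y; simp
    rw [this]
    exact (List.finite_toSet V).image _
  · obtain ⟨v, hv⟩ := List.exists_mem_of_ne_nil V hV
    exact ⟨_, v, hv, rfl⟩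
  · rintro _ ⟨v, hv, rfl⟩
    have hvw := geoV_w (h v hv)
    have hg := h v hv
    simp only [geoV, sN_eq, Bool.and_eq_true] at hg
    obtain ⟨-, hg1, hg2⟩ := hg
    rw [List.all_eq_true] at hg1 hg2
    have l6m : ∀ k : Fin 6, (k : ℕ) ∈ l6 := by decide
    have hn : ∀ k, nth V k v ∈ V := by
      intro k
      rcases nth_mem V k v with h | h
      · exact h
      · rw [h]; exact hv
    have hrel : ∀ k j : Fin 6, relN R v.t k (nth V (dig v.nb k) v) j = true := by
      intro k j
      have := hg2 k (l6m k)
      have h2 := List.all_eq_true.mp this j (l6m j)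
      exact h2
    refine ⟨fun k => (nth R (dig v.t k) zRow).vec, fun k => (nth R (dig v.t k) zRow).b,
      fun k => (nth V (dig v.nb k) v).pt, ?_, ?_, ?_, ?_, ?_⟩
    · intro k; exact ⟨_, hn _, rfl⟩
    · intro k
      have e := Row.at_eq (nth R (dig v.t k) zRow) v hvw
      rw [isZ_iff (hg1 k (l6m k))] at e
      simp at e
      linarith
    · intro k j hjk
      have hw := geoV_w (h _ (hn (dig v.nb j)))
      have e := Row.at_eq (nth R (dig v.t k) zRow) _ hw
      have hr := hrel j k
      have hb : Nat.beq (k : ℕ) (j : ℕ) = false := by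
        have : ¬ (k : ℕ) = j := fun hh => hjk (Fin.ext hh.symm)
        rw [Bool.eq_false_iff]
        exact fun hh => this (Nat.eq_of_beq_eq_true hh)
      simp only [relN, hb] at hr
      rw [isZ_iff hr] at e
      simp at e
      linarith
    · intro k
      have hw := geoV_w (h _ (hn (dig v.nb k)))
      have e := Row.at_eq (nth R (dig v.t k) zRow) _ hw
      have hr := hrel k k
      have hb : Nat.beq (k : ℕ) (k : ℕ) = true := by simp
      simp only [relN, hb] at hr
      have hr' := isNeg_iff hr
      have : (((nth R (dig v.t k) zRow).at (nth V (dig v.nb k) v) : ℤ) : ℝ) < 0 := by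
        exact_mod_cast hr'
      have hw' : (0 : ℝ) < (nth V (dig v.nb k) v).w := by exact_mod_cast hw
      have := div_neg_of_neg_of_pos this hw'
      linarith
    · intro k; exact hx' _

/-- Newton iteration for integer square roots (no correctness needed). -/
noncomputable def sqN (fuel n x : ℕ) : ℕ :=
  Nat.rec (motive := fun _ => ℕ → ℕ) (fun x => x)
    (fun _ ih x => sN (Nat.div (Nat.add x (Nat.div n x)) 2) fun y => cond (Nat.blt y x) (ih y) x)
    fuel x

/-- Continue only on positive integers. -/
noncomputable def pos (z : ℤ) (f : ℕ → Option ℕ) : Option ℕ :=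
  Int.rec (motive := fun _ => Option ℕ) (fun n => sN n fun n => cond (Nat.blt 0 n) (f n) none)
    (fun _ => none) z

noncomputable def chk (b : Bool) (o : Option ℕ) : Option ℕ := cond b o none

noncomputable def omin (x y : Option ℕ) : Option ℕ :=
  Option.rec (motive := fun _ => Option ℕ) y
    (fun a => Option.rec (motive := fun _ => Option ℕ) (some a)
      (fun b => some (cond (Nat.ble a b) a b)) y) x

lemma pos_some {z : ℤ} {f : ℕ → Option ℕ} {v : ℕ} (h : pos z f = some v) :
    ∃ n : ℕ, 0 < n ∧ z = n ∧ f n = some v := by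
  cases z with
  | ofNat n =>
    simp only [pos, sN_eq] at h
    by_cases hn : 0 < n
    · have : Nat.blt 0 n = true := Nat.ble_eq_true_of_le hn
      rw [this] at h
      exact ⟨n, hn, rfl, h⟩
    · have : n = 0 := by omega
      subst this
      exact absurd h (by simp [show Nat.blt 0 0 = false from rfl])
  | negSucc n => simp [pos] at h

lemma chk_some {b : Bool} {o : Option ℕ} {v : ℕ} (h : chk b o = some v) :
    b = true ∧ o = some v := by
  cases b
  · simp [chk] at h
  · exact ⟨rfl, h⟩

lemma omin_some {x y : Option ℕ} {v : ℕ} (h : omin x y = some v) : x = some v ∨ y = some v := by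
  cases x with
  | none => right; exact h
  | some a =>
    cases y with
    | none => left; exact h
    | some b =>
      simp only [omin] at h
      cases hab : Nat.ble a b
      · rw [hab] at h; right; exact h
      · rw [hab] at h; left; exact h

/-- Upper bound for the corner integral in units `10⁻⁹`. -/
noncomputable def evc (a b c : ℕ) (F G H : ℤ) : Option ℕ :=
  sN (a * b) fun ab => sN (b * c) fun bc => sN (ab * c) fun abc =>
  chk (Nat.blt 0 a && (Nat.blt 0 b && (Nat.blt 0 c && (Nat.blt F.natAbs bc && Nat.blt H.natAbs ab)))) <|
  sZ ((a : ℤ) * F) fun aF => sZ ((b : ℤ) * G) fun bG => sZ ((c : ℤ) * H) fun cH =>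
  pos ((abc * abc : ℕ) + 2 * (F * G * H) - (aF * aF + bG * bG + cH * cH)) fun d =>
  sZ (abc + aF + bG + cH) fun D =>
  sN (D.natAbs * D.natAbs + d) fun E =>
  sN (sqN 100 E (D.natAbs + abc)) fun n =>
  chk (Nat.ble (n * n) E && Nat.ble E ((n + 1) * (n + 1))) <|
  pos (D + n) fun S =>
  sN ((S + 1) * (S + 1)) fun q =>
  sN (q * q) fun qq => sN (d * q) fun pq => sN (d * d) fun pp =>
  sN ((4 * (945 * qq + 735 * pq + 64 * pp)) * 1000000000000000000000000000 /
    ((945 * qq + 1050 * pq + 225 * pp) * S) + 1) fun v => some v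

/-- The form with integer data. -/
noncomputable def lw (a b c : ℕ) (F G H : ℤ) : GQ :=
  ⟨((a : ℝ) / 10 ^ 6) ^ 2, ((b : ℝ) / 10 ^ 6) ^ 2, ((c : ℝ) / 10 ^ 6) ^ 2,
    (F : ℝ) / 10 ^ 12, (G : ℝ) / 10 ^ 12, (H : ℝ) / 10 ^ 12⟩

lemma blt_iff {a b : ℕ} (h : Nat.blt a b = true) : a < b := Nat.le_of_ble_eq_true h

lemma evc_sound {a b c : ℕ} {F G H : ℤ} {v : ℕ} (h : evc a b c F G H = some v) :
    (lw a b c F G H).ok ∧ (lw a b c F G H).J ≤ ENNReal.ofReal ((v : ℝ) / 10 ^ 9) := by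
  simp only [evc, sN_eq, sZ_eq] at h
  replace h := chk_some h
  obtain ⟨h1, h⟩ := h
  replace h := pos_some h
  obtain ⟨d, hd, hd', h⟩ := h
  replace h := chk_some h
  obtain ⟨h2, h⟩ := h
  replace h := pos_some h
  obtain ⟨S, hS, hS', h⟩ := h
  simp only [Bool.and_eq_true] at h1 h2
  obtain ⟨ha, hb, hc, hF, hH⟩ := h1
  obtain ⟨hn1, hn2⟩ := h2
  set D : ℤ := ((a * b * c : ℕ) : ℤ) + (a : ℤ) * F + (b : ℤ) * G + (c : ℤ) * H with hD
  set n : ℕ := sqN 100 (D.natAbs * D.natAbs + d) (D.natAbs + a * b * c) with hn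
  clear_value n
  replace ha := blt_iff ha
  replace hb := blt_iff hb
  replace hc := blt_iff hc
  replace hF := blt_iff hF
  replace hH := blt_iff hH
  replace hn1 := Nat.le_of_ble_eq_true hn1
  replace hn2 := Nat.le_of_ble_eq_true hn2
  have hv : v = (4 * (945 * ((S + 1) * (S + 1) * ((S + 1) * (S + 1))) + 735 * (d * ((S + 1) * (S + 1)))
      + 64 * (d * d))) * 1000000000000000000000000000 /
    ((945 * ((S + 1) * (S + 1) * ((S + 1) * (S + 1))) + 1050 * (d * ((S + 1) * (S + 1)))
      + 225 * (d * d)) * S) + 1 := by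
    injection h with h; exact h.symm
  clear h
  have ra : (0 : ℝ) < a := by exact_mod_cast ha
  have rb : (0 : ℝ) < b := by exact_mod_cast hb
  have rc : (0 : ℝ) < c := by exact_mod_cast hc
  have rd : (0 : ℝ) < d := by exact_mod_cast hd
  have rS : (0 : ℝ) < S := by exact_mod_cast hS
  have rF : |(F : ℝ)| < b * c := by
    have : (F.natAbs : ℝ) < b * c := by exact_mod_cast hF
    rwa [Nat.cast_natAbs, Int.cast_abs] at this
  have rH : |(H : ℝ)| < a * b := by
    have : (H.natAbs : ℝ) < a * b := by exact_mod_cast hH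
    rwa [Nat.cast_natAbs, Int.cast_abs] at this
  have rD : (D : ℝ) = a * b * c + a * F + b * G + c * H := by
    rw [hD]; push_cast; ring
  have rSD : (D : ℝ) + n = S := by exact_mod_cast hS'
  have rdd : (d : ℝ) = (a * b * c) ^ 2 + 2 * (F * G * H) - ((a * F) ^ 2 + (b * G) ^ 2 + (c * H) ^ 2) := by
    have := congrArg (fun z : ℤ => (z : ℝ)) hd'
    push_cast at this
    rw [← this]; ring
  have rD2 : ((D.natAbs * D.natAbs : ℕ) : ℝ) = (D : ℝ) ^ 2 := by
    rw [Nat.cast_mul, Nat.cast_natAbs, Int.cast_abs, ← sq, sq_abs]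
  have rn1 : (n : ℝ) ^ 2 ≤ D ^ 2 + d := by
    have : ((n * n : ℕ) : ℝ) ≤ ((D.natAbs * D.natAbs : ℕ) : ℝ) + d := by exact_mod_cast hn1
    rw [rD2] at this
    push_cast at this
    linarith
  have rn2 : (D : ℝ) ^ 2 + d ≤ ((n : ℝ) + 1) ^ 2 := by
    have : ((D.natAbs * D.natAbs : ℕ) : ℝ) + d ≤ (((n + 1) * (n + 1) : ℕ) : ℝ) := by exact_mod_cast hn2
    rw [rD2] at this
    push_cast at this
    linarith
  clear_value D
  have ka : (0 : ℝ) < a / 10 ^ 6 := by positivity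
  have kb : (0 : ℝ) < b / 10 ^ 6 := by positivity
  have kc : (0 : ℝ) < c / 10 ^ 6 := by positivity
  have kF : |(F : ℝ) / 10 ^ 12| < (b : ℝ) / 10 ^ 6 * ((c : ℝ) / 10 ^ 6) := by
    rw [abs_div, abs_of_pos (by positivity : (0 : ℝ) < 10 ^ 12), div_mul_div_comm,
      ← pow_add]
    exact div_lt_div_of_pos_right rF (by positivity)
  have kH : |(H : ℝ) / 10 ^ 12| < (a : ℝ) / 10 ^ 6 * ((b : ℝ) / 10 ^ 6) := by
    rw [abs_div, abs_of_pos (by positivity : (0 : ℝ) < 10 ^ 12), div_mul_div_comm,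
      ← pow_add]
    exact div_lt_div_of_pos_right rH (by positivity)
  have kd : (d : ℝ) / 10 ^ 36 = ((a : ℝ) / 10 ^ 6) ^ 2 * ((b : ℝ) / 10 ^ 6) ^ 2 * ((c : ℝ) / 10 ^ 6) ^ 2 +
      2 * ((F : ℝ) / 10 ^ 12) * ((G : ℝ) / 10 ^ 12) * ((H : ℝ) / 10 ^ 12)
      - ((a : ℝ) / 10 ^ 6) ^ 2 * ((F : ℝ) / 10 ^ 12) ^ 2
      - ((b : ℝ) / 10 ^ 6) ^ 2 * ((G : ℝ) / 10 ^ 12) ^ 2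
      - ((c : ℝ) / 10 ^ 6) ^ 2 * ((H : ℝ) / 10 ^ 12) ^ 2 := by
    rw [rdd]; ring
  have kd0 : (0 : ℝ) < (d : ℝ) / 10 ^ 36 := by positivity
  refine ⟨ok_of_pd _ _ _ _ _ _ ka kH (by rw [← kd]; exact kd0), ?_⟩
  refine (J_upper _ _ _ _ _ _ ((d : ℝ) / 10 ^ 36) ((D : ℝ) / 10 ^ 18) ((n : ℝ) / 10 ^ 18)
    (((n : ℝ) + 1) / 10 ^ 18) ((d : ℝ) / (S + 1) ^ 2) ka kb kc kF kH kd kd0 ?_ ?_ ?_ (by positivity)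
    ?_ (by positivity) ?_).trans ?_
  · rw [rD]; ring
  · have : ((n : ℝ) / 10 ^ 18) ^ 2 = (n : ℝ) ^ 2 / 10 ^ 36 := by ring
    rw [this]
    have : ((D : ℝ) / 10 ^ 18) ^ 2 + d / 10 ^ 36 = ((D : ℝ) ^ 2 + d) / 10 ^ 36 := by ring
    rw [this]
    gcongr
  · have : (((n : ℝ) + 1) / 10 ^ 18) ^ 2 = ((n : ℝ) + 1) ^ 2 / 10 ^ 36 := by ring
    rw [this]
    have : ((D : ℝ) / 10 ^ 18) ^ 2 + d / 10 ^ 36 = ((D : ℝ) ^ 2 + d) / 10 ^ 36 := by ring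
    rw [this]
    gcongr
  · rw [← add_div, rSD]; positivity
  · have : (D : ℝ) / 10 ^ 18 + (n + 1) / 10 ^ 18 = (S + 1) / 10 ^ 18 := by rw [← rSD]; ring
    rw [this]
    apply le_of_eq
    field_simp
  · apply ENNReal.ofReal_le_ofReal
    rw [← add_div, rSD]
    set q : ℕ := (S + 1) * (S + 1) with hq
    have rq : ((S : ℝ) + 1) ^ 2 = q := by rw [hq]; push_cast; ring
    have rq0 : (0 : ℝ) < q := by rw [← rq]; positivity
    rw [rq]
    clear_value q
    set num : ℕ := (4 * (945 * (q * q) + 735 * (d * q) + 64 * (d * d))) * 1000000000000000000000000000 with hnum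
    set den : ℕ := (945 * (q * q) + 1050 * (d * q) + 225 * (d * d)) * S with hden
    have rden : (den : ℝ) = (945 * (q * q) + 1050 * (d * q) + 225 * (d * d)) * S := by
      rw [hden]; push_cast; ring
    have rnum : (num : ℝ) = (4 * (945 * (q * q) + 735 * (d * q) + 64 * (d * d))) * 10 ^ 27 := by
      rw [hnum]; push_cast; ring
    clear_value num den
    have rden0 : (0 : ℝ) < den := by rw [rden]; positivity
    have hle : (num : ℝ) / den ≤ v := by
      rw [div_le_iff₀ rden0]
      have h0 : 0 < den := by exact_mod_cast rden0
      have : num ≤ v * den := by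
        rw [hv]
        have := Nat.lt_mul_div_succ num h0
        rw [mul_comm] at this
        exact this.le
      exact_mod_cast this
    have : 4 * ((945 + 735 * ((d : ℝ) / q) + 64 * (d / q) ^ 2) / (945 + 1050 * (d / q) + 225 * (d / q) ^ 2)) /
        (S / 10 ^ 18) = (num : ℝ) / den / 10 ^ 9 := by
      rw [rnum, rden]
      field_simp
    rw [this]
    gcongr

/-- Largest admissible value (roughly) of one off-diagonal entry. -/
noncomputable def fbX (dd : ℕ) (o1 o2 k1 k2 : ℤ) (f : ℤ → Option ℕ) : Option ℕ :=
  pos k1 fun k1 => pos k2 fun k2 =>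
    sN (sqN 100 (k1 * k2) ((k1 + k2) / 2)) fun s => sZ ((o1 * o2 + s) / dd - 1) f

/-- Replace a non positive definite form by a smaller positive definite one. -/
noncomputable def fb (a b c : ℕ) (F G H : ℤ) : Option ℕ :=
  sN (a * a) fun aa => sN (b * b) fun bb => sN (c * c) fun cc =>
  sZ ((bb : ℤ) * cc - F * F) fun kF => sZ ((aa : ℤ) * cc - G * G) fun kG =>
  sZ ((aa : ℤ) * bb - H * H) fun kH =>
  omin (fbX cc F G kG kF fun X => chk (!isNeg (H - X)) (evc a b c F G X)) <|
  omin (fbX bb F H kH kF fun X => chk (!isNeg (G - X)) (evc a b c F X H))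
    (fbX aa G H kH kG fun X => chk (!isNeg (F - X)) (evc a b c X G H))

noncomputable def evc' (a b c : ℕ) (F G H : ℤ) : Option ℕ :=
  Option.rec (motive := fun _ => Option ℕ) (fb a b c F G H) (fun v => some v) (evc a b c F G H)

noncomputable def cornV (lA lB lC hf hg hh : ℕ) : Option ℕ :=
  sN (sqN 100 lA 4000000) fun a => sN (sqN 100 lB 4000000) fun b => sN (sqN 100 lC 4000000) fun c =>
  chk (Nat.ble (a * a) lA && (Nat.ble (b * b) lB && Nat.ble (c * c) lC)) <|
  sZ (((lB + lC : ℕ) - (hf : ℤ)) / 2) fun F => sZ (((lA + lC : ℕ) - (hg : ℤ)) / 2) fun G =>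
  sZ (((lA + lB : ℕ) - (hh : ℤ)) / 2) fun H => evc' a b c F G H

/-- Validity of a numerical bound. -/
def good (g : GQ) (v : ℕ) : Prop := g.ok ∧ g.J ≤ ENNReal.ofReal ((v : ℝ) / 10 ^ 9)

lemma good.mono {g h : GQ} {v : ℕ} (l : g.leq h) (hg : good g v) : good h v :=
  ⟨l.ok hg.1, (l.J_le hg.1).trans hg.2⟩

lemma fbX_some {dd : ℕ} {o1 o2 k1 k2 : ℤ} {f : ℤ → Option ℕ} {v : ℕ}
    (h : fbX dd o1 o2 k1 k2 f = some v) : ∃ X, f X = some v := by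
  unfold fbX at h
  obtain ⟨a, -, -, h⟩ := pos_some h
  obtain ⟨b, -, -, h⟩ := pos_some h
  rw [sN_eq, sZ_eq] at h
  exact ⟨_, h⟩

lemma not_isNeg {z : ℤ} (h : (!isNeg z) = true) : 0 ≤ z := by
  cases z with
  | ofNat n => exact Int.natCast_nonneg n
  | negSucc n => simp [isNeg] at h

lemma lw_leq {a b c : ℕ} {F G H F' G' H' : ℤ} (hF : F ≤ F') (hG : G ≤ G') (hH : H ≤ H') :
    (lw a b c F G H).leq (lw a b c F' G' H') := by
  have rF : (F : ℝ) ≤ F' := by exact_mod_cast hF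
  have rG : (G : ℝ) ≤ G' := by exact_mod_cast hG
  have rH : (H : ℝ) ≤ H' := by exact_mod_cast hH
  refine ⟨le_refl _, le_refl _, le_refl _, ?_, ?_, ?_⟩ <;> simp only [lw] <;> gcongr

lemma fb_sound {a b c : ℕ} {F G H : ℤ} {v : ℕ} (h : fb a b c F G H = some v) :
    good (lw a b c F G H) v := by
  simp only [fb, sN_eq, sZ_eq] at h
  rcases omin_some h with h | h
  · obtain ⟨X, h⟩ := fbX_some h
    obtain ⟨h1, h2⟩ := chk_some h
    have := not_isNeg h1
    exact good.mono (lw_leq le_rfl le_rfl (by linarith)) (evc_sound h2)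
  rcases omin_some h with h | h
  · obtain ⟨X, h⟩ := fbX_some h
    obtain ⟨h1, h2⟩ := chk_some h
    have := not_isNeg h1
    exact good.mono (lw_leq le_rfl (by linarith) le_rfl) (evc_sound h2)
  · obtain ⟨X, h⟩ := fbX_some h
    obtain ⟨h1, h2⟩ := chk_some h
    have := not_isNeg h1
    exact good.mono (lw_leq (by linarith) le_rfl le_rfl) (evc_sound h2)

lemma evc'_sound {a b c : ℕ} {F G H : ℤ} {v : ℕ} (h : evc' a b c F G H = some v) :
    good (lw a b c F G H) v := by
  unfold evc' at h
  cases he : evc a b c F G H with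
  | none => rw [he] at h; exact fb_sound h
  | some w =>
    rw [he] at h
    have : w = v := by simpa using h
    subst this
    exact evc_sound he

lemma half_le {l m : ℕ} {h : ℕ} {B C f : ℝ} (hB : (l : ℝ) / 10 ^ 12 ≤ B) (hC : (m : ℝ) / 10 ^ 12 ≤ C)
    (hf : f ≤ (h : ℝ) / 10 ^ 12) :
    (((((l + m : ℕ) - (h : ℤ)) / 2 : ℤ)) : ℝ) / 10 ^ 12 ≤ (B + C - f) / 2 := by
  have h1 := Int.ediv_mul_le ((l + m : ℕ) - (h : ℤ)) (show (2 : ℤ) ≠ 0 by norm_num)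
  have h2 : ((((l + m : ℕ) - (h : ℤ)) / 2 : ℤ) : ℝ) * 2 ≤ l + m - h := by exact_mod_cast h1
  have h3 : ((((l + m : ℕ) - (h : ℤ)) / 2 : ℤ) : ℝ) ≤ (l + m - h) / 2 := by linarith
  calc _ ≤ (((l : ℝ) + m - h) / 2) / 10 ^ 12 := by gcongr
    _ = ((l : ℝ) / 10 ^ 12 + m / 10 ^ 12 - h / 10 ^ 12) / 2 := by ring
    _ ≤ _ := by gcongr

lemma sq_le' {a l : ℕ} {A : ℝ} (h : Nat.ble (a * a) l = true) (hA : (l : ℝ) / 10 ^ 12 ≤ A) :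
    ((a : ℝ) / 10 ^ 6) ^ 2 ≤ A := by
  have h1 : ((a * a : ℕ) : ℝ) ≤ l := by exact_mod_cast Nat.le_of_ble_eq_true h
  push_cast at h1
  calc ((a : ℝ) / 10 ^ 6) ^ 2 = (a : ℝ) * a / 10 ^ 12 := by ring
    _ ≤ (l : ℝ) / 10 ^ 12 := by gcongr
    _ ≤ A := hA

lemma cornV_sound {lA lB lC hf hg hh v : ℕ} (h : cornV lA lB lC hf hg hh = some v)
    {A B C f g k : ℝ} (hA : (lA : ℝ) / 10 ^ 12 ≤ A) (hB : (lB : ℝ) / 10 ^ 12 ≤ B)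
    (hC : (lC : ℝ) / 10 ^ 12 ≤ C) (h1 : f ≤ (hf : ℝ) / 10 ^ 12) (h2 : g ≤ (hg : ℝ) / 10 ^ 12)
    (h3 : k ≤ (hh : ℝ) / 10 ^ 12) : good (gr A B C f g k) v := by
  simp only [cornV, sN_eq, sZ_eq] at h
  obtain ⟨c1, h⟩ := chk_some h
  simp only [Bool.and_eq_true] at c1
  obtain ⟨c1, c2, c3⟩ := c1
  refine good.mono ?_ (evc'_sound h)
  exact ⟨sq_le' c1 hA, sq_le' c2 hB, sq_le' c3 hC, half_le hB hC h1, half_le hA hC h2,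
    half_le hA hB h3⟩

/-- Scaled floor of a quotient. -/
noncomputable def flo (n w : ℕ) : ℕ := n * 1000000000000 / w

/-- Upper end for the first coordinate. -/
noncomputable def bump (n : ℕ) : ℕ := n + 10001

/-- Comparison with the target value. -/
noncomputable def leT (s : ℕ) : Bool := Nat.ble s 406050000000000000

lemma leT_sound {s : ℕ} (h : leT s = true) : (s : ℝ) ≤ 406050000000000000 := by
  unfold leT at h
  have h' := Nat.le_of_ble_eq_true h
  have h2 : (s : ℝ) ≤ ((406050000000000000 : ℕ) : ℝ) := Nat.cast_le.mpr h'
  have h3 : ((406050000000000000 : ℕ) : ℝ) = 406050000000000000 := by norm_num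
  rwa [h3] at h2

/-- Numerical check at a box with given lower and upper ends. -/
noncomputable def evL (w0 w1 w2 w3 l0 l1 l2 l3 l4 l5 h0 h1 h2 h3 h4 h5 : ℕ) : Bool :=
    Option.rec false (fun a => Option.rec false (fun b => Option.rec false (fun c =>
      Option.rec false (fun d => leT (w0 * a + w1 * b + w2 * c + w3 * d))
        (cornV l2 l4 l5 h3 h1 h0)) (cornV l1 l3 l5 h4 h2 h0)) (cornV l0 l3 l4 h5 h2 h1))
        (cornV l0 l1 l2 h5 h4 h3)

/-- Numerical check at a vertex. -/
noncomputable def evV (w0 w1 w2 w3 : ℕ) (v : Vtx) : Bool :=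
  Vtx.rec (fun n0 n1 n2 n3 n4 n5 w _ _ =>
    sN (flo n0 w) fun l0 => sN (flo n1 w) fun l1 =>
    sN (flo n2 w) fun l2 => sN (flo n3 w) fun l3 =>
    sN (flo n4 w) fun l4 => sN (flo n5 w) fun l5 =>
    sN (bump l0) fun h0 => sN (Nat.succ l1) fun h1 => sN (Nat.succ l2) fun h2 =>
    sN (Nat.succ l3) fun h3 => sN (Nat.succ l4) fun h4 => sN (Nat.succ l5) fun h5 =>
    evL w0 w1 w2 w3 l0 l1 l2 l3 l4 l5 h0 h1 h2 h3 h4 h5) v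

lemma evV_mk (w0 w1 w2 w3 n0 n1 n2 n3 n4 n5 w t nb : ℕ) :
    evV w0 w1 w2 w3 ⟨n0, n1, n2, n3, n4, n5, w, t, nb⟩ = evL w0 w1 w2 w3 (flo n0 w) (flo n1 w)
      (flo n2 w) (flo n3 w) (flo n4 w) (flo n5 w) (bump (flo n0 w)) (flo n1 w).succ (flo n2 w).succ
      (flo n3 w).succ (flo n4 w).succ (flo n5 w).succ := by
  simp only [evV, sN_eq]

/-- The unit vector of the first edge, scaled. -/
noncomputable def sh (ξ : ℝ) : Fin 6 → ℝ := ![ξ, 0, 0, 0, 0, 0]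

lemma lo_le (n w : ℕ) (hw : 0 < w) : ((flo n w : ℕ) : ℝ) / 10 ^ 12 ≤ (n : ℝ) / w := by
  unfold flo
  have hw' : (0 : ℝ) < w := by exact_mod_cast hw
  rw [div_le_div_iff₀ (by positivity) hw']
  have := Nat.div_mul_le_self (n * 1000000000000) w
  have : ((n * 1000000000000 / w : ℕ) : ℝ) * w ≤ n * 1000000000000 := by exact_mod_cast this
  linarith

lemma le_hi (n w : ℕ) (hw : 0 < w) :
    (n : ℝ) / w ≤ ((Nat.succ (flo n w) : ℕ) : ℝ) / 10 ^ 12 := by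
  unfold flo
  have hw' : (0 : ℝ) < w := by exact_mod_cast hw
  rw [div_le_div_iff₀ hw' (by positivity)]
  have := (Nat.lt_mul_div_succ (n * 1000000000000) hw).le
  have : (n : ℝ) * 1000000000000 ≤ w * ((n * 1000000000000 / w : ℕ) + 1) := by exact_mod_cast this
  push_cast at this ⊢
  linarith

lemma le_hi' (n0 w : ℕ) (hw : 0 < w) {ξ : ℝ} (h1 : ξ ≤ 1 / 10 ^ 8) :
    (n0 : ℝ) / w + ξ ≤ ((bump (flo n0 w) : ℕ) : ℝ) / 10 ^ 12 := by
  have := le_hi n0 w hw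
  unfold bump
  push_cast at this ⊢
  rw [add_div] at this ⊢
  have : (10001 : ℝ) / 10 ^ 12 = 1 / 10 ^ 8 + 1 / 10 ^ 12 := by norm_num
  linarith

lemma fin_sum {w0 w1 w2 w3 a b c d : ℕ}
    (rsum : ((w0 * a + w1 * b + w2 * c + w3 * d : ℕ) : ℝ) ≤ 406050000000000000) :
    ENNReal.ofReal ((w0 : ℝ) / 10 ^ 9) * ENNReal.ofReal ((a : ℝ) / 10 ^ 9) +
      ENNReal.ofReal ((w1 : ℝ) / 10 ^ 9) * ENNReal.ofReal ((b : ℝ) / 10 ^ 9) +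
      ENNReal.ofReal ((w2 : ℝ) / 10 ^ 9) * ENNReal.ofReal ((c : ℝ) / 10 ^ 9) +
      ENNReal.ofReal ((w3 : ℝ) / 10 ^ 9) * ENNReal.ofReal ((d : ℝ) / 10 ^ 9)
      ≤ ENNReal.ofReal 0.40605 := by
  simp only [Nat.cast_add, Nat.cast_mul] at rsum
  rw [← ENNReal.ofReal_mul (by positivity), ← ENNReal.ofReal_mul (by positivity),
    ← ENNReal.ofReal_mul (by positivity), ← ENNReal.ofReal_mul (by positivity),
    ← ENNReal.ofReal_add (by positivity) (by positivity),
    ← ENNReal.ofReal_add (by positivity) (by positivity),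
    ← ENNReal.ofReal_add (by positivity) (by positivity)]
  apply ENNReal.ofReal_le_ofReal
  have : (w0 : ℝ) / 10 ^ 9 * (a / 10 ^ 9) + w1 / 10 ^ 9 * (b / 10 ^ 9) + w2 / 10 ^ 9 * (c / 10 ^ 9)
    + w3 / 10 ^ 9 * (d / 10 ^ 9) = (w0 * a + w1 * b + w2 * c + w3 * d) / 10 ^ 18 := by ring
  rw [this, div_le_iff₀ (by positivity)]
  norm_num
  exact rsum

lemma orec (f : ℕ → Bool) (o : Option ℕ) (h : (Option.rec false f o : Bool) = true) :
    ∃ a, o = some a ∧ f a = true := by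
  cases o with
  | none => exact absurd h Bool.false_ne_true
  | some a => exact ⟨a, rfl, h⟩

lemma evL_some {w0 w1 w2 w3 l0 l1 l2 l3 l4 l5 h0 h1 h2 h3 h4 h5 : ℕ}
    (h : evL w0 w1 w2 w3 l0 l1 l2 l3 l4 l5 h0 h1 h2 h3 h4 h5 = true) :
    ∃ a b c d, cornV l0 l1 l2 h5 h4 h3 = some a ∧ cornV l0 l3 l4 h5 h2 h1 = some b ∧
      cornV l1 l3 l5 h4 h2 h0 = some c ∧ cornV l2 l4 l5 h3 h1 h0 = some d ∧
      leT (w0 * a + w1 * b + w2 * c + w3 * d) = true := by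
  unfold evL at h
  obtain ⟨a, hA, h⟩ := orec _ _ h
  obtain ⟨b, hB, h⟩ := orec _ _ h
  obtain ⟨c, hC, h⟩ := orec _ _ h
  obtain ⟨d, hD, h⟩ := orec _ _ h
  exact ⟨a, b, c, d, hA, hB, hC, hD, h⟩

lemma evL_sound {w0 w1 w2 w3 l0 l1 l2 l3 l4 l5 k0 k1 k2 k3 k4 k5 : ℕ} {ra rb rc rd : ℝ}
    (ha : 0 ≤ ra) (hb : 0 ≤ rb) (hc : 0 ≤ rc) (hd : 0 ≤ rd)
    (wa : ra ^ 3 ≤ (w0 : ℝ) / 10 ^ 9)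
    (wb : rb ^ 3 ≤ (w1 : ℝ) / 10 ^ 9) (wc : rc ^ 3 ≤ (w2 : ℝ) / 10 ^ 9)
    (wd : rd ^ 3 ≤ (w3 : ℝ) / 10 ^ 9)
    (h : evL w0 w1 w2 w3 l0 l1 l2 l3 l4 l5 k0 k1 k2 k3 k4 k5 = true) {y : Fin 6 → ℝ}
    (L0 : (l0 : ℝ) / 10 ^ 12 ≤ y 0) (L1 : (l1 : ℝ) / 10 ^ 12 ≤ y 1) (L2 : (l2 : ℝ) / 10 ^ 12 ≤ y 2)
    (L3 : (l3 : ℝ) / 10 ^ 12 ≤ y 3) (L4 : (l4 : ℝ) / 10 ^ 12 ≤ y 4) (L5 : (l5 : ℝ) / 10 ^ 12 ≤ y 5)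
    (H0 : y 0 ≤ (k0 : ℝ) / 10 ^ 12) (H1 : y 1 ≤ (k1 : ℝ) / 10 ^ 12) (H2 : y 2 ≤ (k2 : ℝ) / 10 ^ 12)
    (H3 : y 3 ≤ (k3 : ℝ) / 10 ^ 12) (H4 : y 4 ≤ (k4 : ℝ) / 10 ^ 12) (H5 : y 5 ≤ (k5 : ℝ) / 10 ^ 12) :
    y ∈ subPsi ra rb rc rd (ENNReal.ofReal 0.40605) := by
  obtain ⟨a, b, c, d, hA, hB, hC, hD, h⟩ := evL_some h
  have rsum := leT_sound h
  have gA := cornV_sound hA L0 L1 L2 H5 H4 H3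
  have gB := cornV_sound hB L0 L3 L4 H5 H2 H1
  have gC := cornV_sound hC L1 L3 L5 H4 H2 H0
  have gD := cornV_sound hD L2 L4 L5 H3 H1 H0
  refine ⟨⟨gA.1, gB.1, gC.1, gD.1⟩, ?_⟩
  unfold Psi
  calc _ ≤ ENNReal.ofReal ((w0 : ℝ) / 10 ^ 9) * ENNReal.ofReal ((a : ℝ) / 10 ^ 9) +
      ENNReal.ofReal ((w1 : ℝ) / 10 ^ 9) * ENNReal.ofReal ((b : ℝ) / 10 ^ 9) +
      ENNReal.ofReal ((w2 : ℝ) / 10 ^ 9) * ENNReal.ofReal ((c : ℝ) / 10 ^ 9) +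
      ENNReal.ofReal ((w3 : ℝ) / 10 ^ 9) * ENNReal.ofReal ((d : ℝ) / 10 ^ 9) := by
        gcongr
        · exact gA.2
        · exact gB.2
        · exact gC.2
        · exact gD.2
    _ ≤ _ :=  fin_sum rsum

lemma pt_sh (n0 n1 n2 n3 n4 n5 w t nb : ℕ) (ξ : ℝ) :
    Vtx.pt ⟨n0, n1, n2, n3, n4, n5, w, t, nb⟩ + sh ξ =
      ![(n0 : ℝ) / w + ξ, (n1 : ℝ) / w, (n2 : ℝ) / w, (n3 : ℝ) / w, (n4 : ℝ) / w, (n5 : ℝ) / w] := by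
  ext i; fin_cases i <;> simp [Vtx.pt, sh]

lemma lo_le' (n0 w : ℕ) (hw : 0 < w) {ξ : ℝ} (h0 : 0 ≤ ξ) :
    ((flo n0 w : ℕ) : ℝ) / 10 ^ 12 ≤ (n0 : ℝ) / w + ξ := by
  linarith [lo_le n0 w hw]

lemma evV_sound {w0 w1 w2 w3 : ℕ} {ra rb rc rd : ℝ} (ha : 0 ≤ ra) (hb : 0 ≤ rb) (hc : 0 ≤ rc) (hd : 0 ≤ rd)
    (wa : ra ^ 3 ≤ (w0 : ℝ) / 10 ^ 9)
    (wb : rb ^ 3 ≤ (w1 : ℝ) / 10 ^ 9) (wc : rc ^ 3 ≤ (w2 : ℝ) / 10 ^ 9)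
    (wd : rd ^ 3 ≤ (w3 : ℝ) / 10 ^ 9) {v : Vtx} (hw : 0 < v.w) (h : evV w0 w1 w2 w3 v = true)
    {ξ : ℝ} (h0 : 0 ≤ ξ) (h1 : ξ ≤ 1 / 10 ^ 8) :
    v.pt + sh ξ ∈ subPsi ra rb rc rd (ENNReal.ofReal 0.40605) := by
  obtain ⟨n0, n1, n2, n3, n4, n5, w, t, nb⟩ := v
  replace hw : 0 < w := hw
  rw [evV_mk] at h
  rw [pt_sh]
  exact evL_sound ha hb hc hd wa wb wc wd h (lo_le' n0 w hw h0) (lo_le n1 w hw) (lo_le n2 w hw)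
    (lo_le n3 w hw) (lo_le n4 w hw) (lo_le n5 w hw) (le_hi' n0 w hw h1) (le_hi n1 w hw)
    (le_hi n2 w hw) (le_hi n3 w hw) (le_hi n4 w hw) (le_hi n5 w hw)

/-- Constraints for tetrahedra with 0 small balls. -/
noncomputable def rows0 : List Row := [
  ⟨.negSucc 99999999, .ofNat 0, .ofNat 0, .ofNat 0, .ofNat 0, .ofNat 0, .negSucc 399999999⟩,
  ⟨.ofNat 0, .negSucc 99999999, .ofNat 0, .ofNat 0, .ofNat 0, .ofNat 0, .negSucc 399999999⟩,
  ⟨.ofNat 0, .ofNat 0, .negSucc 99999999, .ofNat 0, .ofNat 0, .ofNat 0, .negSucc 399999999⟩,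
  ⟨.ofNat 0, .ofNat 0, .ofNat 0, .negSucc 99999999, .ofNat 0, .ofNat 0, .negSucc 399999999⟩,
  ⟨.ofNat 0, .ofNat 0, .ofNat 0, .ofNat 0, .negSucc 99999999, .ofNat 0, .negSucc 399999999⟩,
  ⟨.ofNat 0, .ofNat 0, .ofNat 0, .ofNat 0, .ofNat 0, .negSucc 99999999, .negSucc 399999999⟩,
  ⟨.ofNat 1600000000, .ofNat 1600000000, .ofNat 1600000000, .ofNat 1600000000, .ofNat 1600000000, .ofNat 1600000000, .ofNat 51200000100⟩,
  ⟨.ofNat 0, .negSucc 99999999, .negSucc 99999999, .ofNat 100000000, .ofNat 100000000, .ofNat 0, .ofNat 200000⟩,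
  ⟨.negSucc 99999999, .ofNat 100000000, .ofNat 0, .ofNat 0, .negSucc 99999999, .ofNat 100000000, .ofNat 274000⟩,
  ⟨.ofNat 0, .negSucc 99999999, .ofNat 100000000, .negSucc 99999999, .ofNat 100000000, .ofNat 0, .ofNat 348000⟩,
  ⟨.ofNat 6400000000, .ofNat 0, .ofNat 0, .ofNat 0, .ofNat 0, .ofNat 0, .ofNat 51200000100⟩]

/-- Vertices of the polytope `rows0`. -/
noncomputable def vtx0 : List Vtx := [
  ⟨4, 4, 4, 4, 4, 4, 1, 5514788471040, 6605677790500⟩,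
  ⟨2000, 2000, 2000, 2001, 2000, 2000, 500, 7718123471104, 42983491877⟩,
  ⟨2000, 2000, 2000, 2000, 2001, 2000, 500, 7718106693888, 47262794534⟩,
  ⟨128000000, 255968001, 128000000, 128000000, 256032001, 128000000, 32000000, 7722435281408, 16501550618151⟩,
  ⟨128000000, 128000000, 255968001, 256032001, 128000000, 128000000, 32000000, 7722435346688, 25293382750760⟩,
  ⟨200000, 200137, 200000, 200000, 200000, 200000, 50000, 8817635164672, 26022058247⟩,
  ⟨200000, 200000, 200000, 200000, 200000, 200137, 50000, 8813323354368, 47414117640⟩,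
  ⟨255956161, 256043841, 128000000, 128000000, 128000000, 128000000, 32000000, 8821946974978, 45101586779163⟩,
  ⟨255956161, 128000000, 128000000, 128000000, 128000000, 256043841, 32000000, 8821930131969, 46205493910535⟩,
  ⟨200000, 200137, 200000, 200237, 200000, 200000, 50000, 8826241942016, 1121155289612⟩,
  ⟨200000, 200000, 200000, 200100, 200000, 200137, 50000, 8826225033472, 1125467228429⟩,
  ⟨200000, 200000, 200000, 200000, 200100, 200237, 50000, 8826208256256, 2224962736398⟩,
  ⟨319880321, 320011841, 192000000, 320107841, 192000000, 192000000, 48000000, 8826258785282, 47309216616466⟩,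
  ⟨255924161, 128000000, 128000000, 128064000, 128000000, 256011841, 32000000, 8826258719233, 48413040055052⟩,
  ⟨255892161, 128000000, 128000000, 128000000, 128064000, 256043841, 32000000, 8826258653697, 49512568397329⟩,
  ⟨128000000, 256043841, 128000000, 128000000, 255956161, 128000000, 32000000, 8821946909184, 3320295988999⟩,
  ⟨128000000, 255968001, 128000000, 128151680, 255880321, 128000000, 32000000, 8826258784768, 3363111506444⟩,
  ⟨128000000, 255892161, 128000000, 128000000, 255956161, 128151680, 32000000, 8826258653696, 3363144998926⟩,
  ⟨128000000, 128087680, 255880321, 256032001, 128000000, 128000000, 32000000, 8826258785280, 4539932676108⟩,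
  ⟨128000000, 128000000, 255924161, 255988161, 128000000, 128087680, 32000000, 8826258718976, 4544245469709⟩,
  ⟨100000, 100000, 100087, 100000, 100000, 100000, 25000, 9917146792192, 112022985006⟩,
  ⟨200000, 200000, 200037, 200000, 200137, 200000, 50000, 9925753504000, 2285410719279⟩,
  ⟨128000000, 255944321, 128023680, 128000000, 256032001, 128000000, 32000000, 9925770412800, 3432033294384⟩,
  ⟨128000000, 128000000, 256055681, 255944321, 128000000, 128000000, 32000000, 9921458602240, 4484517863729⟩,
  ⟨128000000, 128000000, 255968001, 255944321, 128087680, 128000000, 32000000, 9925770412288, 4497185379890⟩,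
  ⟨200000, 200137, 200311, 200000, 200000, 200000, 50000, 9930048537344, 5583895732507⟩,
  ⟨200000, 200000, 200174, 200000, 200000, 200137, 50000, 9930031694080, 6683457886492⟩,
  ⟨319856641, 319988161, 320155201, 192000000, 192000000, 192000000, 48000000, 9930065380355, 7916045999905⟩,
  ⟨255900481, 128000000, 128111360, 128000000, 128000000, 255988161, 32000000, 9930065314561, 9019869504027⟩,
  ⟨200000, 200000, 200037, 200000, 200137, 200274, 50000, 9930082025728, 12185260728350⟩,
  ⟨255856641, 128000000, 128023680, 128000000, 128087680, 256032001, 32000000, 9930082222849, 15621267727136⟩,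
  ⟨128000000, 255944321, 128199040, 128000000, 255856641, 128000000, 32000000, 9930065380096, 16587585233179⟩,
  ⟨128000000, 255856641, 128023680, 128000000, 255944321, 128175360, 32000000, 9930082222848, 18786708955934⟩,
  ⟨128000000, 128087680, 256055681, 255856641, 128000000, 128000000, 32000000, 9930065380352, 19890415214363⟩,
  ⟨128000000, 128000000, 256011841, 255900481, 128000000, 128087680, 32000000, 9930065314048, 20989943685404⟩,
  ⟨128000000, 128000000, 255880321, 255856641, 128087680, 128175360, 32000000, 9930082222336, 20994372476958⟩,
  ⟨512000001, 256000000, 256000000, 256000000, 256000000, 256000000, 64000000, 11016658420225, 181028597289⟩,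
  ⟨512000001, 256000000, 256000000, 256128000, 256000000, 256000000, 64000000, 11025265197569, 1254871148587⟩,
  ⟨512000001, 256000000, 256000000, 256000000, 256128000, 256000000, 64000000, 11025265132033, 2354399489831⟩,
  ⟨1024000002, 767872003, 512000000, 512000000, 768128003, 512000000, 128000000, 11025282040578, 3475269036848⟩,
  ⟨1024000002, 512000000, 767872003, 768128003, 512000000, 512000000, 128000000, 11025282040833, 4609123562027⟩,
  ⟨512000001, 512000003, 256000000, 256000000, 256000000, 256000000, 64000000, 11020970230530, 7851907427123⟩,
  ⟨512000001, 256000000, 256000000, 256000000, 256000000, 512000003, 64000000, 11020953387521, 8951469716521⟩,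
  ⟨1024000002, 767872003, 512000000, 768128003, 512000000, 512000000, 128000000, 11025282040834, 13370856843048⟩,
  ⟨512000001, 256000000, 256000000, 256128000, 256000000, 511872003, 64000000, 11025281974785, 14474663503915⟩,
  ⟨512000001, 256000000, 256000000, 256000000, 256128000, 511872003, 64000000, 11025281909249, 15574191846695⟩,
  ⟨512000001, 256000000, 256222720, 256000000, 256000000, 256000000, 64000000, 11033855132417, 22145726886195⟩,
  ⟨512000001, 256000000, 256047360, 256000000, 256175360, 256000000, 64000000, 11033888752385, 23253728178736⟩,
  ⟨1024000002, 767777283, 512094720, 512000000, 768128003, 512000000, 128000000, 11033888818435, 24357618267442⟩,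
  ⟨1024000002, 512000000, 768222723, 767777283, 512000000, 512000000, 128000000, 11033871975425, 25461341303347⟩,
  ⟨1024000002, 512000000, 767872003, 767777283, 512350720, 512000000, 128000000, 11033888818433, 26560902935856⟩,
  ⟨1024000002, 767777283, 768222723, 512000000, 512000000, 512000000, 128000000, 11033871975427, 29863682781233⟩,
  ⟨512000001, 256000000, 256222720, 256000000, 256000000, 511777283, 64000000, 11033871909633, 30967489442099⟩,
  ⟨512000001, 256000000, 256047360, 256000000, 256175360, 511777283, 64000000, 11033888817921, 33179497869872⟩]

lemma geo0 : vtx0.all (geoV rows0 vtx0) = true := by decide +kernel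

lemma ev0 : vtx0.all (evV 1000000000 1000000000 1000000000 1000000000) = true := by decide +kernel

/-- Constraints for tetrahedra with 1 small balls. -/
noncomputable def rows1 : List Row := [
  ⟨.negSucc 99999999, .ofNat 0, .ofNat 0, .ofNat 0, .ofNat 0, .ofNat 0, .negSucc 399999997⟩,
  ⟨.ofNat 0, .negSucc 99999999, .ofNat 0, .ofNat 0, .ofNat 0, .ofNat 0, .negSucc 399999999⟩,
  ⟨.ofNat 0, .ofNat 0, .negSucc 99999999, .ofNat 0, .ofNat 0, .ofNat 0, .negSucc 199999999⟩,
  ⟨.ofNat 0, .ofNat 0, .ofNat 0, .negSucc 99999999, .ofNat 0, .ofNat 0, .negSucc 399999999⟩,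
  ⟨.ofNat 0, .ofNat 0, .ofNat 0, .ofNat 0, .negSucc 99999999, .ofNat 0, .negSucc 199999999⟩,
  ⟨.ofNat 0, .ofNat 0, .ofNat 0, .ofNat 0, .ofNat 0, .negSucc 99999999, .negSucc 199999999⟩,
  ⟨.ofNat 400000000, .ofNat 400000000, .ofNat 400000000, .ofNat 400000000, .ofNat 400000000, .ofNat 400000000, .ofNat 10698066502⟩,
  ⟨.negSucc 99999999, .ofNat 0, .negSucc 99999999, .ofNat 100000000, .ofNat 0, .ofNat 100000000, .ofNat 310000⟩,
  ⟨.negSucc 99999999, .ofNat 100000000, .ofNat 0, .ofNat 0, .negSucc 99999999, .ofNat 100000000, .ofNat 200000⟩,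
  ⟨.ofNat 409600000000, .ofNat 76800000000, .negSucc 448099999999, .ofNat 76800000000, .negSucc 448099999999, .negSucc 84099999999, .ofNat 1623117138432⟩,
  ⟨.ofNat 0, .ofNat 0, .ofNat 1500000000, .ofNat 0, .ofNat 0, .ofNat 0, .ofNat 7545166105⟩,
  ⟨.ofNat 0, .ofNat 0, .ofNat 0, .ofNat 0, .ofNat 1500000000, .ofNat 0, .ofNat 7545166105⟩,
  ⟨.ofNat 0, .ofNat 0, .ofNat 0, .ofNat 0, .ofNat 0, .ofNat 1500000000, .ofNat 7545166105⟩,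
  ⟨.ofNat 700000000, .ofNat 700000000, .negSucc 699999999, .ofNat 4900000000, .negSucc 4899999999, .negSucc 4899999999, .ofNat 20156767695⟩,
  ⟨.ofNat 700000000, .ofNat 4900000000, .negSucc 4899999999, .ofNat 700000000, .negSucc 699999999, .negSucc 4899999999, .ofNat 20156767695⟩,
  ⟨.ofNat 4900000000, .ofNat 3500000000, .negSucc 7699999999, .ofNat 3500000000, .negSucc 7699999999, .negSucc 5499999999, .ofNat 24360634892⟩]

/-- Vertices of the polytope `rows1`. -/
noncomputable def vtxT : Vtx :=
  ⟨362465471, 200000000, 100000000, 200000000, 100000000, 100000000, 50000000, 9917146792449, 1314433337686⟩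

noncomputable def vtx1 : List Vtx := [
  ⟨199999999, 200000000, 100000000, 200000000, 100000000, 100000000, 50000000, 5514788471040, 4509749936896⟩,
  ⟨199999999, 200000000, 100000000, 200154999, 100000000, 100000000, 50000000, 7718123471104, 1121440237138⟩,
  ⟨199999999, 200099999, 100000000, 200000000, 100000000, 100000000, 50000000, 8817635164672, 1117161655891⟩,
  ⟨199999999, 200000000, 100000000, 200000000, 100000000, 100099999, 50000000, 8813323354368, 1129661268782⟩,
  ⟨199999999, 200000000, 100000000, 200055000, 100000000, 100099999, 50000000, 8826225033472, 2216321680943⟩,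
  ⟨199999999, 200099999, 100000000, 200154999, 100000000, 100000000, 50000000, 8826241942016, 2211993948756⟩,
  ⟨199999999, 200000000, 100000000, 200000000, 100055000, 100154999, 50000000, 8826208256256, 33002613120816⟩,
  ⟨2399999988, 2400000000, 2948193259, 2400000000, 2948853259, 2950053247, 600000000, 8826258653440, 35270390260017⟩,
  ⟨17360852274595, 6861600000000, 7933005919232, 6861600000000, 3430800000000, 3430800000000, 1715400000000, 9921458602753, 24190112127063⟩,
  ⟨17360852274595, 6861600000000, 3430800000000, 6861600000000, 7933005919232, 3430800000000, 1715400000000, 9921458536961, 37384273594714⟩,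
  ⟨1199999994, 1200000000, 1509033221, 1200000000, 600000000, 600000000, 300000000, 11016658419968, 1164574461462⟩,
  ⟨1199999994, 1200000000, 1509033221, 2109963215, 600000000, 600000000, 300000000, 11025265197312, 2246553965122⟩,
  ⟨2399999988, 2400000000, 3018066442, 4219926430, 2809106893, 1200000000, 600000000, 11025282040064, 43052954882883⟩,
  ⟨1199999994, 1200599994, 1509033221, 1200000000, 600000000, 600000000, 300000000, 11029560165120, 3346032235031⟩,
  ⟨1199999994, 1200000000, 1509033221, 1200000000, 600000000, 600599994, 300000000, 11029543321856, 4445627813400⟩,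
  ⟨4799999976, 8230233311, 6036132884, 4800000000, 5827833335, 2400000000, 1200000000, 11029577007872, 45260601561879⟩,
  ⟨1199999994, 1200000000, 1509033221, 2109363221, 600000000, 600599994, 300000000, 11029593719040, 5549350785561⟩,
  ⟨1199999994, 1200599994, 1509033221, 2109963215, 600000000, 600000000, 300000000, 11029593785344, 6648845374276⟩,
  ⟨4799999976, 6410306881, 6036132884, 8439852860, 4007906905, 2400000000, 1200000000, 11029593851136, 47335104189765⟩,
  ⟨4799999976, 4800000000, 6036132884, 4800000000, 5827833335, 5830233311, 1200000000, 11029576876288, 8985324621848⟩,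
  ⟨2399999988, 2400000000, 3018066442, 2609619549, 2809106893, 2810306881, 600000000, 11029593850112, 8852264260377⟩,
  ⟨5829033311, 2400000000, 3018066442, 2400000000, 1200000000, 1200000000, 600000000, 11020970230529, 9943254910487⟩,
  ⟨8227833311, 8230233311, 6036132884, 4800000000, 2400000000, 2400000000, 1200000000, 11029577008131, 100150283866183⟩,
  ⟨8227833311, 4800000000, 6036132884, 4800000000, 2400000000, 5830233311, 1200000000, 11029576942337, 58368858528023⟩,
  ⟨6409106869, 4800000000, 6036132884, 8437452884, 2400000000, 4011506869, 1200000000, 11029593850881, 59683269317961⟩,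
  ⟨1199999994, 1200000000, 600000000, 1200000000, 1509033221, 600000000, 300000000, 12116153204992, 1228816129058⟩,
  ⟨1199999994, 1200000000, 600000000, 1200929994, 1509033221, 600000000, 300000000, 12124776694016, 2311198285091⟩,
  ⟨1199999994, 2109633215, 600000000, 1200000000, 1509033221, 600000000, 300000000, 12129071727104, 3410726037834⟩,
  ⟨1199999994, 2109633215, 600000000, 1200929994, 1509033221, 600000000, 300000000, 12129105412608, 6713505688395⟩,
  ⟨1199999994, 1200000000, 600000000, 1200000000, 1509033221, 600929994, 300000000, 12124743139584, 7808705634084⟩,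
  ⟨1199999994, 2108703221, 600000000, 1200000000, 1509033221, 600929994, 300000000, 12129105281536, 7825902084389⟩,
  ⟨4799999976, 4800000000, 5827173335, 4800000000, 6036132884, 5830893311, 1200000000, 12124793536768, 8985577464100⟩,
  ⟨2399999988, 2607639549, 2809766893, 2400000000, 3018066442, 2811626881, 600000000, 12129105478400, 8934221884197⟩,
  ⟨5829033311, 2400000000, 1200000000, 2400000000, 3018066442, 1200000000, 600000000, 12120481792513, 11107391712588⟩,
  ⟨8227173311, 4800000000, 2400000000, 8230893311, 6036132884, 2400000000, 1200000000, 12124793668097, 101301553997645⟩,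
  ⟨8227173311, 4800000000, 2400000000, 4800000000, 6036132884, 5830893311, 1200000000, 12124793537025, 60619674034213⟩,
  ⟨6409766869, 8434812884, 2400000000, 4800000000, 6036132884, 4013486869, 1200000000, 12129105478402, 61728580652833⟩,
  ⟨1199999994, 1200000000, 1509033221, 1200000000, 1509033221, 600000000, 300000000, 12137661661440, 12207037884973⟩,
  ⟨4799999976, 4800000000, 5827173335, 8230893311, 6036132884, 2400000000, 1200000000, 12124793667840, 14465904945955⟩,
  ⟨2399999988, 2400000000, 3018066442, 4010966881, 3018066442, 1200000000, 600000000, 12137678569728, 14461795314221⟩,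
  ⟨2399999988, 4219266430, 2809766893, 2400000000, 3018066442, 1200000000, 600000000, 12129088635648, 17773046606672⟩,
  ⟨2399999988, 4010966881, 3018066442, 2400000000, 3018066442, 1200000000, 600000000, 12137678570240, 17768920131629⟩,
  ⟨4799999976, 8438532860, 4007906905, 6411626881, 6036132884, 2400000000, 1200000000, 12129105478912, 21058914427217⟩,
  ⟨2399999988, 2400000000, 3018066442, 2400000000, 3018066442, 2810966881, 600000000, 12137678438656, 22128311675437⟩,
  ⟨4010966869, 2400000000, 3018066442, 2400000000, 3018066442, 1200000000, 600000000, 12137678570241, 24335925127210⟩,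
  ⟨2108433221, 1200000000, 600000000, 1200000000, 600000000, 1509033221, 300000000, 13228566577665, 4613603276090⟩,
  ⟨2108433221, 1200000000, 600000000, 1200330000, 600000000, 1509033221, 300000000, 13228616974849, 5756031088189⟩,
  ⟨2108103221, 1200000000, 600000000, 1200000000, 600330000, 1509033221, 300000000, 13228616909313, 7933579440440⟩,
  ⟨2604039573, 2400000000, 2812166869, 2400000000, 2812826869, 3018066442, 600000000, 13228617106177, 9033208575544⟩,
  ⟨9672448354157, 4915200000000, 2457600000000, 4915200000000, 2457600000000, 6181000073216, 1228800000000, 13232861544961, 198444856122⟩,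
  ⟨45464794974905, 20584800000000, 14823223733542, 20584800000000, 10292400000000, 25885955873034, 5146200000000, 13232895165185, 10124080201275⟩,
  ⟨45464794974905, 20584800000000, 10292400000000, 20584800000000, 14823223733542, 25885955873034, 5146200000000, 13232895099393, 11232182088512⟩,
  ⟨4216866442, 2400000000, 2812166869, 2400000000, 1200000000, 3018066442, 600000000, 13228600197889, 26608097375803⟩,
  ⟨8433732884, 4800000000, 4011506869, 6412826869, 2400000000, 6036132884, 1200000000, 13228617106433, 27754970951999⟩,
  ⟨4216206442, 2400000000, 1200000000, 2400000000, 2812826869, 3018066442, 600000000, 13224305164801, 39806565953848⟩,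
  ⟨8432412884, 6412166869, 2400000000, 4800000000, 4013486869, 6036132884, 1200000000, 13228617106178, 40919230333233⟩,
  ⟨67595662588963, 33182400000000, 16591200000000, 42484792321871, 20285359647052, 41727786627092, 8295600000000, 13232912073217, 102491680947777⟩,
  ⟨11291725067885, 6873105880941, 2918400000000, 5836800000000, 2918400000000, 7339937586944, 1459200000000, 13232928719618, 103552504577339⟩,
  ⟨67599126928963, 42479131501871, 20287556127052, 33182400000000, 16591200000000, 41727786627092, 8295600000000, 13232928850947, 104682097360959⟩,
  ⟨594287980415, 307200000000, 153600000000, 361813555839, 153600000000, 386312504576, 76800000000, 13232911942145, 105755822341693⟩,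
  ⟨12910748341613, 7794452440941, 3379200000000, 7796311000941, 3379200000000, 8498875100672, 1689600000000, 13232928916482, 106855501807935⟩,
  ⟨82463861714429, 41169600000000, 24278959647052, 55002816055413, 20584800000000, 51771911746068, 10292400000000, 13232912073729, 107984927340863⟩,
  ⟨104598193668487, 63894934768361, 29743292040562, 66769412788923, 26883600000000, 67613742500126, 13441800000000, 13232928916996, 109084623453505⟩,
  ⟨82467326054429, 54997155235413, 20584800000000, 41169600000000, 24281156127052, 51771911746068, 10292400000000, 13232928850690, 110192557179195⟩,
  ⟨104598193668487, 66754626808923, 26883600000000, 63909720748361, 29743292040562, 67613742500126, 13441800000000, 13232928916994, 111292153085247⟩,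
  ⟨76845337803, 67200000000, 84505860376, 127803278179, 33600000000, 33600000000, 16800000000, 14336718603265, 13633405338436⟩,
  ⟨467736912187, 369600000000, 464782232068, 748005584255, 236328633452, 184800000000, 92400000000, 14336718669057, 14737211541573⟩,
  ⟨28413712601, 28426312601, 31689697641, 47522940242, 12600000000, 12600000000, 6300000000, 14336735511812, 20238997866821⟩,
  ⟨236965546570, 251550115213, 253517581128, 389839367698, 115283768643, 100800000000, 50400000000, 14336735512069, 21342821237833⟩,
  ⟨160355560975, 100800000000, 126758790564, 185263838087, 50400000000, 50400000000, 25200000000, 14336701826049, 24645634376519⟩,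
  ⟨261105160975, 261205960975, 253517581128, 370527676174, 100800000000, 100800000000, 50400000000, 14336735446276, 25749507819845⟩,
  ⟨314046236581, 235200000000, 295770511316, 466634711171, 117600000000, 143364316726, 58800000000, 14336718668801, 27952825910089⟩,
  ⟨251449315213, 237066346570, 253517581128, 389839367698, 100800000000, 115283768643, 50400000000, 14336735512068, 27957154759749⟩,
  ⟨76861507803, 127800968179, 33600000000, 67200000000, 84505860376, 33600000000, 16800000000, 15440541975298, 31260052179792⟩,
  ⟨28418332601, 47520630242, 12600000000, 28437862601, 31689697641, 12600000000, 6300000000, 15440542106882, 32363875290961⟩,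
  ⟨160355560975, 185263838087, 50400000000, 100800000000, 126758790564, 50400000000, 25200000000, 15440508420866, 37865678327120⟩,
  ⟨261077440975, 370527676174, 100800000000, 261233680975, 253517581128, 100800000000, 50400000000, 15440525264130, 38969518280529⟩,
  ⟨314078576581, 466616231171, 117600000000, 235200000000, 295770511316, 143350456726, 58800000000, 15440542040834, 41172836437840⟩,
  ⟨251440075213, 389802407698, 100800000000, 237140266570, 253517581128, 115256048643, 50400000000, 15440542107138, 41177148443473⟩,
  ⟨467801592187, 747968624255, 236300913452, 369600000000, 464782232068, 184800000000, 92400000000, 15440542041347, 45579472883281⟩,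
  ⟨236984026570, 389802407698, 115256048643, 251596315213, 253517581128, 100800000000, 50400000000, 15440542107141, 47782808275791⟩,
  ⟨13037446223, 8400000000, 4200000000, 13043956223, 4200000000, 4200000000, 2100000000, 16522823336449, 2565712143956⟩,
  ⟨4346136241, 4347536241, 1400000000, 2800000000, 1400000000, 1400000000, 700000000, 16527118304002, 3669486359643⟩,
  ⟨16535696223, 16541646223, 5950000000, 16544918723, 5950000000, 5950000000, 2975000000, 16527151924226, 6950655979368⟩,
  ⟨72869855711, 41300000000, 20650000000, 51856074936, 20650000000, 20650000000, 10325000000, 16531413271041, 353803786326⟩,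
  ⟨72869855711, 51856074936, 20650000000, 41300000000, 20650000000, 20650000000, 10325000000, 16531413271298, 358065263959⟩,
  ⟨513554693502001, 389995625263077, 218347881596672, 239400000000000, 119700000000000, 119700000000000, 59850000000000, 16531430114307, 10287895763544⟩,
  ⟨513554693502001, 239400000000000, 218347881596672, 389995625263077, 119700000000000, 119700000000000, 59850000000000, 16531430114305, 10352303692119⟩,
  ⟨513554693502001, 239400000000000, 119700000000000, 389995625263077, 218347881596672, 119700000000000, 59850000000000, 16531430113793, 11391685449818⟩,
  ⟨513554693502001, 389995625263077, 119700000000000, 239400000000000, 218347881596672, 119700000000000, 59850000000000, 16531430114050, 11477602031959⟩,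
  ⟨362152030111, 362247230111, 167870653516, 190400000000, 95200000000, 95200000000, 47600000000, 16527135147011, 25663828358251⟩,
  ⟨21301611183, 11200000000, 5600000000, 21310291183, 9874563148, 5600000000, 2800000000, 16522840179201, 38866540914545⟩,
  ⟨1357448839824951, 689118400000000, 344559200000000, 1234238303346027, 513977997934996, 468303803238924, 172279600000000, 16531446956545, 63068799263333⟩,
  ⟨17579793326471, 15789898633671, 5043400000000, 10086800000000, 5043400000000, 6838338092800, 2521700000000, 16531463602946, 64129606115679⟩,
  ⟨1357513124264951, 1234178915226027, 514038936614996, 689118400000000, 344559200000000, 468237968238924, 172279600000000, 16531463734275, 65263493866595⟩,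
  ⟨52739027841913, 30260400000000, 15130200000000, 47374757853513, 15130200000000, 20517921798400, 7565100000000, 16531446825473, 66324317168225⟩,
  ⟨72673570653929, 59219736243513, 21056850000000, 59231317511013, 21056850000000, 34531741260416, 10528425000000, 16531463799810, 67432603346275⟩,
  ⟨434121157720300, 227678400000000, 156193899483749, 421054186755150, 113839200000000, 169437321208899, 56919600000000, 16531446957057, 68635060100451⟩,
  ⟨2483684043583201, 1987709102845604, 802452890875419, 2098604959401023, 691937600000000, 1188604478337597, 345968800000000, 16531463800324, 69739034403173⟩,
  ⟨144712409610100, 140346446575050, 37946400000000, 75892800000000, 52069711384583, 56473620819633, 18973200000000, 16531463734018, 70859886585183⟩,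
  ⟨2483684043583201, 2098224393721023, 691937600000000, 1988089668525604, 802452890875419, 1188604478337597, 345968800000000, 16531463800322, 71963743904099⟩,
  ⟨271474087761, 168000000000, 105450326602, 293054614363, 84000000000, 84000000000, 42000000000, 16548626760705, 72921740240744⟩,
  ⟨847615331799, 459200000000, 284320294246, 902691506045, 346917953984, 229600000000, 114800000000, 16548626826497, 74064201149545⟩,
  ⟨214565925174, 214638725174, 107499318929, 249378084103, 72800000000, 72800000000, 36400000000, 16548643669252, 75129286258025⟩,
  ⟨438787696110, 459854295261, 221435868366, 514849244476, 166520999151, 145600000000, 72800000000, 16548643669509, 76370548582509⟩,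
  ⟨23126184831, 11200000000, 10102634854, 19257645829, 5600000000, 5600000000, 2800000000, 16548609983489, 77345489446763⟩,
  ⟨916198775268, 916489975268, 489541657915, 989465798277, 291200000000, 291200000000, 145600000000, 16548643603716, 78457952824681⟩,
  ⟨187947833735, 100800000000, 73402201078, 192363934861, 50400000000, 69064219952, 25200000000, 16548626826241, 79587529090925⟩,
  ⟨3188993329541, 3043565535484, 1593502384491, 3618428479975, 1019200000000, 1165646994057, 509600000000, 16548643669508, 80691369568361⟩,
  ⟨90500602587, 97684358121, 28000000000, 56000000000, 35155755534, 28000000000, 14000000000, 16552938504962, 81722229288820⟩,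
  ⟨214575165174, 249373464103, 72800000000, 214688005174, 107525498929, 72800000000, 36400000000, 16552938636546, 82826052399989⟩,
  ⟨23126184831, 19257645829, 5600000000, 11200000000, 10102634854, 5600000000, 2800000000, 16552904950530, 83951283761524⟩,
  ⟨916124855268, 989462718277, 291200000000, 916576215268, 489532417915, 291200000000, 145600000000, 16552921793794, 85059418682229⟩,
  ⟨62651751245, 64118978287, 16800000000, 33600000000, 24469547026, 23019119984, 8400000000, 16552938570498, 86193289982836⟩,
  ⟨3188768489541, 3618120479975, 1019200000000, 3044181535484, 1593699504491, 1165366714057, 509600000000, 16552938636802, 87297113616245⟩,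
  ⟨847652291799, 902649926045, 346874833984, 459200000000, 284368034246, 229600000000, 114800000000, 16552938571011, 88353658532469⟩,
  ⟨438787696110, 514809204476, 166480959151, 459894335261, 221475908366, 145600000000, 72800000000, 16552938636805, 89513316872051⟩]

lemma geo1 : (vtxT :: vtx1).all (geoV rows1 (vtxT :: vtx1)) = true := by decide +kernel

lemma ev1 : vtx1.all (evV 1000000000 1000000000 1000000000 71067812) = true := by decide +kernel

/-- Constraints for tetrahedra with 2 small balls. -/
noncomputable def rows2 : List Row := [
  ⟨.negSucc 99999999, .ofNat 0, .ofNat 0, .ofNat 0, .ofNat 0, .ofNat 0, .negSucc 399999999⟩,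
  ⟨.ofNat 0, .negSucc 99999999, .ofNat 0, .ofNat 0, .ofNat 0, .ofNat 0, .negSucc 199999999⟩,
  ⟨.ofNat 0, .ofNat 0, .negSucc 99999999, .ofNat 0, .ofNat 0, .ofNat 0, .negSucc 199999999⟩,
  ⟨.ofNat 0, .ofNat 0, .ofNat 0, .negSucc 99999999, .ofNat 0, .ofNat 0, .negSucc 199999999⟩,
  ⟨.ofNat 0, .ofNat 0, .ofNat 0, .ofNat 0, .negSucc 99999999, .ofNat 0, .negSucc 199999999⟩,
  ⟨.ofNat 0, .ofNat 0, .ofNat 0, .ofNat 0, .ofNat 0, .negSucc 99999999, .negSucc 68629149⟩,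
  ⟨.ofNat 1600000000, .ofNat 1600000000, .ofNat 1600000000, .ofNat 1600000000, .ofNat 1600000000, .ofNat 1600000000, .ofNat 34384531313⟩,
  ⟨.ofNat 0, .negSucc 99999999, .negSucc 99999999, .ofNat 100000000, .ofNat 100000000, .ofNat 0, .ofNat 200000⟩,
  ⟨.ofNat 0, .negSucc 99999999, .ofNat 100000000, .negSucc 99999999, .ofNat 100000000, .ofNat 0, .ofNat 226000⟩,
  ⟨.ofNat 0, .ofNat 0, .ofNat 0, .ofNat 0, .ofNat 0, .ofNat 6400000000, .ofNat 17569062526⟩,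
  ⟨.negSucc 15299999999, .ofNat 39100000000, .negSucc 25499999999, .negSucc 20699999999, .ofNat 13500000000, .negSucc 34499999999, .ofNat 34384531313⟩,
  ⟨.ofNat 34200000000, .ofNat 7600000000, .negSucc 47499999999, .ofNat 7200000000, .negSucc 44999999999, .negSucc 9999999999, .ofNat 95340605666⟩,
  ⟨.ofNat 115600000000, .negSucc 88399999999, .negSucc 88399999999, .negSucc 88399999999, .negSucc 88399999999, .ofNat 67600000000, .ofNat 160500547216⟩,
  ⟨.negSucc 85999999999, .negSucc 155999999999, .ofNat 170000000000, .ofNat 335400000000, .negSucc 365499999999, .negSucc 662999999999, .ofNat 65913535289⟩,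
  ⟨.ofNat 4000000000, .ofNat 17000000000, .negSucc 14999999999, .ofNat 6800000000, .negSucc 5999999999, .negSucc 25499999999, .ofNat 46996132904⟩,
  ⟨.ofNat 7200000000, .ofNat 13600000000, .negSucc 14399999999, .ofNat 15300000000, .negSucc 16199999999, .negSucc 30599999999, .ofNat 53301933699⟩,
  ⟨.ofNat 15400000000, .ofNat 18200000000, .negSucc 30799999999, .ofNat 14300000000, .negSucc 24199999999, .negSucc 28599999999, .ofNat 70117402486⟩,
  ⟨.negSucc 2799999999, .ofNat 35000000000, .negSucc 29399999999, .negSucc 4999999999, .ofNat 4200000000, .negSucc 52499999999, .ofNat 42792265707⟩]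

/-- Vertices of the polytope `rows2`. -/
noncomputable def vtx2 : List Vtx := [
  ⟨8000000, 4000000, 4000000, 4000000, 4000000, 1372583, 2000000, 5514788471040, 6605676707877⟩,
  ⟨8000000, 4000000, 4000000, 4004000, 4000000, 1372583, 2000000, 7718123471104, 30103132710⟩,
  ⟨8000000, 4000000, 4000000, 4000000, 4004000, 1372583, 2000000, 7718106693888, 34376847911⟩,
  ⟨8000000, 4000000, 4004520, 4000000, 4000000, 1372583, 2000000, 8817635164416, 51628344360⟩,
  ⟨12800000000, 20482848913, 20490080913, 6400000000, 6400000000, 2196132800, 3200000000, 8821946974976, 20903825263390⟩,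
  ⟨8000000, 4000000, 4000260, 4000000, 4004260, 1372583, 2000000, 8826241876224, 2212148024617⟩,
  ⟨12800000000, 6400000000, 6400000000, 6400000000, 6400000000, 8784531263, 3200000000, 9912834982144, 34477971242⟩,
  ⟨12800000000, 6400000000, 6400000000, 6406400000, 6400000000, 8784531263, 3200000000, 9925736661248, 1125416372523⟩,
  ⟨12800000000, 6400000000, 6400000000, 6400000000, 6406400000, 8784531263, 3200000000, 9925719884032, 2224911419948⟩,
  ⟨25600000000, 34378131363, 12800000000, 34390931363, 12800000000, 17569062526, 6400000000, 9925770347008, 100416453479201⟩,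
  ⟨25600000000, 34378131363, 12800000000, 12800000000, 34390931363, 17569062526, 6400000000, 9925770281472, 27599594655533⟩,
  ⟨25600000000, 12800000000, 34378131363, 34390931363, 12800000000, 17569062526, 6400000000, 9925770346752, 84731233372462⟩,
  ⟨12800000000, 6400000000, 6407232000, 6400000000, 6400000000, 8784531263, 3200000000, 9930031694080, 3324540620079⟩,
  ⟨25600000000, 34377299363, 34391763363, 12800000000, 12800000000, 17569062526, 6400000000, 9930065314560, 4514212941872⟩,
  ⟨12800000000, 6400000000, 6400416000, 6400000000, 6406816000, 8784531263, 3200000000, 9930082025728, 5532120321841⟩,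
  ⟨25600000000, 34377299363, 12800832000, 12800000000, 34390931363, 17569062526, 6400000000, 9930082222848, 30829494276402⟩,
  ⟨25600000000, 12800000000, 34391763363, 34377299363, 12800000000, 17569062526, 6400000000, 9930065314048, 85809354050867⟩,
  ⟨25600000000, 12800000000, 34378131363, 34377299363, 12813632000, 17569062526, 6400000000, 9930082222336, 86908932591412⟩,
  ⟨210400000000, 211634588063, 105200000000, 105200000000, 211739788063, 36098932900, 52600000000, 11025265132032, 2753502057858⟩,
  ⟨4134400000000, 7362633961823, 5871622371975, 2067200000000, 2067200000000, 709350894400, 1033600000000, 11020970230528, 4965436523910⟩,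
  ⟨832000000000, 1331385179345, 1082964005037, 416000000000, 664891254308, 142748632000, 208000000000, 11029577007872, 4480005052039⟩,
  ⟨210400000000, 211636148063, 105206838000, 105200000000, 211748186063, 36098932900, 52600000000, 11029593785088, 5575204935304⟩,
  ⟨6323200000000, 8117716467911, 5162616399111, 5162410895111, 8121083571911, 1084889603200, 1580800000000, 11029593851136, 88549677669514⟩,
  ⟨5004800000000, 8182168287751, 2502400000000, 2502400000000, 2502400000000, 3434751723833, 1251200000000, 11033838289408, 7194512005912⟩,
  ⟨4861491737591, 6231900793145, 1740800000000, 1740800000000, 1740800000000, 2389392503536, 870400000000, 11033871909634, 39956468356635⟩,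
  ⟨7782400000000, 10452879803993, 3891200000000, 3891200000000, 10456771003993, 5337139268622, 1945600000000, 11025281909248, 11107096665228⟩,
  ⟨1638400000000, 2202128276873, 819200000000, 819200000000, 2199091737591, 1124420001664, 409600000000, 11033871843840, 11102882110232⟩,
  ⟨4134400000000, 7659111892658, 3447091737591, 2067200000000, 2067200000000, 2837403597949, 1033600000000, 11033871909632, 14375643142424⟩,
  ⟨7782400000000, 10452761243993, 3891452928000, 3891200000000, 10456905371993, 5336870532622, 1945600000000, 11029593850624, 16600385525390⟩,
  ⟨16497607621251, 3478400000000, 6362250669590, 6365729069590, 3478400000000, 1193598176800, 1739200000000, 12124793668609, 89194495418460⟩,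
  ⟨16419404577599, 6347360397590, 6351276525590, 3465600000000, 3465600000000, 1189205911200, 1732800000000, 12129088635907, 4845666378527⟩,
  ⟨16501335973251, 3478400000000, 6364090989590, 6360160397590, 3478400000000, 1193598176800, 1739200000000, 12129088635905, 90285484482590⟩,
  ⟨16501165573251, 3478400000000, 6360471693590, 6360245597590, 3482104496000, 1193598176800, 1739200000000, 12129105478913, 91384543198499⟩,
  ⟨6357709986750, 3143014609267, 1715200000000, 3144729809267, 1715200000000, 2354254378484, 857600000000, 12133400445954, 10347184275264⟩,
  ⟨7953466869387, 3133890134795, 1692800000000, 1692800000000, 3135582934795, 580877125600, 846400000000, 12124793668354, 157690835986979⟩,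
  ⟨7953581477387, 3133722798795, 1692910032000, 1692800000000, 3135525630795, 580877125600, 846400000000, 12129105478915, 158476211078432⟩,
  ⟨449209151716, 325696944181, 121600000000, 121600000000, 121600000000, 166906093997, 60800000000, 12133383537410, 26853314601288⟩,
  ⟨102663405227, 28900000000, 28900000000, 28900000000, 28900000000, 9916912175, 14450000000, 13215681675777, 181045438529⟩,
  ⟨102685505227, 28900000000, 28900000000, 28928900000, 28900000000, 9916912175, 14450000000, 13224288453121, 1259149407797⟩,
  ⟨102685505227, 28900000000, 28900000000, 28900000000, 28928900000, 9916912175, 14450000000, 13224288387585, 2358677743938⟩,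
  ⟨102688378227, 28900000000, 28932657000, 28900000000, 28900000000, 9916912175, 14450000000, 13228583420673, 3458239904312⟩,
  ⟨102688378227, 28900000000, 28901878500, 28900000000, 28930778500, 9916912175, 14450000000, 13228617040641, 5665736178756⟩,
  ⟨5457018594281, 1849600000000, 1849600000000, 1849600000000, 1849600000000, 2538729535007, 924800000000, 13232861544961, 6756724584262⟩,
  ⟨5458432994281, 1849600000000, 1849600000000, 1851449600000, 1849600000000, 2538729535007, 924800000000, 13232911942145, 7860497690174⟩,
  ⟨5458432994281, 1849600000000, 1849600000000, 1849600000000, 1851449600000, 2538729535007, 924800000000, 13232911876609, 8964304220461⟩,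
  ⟨13056000025504, 5502423484813, 3264000000000, 3264000000000, 5505687484813, 4480110944130, 1632000000000, 13232912073474, 11284073168690⟩,
  ⟨13056000025504, 3264000000000, 5502423484813, 5505687484813, 3264000000000, 4480110944130, 1632000000000, 13232912073729, 12331709576256⟩,
  ⟨5458616866281, 1849600000000, 1851690048000, 1849600000000, 1849600000000, 2538729535007, 924800000000, 13232928719617, 13366646092592⟩,
  ⟨13056000025504, 5502211324813, 5505899644813, 3264000000000, 3264000000000, 4480110944130, 1632000000000, 13232928850947, 14539675349555⟩,
  ⟨5458616866281, 1849600000000, 1849720224000, 1849600000000, 1851569824000, 2538729535007, 924800000000, 13232928916225, 15569997739058⟩,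
  ⟨13056000025504, 5502211324813, 3264212160000, 3264000000000, 5505687484813, 4480110944130, 1632000000000, 13232928916995, 16789785293108⟩,
  ⟨13056000025504, 3264000000000, 5505899644813, 5502211324813, 3264000000000, 4480110944130, 1632000000000, 13232928850945, 17846363960368⟩,
  ⟨13056000025504, 3264000000000, 5502423484813, 5502211324813, 3267476160000, 4480110944130, 1632000000000, 13232928916993, 18954465784114⟩,
  ⟨2326601627122, 693444682213, 625600000000, 694070282213, 625600000000, 214671981200, 312800000000, 13241501942786, 120011070784054⟩,
  ⟨15544937060705, 3469700000000, 5572885148603, 5576354848603, 3469700000000, 1190612808775, 1734850000000, 13241501942785, 32050022661173⟩,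
  ⟨4848081216541379, 1025280000000000, 1843325427175306, 1844350707175306, 1025280000000000, 430486481793209, 512640000000000, 13241502008321, 32084399111488⟩,
  ⟨15981439504613, 5705095457603, 5709146846603, 3585300000000, 3585300000000, 1230280457475, 1792650000000, 13241518720003, 33158241797178⟩,
  ⟨4848832980369247, 1845018485095306, 1846178787175306, 1026816000000000, 1026816000000000, 439646155075581, 513408000000000, 13241518785539, 33192718910779⟩,
  ⟨15570685991705, 3469700000000, 5593416218603, 5589495457603, 3469700000000, 1190612808775, 1734850000000, 13241518720001, 34257569004600⟩,
  ⟨4849535273821379, 1025280000000000, 1844641051495306, 1843482485095306, 1025280000000000, 428585022273209, 512640000000000, 13241518785537, 34304830356793⟩,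
  ⟨15569509166705, 3469700000000, 5588951525603, 5588725995103, 3473395230500, 1190612808775, 1734850000000, 13241518851329, 35361375534404⟩,
  ⟨4849468817821379, 1025280000000000, 1843538904295306, 1843472261095306, 1026371923200000, 428671926273209, 512640000000000, 13241518851585, 35408637017157⟩,
  ⟨2371197908959046, 973497609727883, 620595200000000, 974118204927883, 620595200000000, 851818427510584, 310297600000000, 13241535628290, 36469461106496⟩,
  ⟨3407616006656544, 1436132529536193, 851904000000000, 1308696476739907, 980191956796286, 1169308956417930, 425952000000000, 13241535628802, 36478285987392⟩,
  ⟨7193856014052704, 2775259426539391, 2055039913592572, 3033633804131963, 1798464000000000, 2468541130215630, 899232000000000, 13241535628804, 36482379693631⟩,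
  ⟨36267607830845, 11867424148603, 9754600000000, 9754600000000, 9754600000000, 3347249532950, 4877300000000, 13241468322562, 121106371589432⟩,
  ⟨18545889112288, 6426070948603, 4307800000000, 4307800000000, 6430378748603, 1478203261850, 2153900000000, 13241501942530, 37551993992516⟩,
  ⟨2422143898026711, 927330937587653, 518208000000000, 518208000000000, 927849145587653, 254491019625203, 259104000000000, 13241502008066, 37577864396613⟩,
  ⟨18547472135288, 6426825995103, 4308080007000, 4307800000000, 6431413802103, 1478203261850, 2153900000000, 13241518851331, 38660111615292⟩,
  ⟨2422188595146711, 927304130547653, 518241683520000, 518208000000000, 927856022067653, 254432569545203, 259104000000000, 13241518851587, 38698783163453⟩,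
  ⟨1191054558673804, 665358057727883, 312147200000000, 312147200000000, 312147200000000, 428447943290299, 156073600000000, 13241535431426, 39763902414408⟩,
  ⟨1716864003353776, 951964926622863, 429216000000000, 429216000000000, 495601665882956, 589134589153095, 214608000000000, 13241535562498, 39776820805448⟩,
  ⟨3596928007026352, 2000731240366051, 1032003331765912, 899232000000000, 899232000000000, 1234270565107815, 449616000000000, 13241535562755, 39789537937216⟩,
  ⟨2021600000000, 1010800000000, 1907253999789, 1908264799789, 1010800000000, 346851724100, 505400000000, 14323800080640, 1418636057937⟩,
  ⟨2021600000000, 1010800000000, 1908682803789, 1907540599789, 1010800000000, 346851724100, 505400000000, 14328095047936, 3613381118802⟩,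
  ⟨10483200000000, 12321436535509, 16781376267747, 9695616724238, 5241600000000, 1798632763200, 2620800000000, 14328111891456, 4803020083282⟩,
  ⟨2021600000000, 1010800000000, 1908746916789, 1908681214789, 1011876502000, 346851724100, 505400000000, 14328128667904, 5812337463379⟩,
  ⟨58604800000000, 29302400000000, 83160055184907, 83189357584907, 29302400000000, 31300140463327, 14651200000000, 14323816857856, 12430865293137⟩,
  ⟨58604800000000, 29302400000000, 83194080656907, 83160968944907, 29302400000000, 31294503631327, 14651200000000, 14328111825152, 17924145236818⟩,
  ⟨58604800000000, 29302400000000, 83171998520907, 83170093864907, 29333607056000, 31276253791327, 14651200000000, 14328128733440, 19023723778131⟩,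
  ⟨43814400000000, 36054706511018, 55966709286181, 55965285318181, 36078037679018, 7517362574400, 10953600000000, 14328128734464, 24602835963731⟩,
  ⟨14307315479509, 3612800000000, 8021945303634, 8025558103634, 3612800000000, 1239716965600, 1806400000000, 14323816924161, 32239254328161⟩,
  ⟨14305436535509, 3612800000000, 8026732407634, 8022649943634, 3612800000000, 1239716965600, 1806400000000, 14328111891457, 34433999459147⟩,
  ⟨14299353255509, 3612800000000, 8025926415634, 8025691583634, 3616647632000, 1239716965600, 1806400000000, 14328128734465, 35533645172560⟩,
  ⟨435200000000, 745927864103, 217600000000, 423146202239, 217600000000, 298674062942, 108800000000, 15431918420480, 10322238265686⟩,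
  ⟨790758400000000, 1413518910640619, 395379200000000, 623436695554593, 395379200000000, 542690772365614, 197689600000000, 15436263719424, 25651983178070⟩,
  ⟨186038786174101, 256069684910831, 71206400000000, 82866624859806, 71206400000000, 97736694832138, 35603200000000, 15436263851010, 26750521530457⟩,
  ⟨1226858981204319, 1548361088812367, 433664000000000, 433664000000000, 433664000000000, 583579613521074, 216832000000000, 15436213388034, 26876086343314⟩,
  ⟨713139200000000, 1277058836197927, 356569600000000, 595014957986154, 400195586174101, 489421374786782, 178284800000000, 15436263850496, 28950584973654⟩,
  ⟨802995200000000, 1469564518292812, 445123586174101, 643888686059529, 401497600000000, 551088784253042, 200748800000000, 15436263851008, 30050113378390⟩,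
  ⟨115600000000, 106671853599, 57800000000, 106729653599, 57800000000, 19833824350, 28900000000, 16522823336448, 1521951726964⟩,
  ⟨5766400000000, 7974628720962, 2883200000000, 7977511920962, 2883200000000, 3495522071089, 1441600000000, 16522840113664, 10322323136373⟩,
  ⟨3351396521996279, 873006473037426, 1278454690148022, 1416277083185448, 735920000000000, 252527820340000, 367960000000000, 16540036891908, 32304436639609⟩,
  ⟨115556800000000, 105564452418249, 92058220116483, 139902050934732, 57778400000000, 19826412401800, 28889200000000, 16548626760704, 80652479193185⟩,
  ⟨2290144000000000, 3019654871284749, 2691753332621286, 2764437968237320, 1145072000000000, 392926590244000, 572536000000000, 16548609983488, 82898730311777⟩,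
  ⟨22887616000000000, 24620416928021787, 21646371338920233, 34834424074942020, 11443808000000000, 7532980694353430, 5721904000000000, 16548626826240, 85054820540513⟩,
  ⟨5466368000000000, 6084244874615367, 5396522239130413, 7720005836220800, 3763494461524980, 937880473568000, 1366592000000000, 16548626826496, 88400600063841⟩,
  ⟨4133635307668715, 1665179011732473, 2328137001629927, 2829185309362400, 1165296000000000, 399866369892000, 582648000000000, 16548626826500, 89457162018656⟩,
  ⟨197200000000, 193829640495, 98600000000, 171526003379, 98600000000, 33834170950, 49300000000, 16552888107520, 166414470374778⟩,
  ⟨19692800000000, 28597974606255, 9846400000000, 25930604130796, 9846400000000, 11887024113050, 4923200000000, 16552904884736, 92751469700475⟩,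
  ⟨7595600000000, 7424068538919, 3797800000000, 7047028307947, 4178638030972, 1303198929350, 1898900000000, 16552921727488, 167513965422204⟩,
  ⟨870400000000, 1309689718143, 1013762618417, 897906891608, 435200000000, 149337030400, 217600000000, 16552904950784, 168630656657021⟩,
  ⟨59392000000000, 73415702883813, 51322646312507, 77379533679320, 47388511517000, 10190056192000, 14848000000000, 16552921793792, 169738808616830⟩,
  ⟨769868800000000, 1080599927269749, 384934400000000, 1035472174786946, 430447086882803, 434861651763898, 192467200000000, 16552921793024, 170816811853439⟩,
  ⟨151657457931415, 70215772241467, 58068642501274, 33318400000000, 33318400000000, 11433067356800, 16659200000000, 17639531676675, 33468237769590⟩,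
  ⟨1372753363666110, 803044499729654, 389366400000000, 803433866129654, 389366400000000, 425842087046483, 194683200000000, 17639548519426, 36788214000247⟩,
  ⟨1615519504824543, 638788407658889, 344374400000000, 346900120365206, 636607061693683, 118170611768800, 172187200000000, 17639548519682, 37874823948665⟩,
  ⟨53183886711677, 21088477704118, 11334400000000, 11334400000000, 20959494306051, 3889351188800, 5667200000000, 17639531676418, 37879169182312⟩,
  ⟨369263036775916, 310463000264827, 103532800000000, 103532800000000, 103532800000000, 122152689060059, 51766400000000, 17639531610882, 40069602437480⟩,
  ⟨31889193393661, 12038000143724, 8835800000000, 12046835943724, 8835800000000, 3031967217850, 4417900000000, 17639548453890, 58774184880760⟩,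
  ⟨1308685534567, 589998710266, 361000000000, 361000000000, 361000000000, 123875615750, 180500000000, 17639514833666, 71946816154984⟩,
  ⟨435269023414, 266437771867, 135000000000, 135000000000, 135000000000, 46324676250, 67500000000, 17652399735554, 171998163729008⟩,
  ⟨26483495347455, 15062488465681, 11017055091779, 6256000000000, 6256000000000, 2146719812000, 3128000000000, 17652416578563, 173071871865725⟩,
  ⟨260262953960689, 252690071175515, 78304000000000, 78304000000000, 78304000000000, 93524456092906, 39152000000000, 17652416512770, 96123237923696⟩,
  ⟨425569682552583, 181417913775484, 93846400000000, 101550544501306, 173807615674178, 32202993312800, 46923200000000, 17652433421570, 174180041260926⟩,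
  ⟨178852378455651, 76084513893106, 38944000000000, 38944000000000, 72271385642453, 13363468088000, 19472000000000, 17652416578306, 175283780022896⟩,
  ⟨13689785262879, 6483060218454, 4221200000000, 6487281418454, 4221200000000, 1448486839900, 2110600000000, 17656728323074, 99426252455032⟩,
  ⟨241646577328490, 229550897101074, 91798400000000, 229642695501074, 91798400000000, 101952079845393, 45899200000000, 17656728388610, 100508600926071⟩,
  ⟨47996921894723533, 19294659974523777, 18295174355282334, 14661224519726704, 10662387200000000, 3658752852534400, 5331193600000000, 17656795497732, 101603851401081⟩,
  ⟨204067587700948310, 77455408610349486, 71733753158285440, 99750927890234926, 49487721600000000, 29258386341502607, 24743860800000000, 17656795563524, 101608012019833⟩,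
  ⟨5443412574216291, 1836880679629560, 1787920908540786, 2258262694970346, 1367906800000000, 469391404816100, 683953400000000, 17656795563268, 101625175111545⟩,
  ⟨228383507447852435, 74770743040336509, 75183561772941456, 86935876151998558, 63069220997279407, 17429174230972000, 25396168000000000, 17656795563525, 101612457982071⟩,
  ⟨418343467488187, 262193745844026, 138618000000000, 183897493274470, 138618000000000, 47566177573500, 69309000000000, 17656845763586, 108230835141757⟩,
  ⟨14909444435086919, 16985768186074839, 6087795200000000, 14450781481222068, 6087795200000000, 6892785710594642, 3043897600000000, 17656845829122, 109338953416573⟩,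
  ⟨876909530976299, 476892393770274, 260205200000000, 398717728400718, 338640070569556, 89288308507900, 130102600000000, 17656845894914, 110442743234430⟩,
  ⟨13323133173400125, 7586905307774739, 5562292330422121, 3241814098104640, 3160400000000000, 1084477828300000, 1580200000000000, 17656845829380, 111533698481022⟩,
  ⟨2860498859318205, 1371607981364571, 874029574130329, 1142445096901240, 1103899290593660, 242546396764000, 353416000000000, 17656845895173, 112641850571903⟩,
  ⟨30014442075010075, 25498596102262893, 10319740800000000, 22967841343010122, 12860815300052771, 9225892717052786, 5159870400000000, 17656845895170, 113741294959742⟩,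
  ⟨140000000000, 150422569457, 70000000000, 70000000000, 70000000000, 24020202500, 35000000000, 18713239814656, 599174644892⟩,
  ⟨12331200000000, 12551260178049, 6165600000000, 6165600000000, 11981931164363, 2115699436200, 3082800000000, 18734731428352, 20343305766018⟩,
  ⟨18674694613686, 18372799461157, 9049600000000, 9049600000000, 18381849061157, 3105331779200, 4524800000000, 18734765114114, 20407563092872⟩,
  ⟨17134400000000, 17422031926249, 8567200000000, 8854947306843, 17142851819406, 2939798269400, 4283600000000, 18734765113856, 20446217865602⟩,
  ⟨10281600000000, 15932751678987, 10957131164363, 5140800000000, 5140800000000, 1764043671600, 2570400000000, 18734731494144, 21442817262982⟩,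
  ⟨202739200000000, 359252890122395, 265630853234081, 125456092157538, 101369600000000, 34784547419200, 50684800000000, 18734748337152, 21550075382150⟩,
  ⟨387846584315076, 597292245340025, 441833409137461, 169836800000000, 169836800000000, 58278776113600, 84918400000000, 18734748337155, 21567254988677⟩,
  ⟨108261687374814, 122005582390569, 83140278507928, 41932800000000, 80845487946641, 14389062105600, 20966400000000, 18734781957379, 22610964942474⟩,
  ⟨18675806269686, 18373257009157, 9050188224000, 9049600000000, 18382894833157, 3105331779200, 4524800000000, 18734782022915, 23710409395850⟩,
  ⟨257305600000000, 331775562737801, 208631828543325, 212803533681657, 327732510399469, 44146661545600, 64326400000000, 18734765180160, 24852920765834⟩,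
  ⟨69981233785166, 86993637304005, 54550182901964, 54547976437964, 87029789368005, 11648288371200, 16972800000000, 18734782023173, 24810038462606⟩,
  ⟨33810000000000, 45051547270410, 16905000000000, 16905000000000, 16905000000000, 11617210068113, 8452500000000, 18734714651136, 25840697050259⟩,
  ⟨3189275324056686, 2642491030782217, 1047961600000000, 1047961600000000, 2643538992382217, 689292843410624, 523980800000000, 18734765179650, 28104462601614⟩,
  ⟨1220134400000000, 1792568204215249, 610067200000000, 1156743262028343, 1246502209386906, 529258081067700, 305033600000000, 18734765179392, 28156019050892⟩,
  ⟨3189244451032686, 2642463975390217, 1048029717504000, 1047961600000000, 2643580054494217, 689241592210624, 523980800000000, 18734782023171, 31407158560906⟩,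
  ⟨1453646605818, 778639532219, 358400000000, 358400000000, 778997932219, 122983436800, 179200000000, 18721863435010, 38068485398160⟩,
  ⟨1453579629818, 778649724219, 358423296000, 358400000000, 779031420219, 122983436800, 179200000000, 18726175245571, 39099361169034⟩,
  ⟨148580000000000, 214673985430135, 74290000000000, 89722555481415, 74290000000000, 60710971484974, 37145000000000, 18751995249152, 94058031978131⟩,
  ⟨4223436555939267, 5924854779051776, 3564157755479881, 1684256000000000, 1684256000000000, 1016649275500366, 842128000000000, 18751995380739, 96235680928918⟩,
  ⟨101728555481415, 127890710928275, 43148000000000, 43148000000000, 43148000000000, 37429809271978, 21574000000000, 18751995249410, 96257139052946⟩,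
  ⟨3636379811707149, 3873961070538067, 1200640000000000, 1200640000000000, 1737754787279966, 1251700479112418, 600320000000000, 18751995380482, 96261484287378⟩,
  ⟨2765939200000000, 4295780409556832, 1382969600000000, 2618069411707149, 2470896578934733, 1326582773591000, 691484800000000, 18751995380224, 97365223642772⟩,
  ⟨10741619200000000, 19085760470252777, 12986298452543131, 7080658711878534, 5370809600000000, 2445094461375872, 2685404800000000, 18751995380736, 98430341977490⟩,
  ⟨6460000000000, 7036781515388, 3230000000000, 3900980673105, 3230000000000, 1108360772500, 1615000000000, 18751911363072, 108304338033052⟩,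
  ⟨12059200000000, 13149900888332, 6029600000000, 10016899646049, 9168630842283, 2069031614200, 3014800000000, 18751944983040, 110516347050654⟩,
  ⟨99699200000000, 174927305347249, 127775706664531, 66284738402934, 49849600000000, 17105678379200, 24924800000000, 18751928206336, 111624448285341⟩,
  ⟨178995200000000, 237254816000767, 138680760542625, 193218212538969, 182806861604423, 30710721075200, 44748800000000, 18751945049344, 112741173468062⟩,
  ⟨773171200000000, 1138904812719602, 386585600000000, 779951844634689, 745925153684913, 329387847821700, 193292800000000, 18751945048576, 113857797855902⟩,
  ⟨4422980673105, 4085003315296, 1876000000000, 1876000000000, 1876000000000, 643741427000, 938000000000, 18751911363330, 122598023206813⟩,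
  ⟨38009569201467, 50738100701167, 36408824267381, 14896000000000, 14896000000000, 5111499092000, 7448000000000, 18751928206339, 123723454783385⟩,
  ⟨97266360542625, 52353804374372, 24041600000000, 24637568885579, 51781877088793, 8249772863200, 12020800000000, 18751945049346, 125961183468442⟩,
  ⟨152998086264243, 81700066305920, 37520000000000, 37520000000000, 80545648534762, 12874828540000, 18760000000000, 18751928206082, 127060644503197⟩]

lemma geo2 : vtx2.all (geoV rows2 vtx2) = true := by decide +kernel

lemma ev2 : vtx2.all (evV 1000000000 1000000000 71067812 71067812) = true := by decide +kernel

/-- Constraints for tetrahedra with 3 small balls. -/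
noncomputable def rows3 : List Row := [
  ⟨.negSucc 99999999, .ofNat 0, .ofNat 0, .ofNat 0, .ofNat 0, .ofNat 0, .negSucc 199999999⟩,
  ⟨.ofNat 0, .negSucc 99999999, .ofNat 0, .ofNat 0, .ofNat 0, .ofNat 0, .negSucc 199999999⟩,
  ⟨.ofNat 0, .ofNat 0, .negSucc 99999999, .ofNat 0, .ofNat 0, .ofNat 0, .negSucc 199999999⟩,
  ⟨.ofNat 0, .ofNat 0, .ofNat 0, .negSucc 99999999, .ofNat 0, .ofNat 0, .negSucc 68629149⟩,
  ⟨.ofNat 0, .ofNat 0, .ofNat 0, .ofNat 0, .negSucc 99999999, .ofNat 0, .negSucc 68629149⟩,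
  ⟨.ofNat 0, .ofNat 0, .ofNat 0, .ofNat 0, .ofNat 0, .negSucc 99999999, .negSucc 68629149⟩,
  ⟨.ofNat 400000000, .ofNat 400000000, .ofNat 400000000, .ofNat 400000000, .ofNat 400000000, .ofNat 400000000, .ofNat 6494199305⟩,
  ⟨.negSucc 99999999, .ofNat 100000000, .ofNat 0, .ofNat 0, .negSucc 99999999, .ofNat 100000000, .ofNat 67800⟩,
  ⟨.ofNat 0, .negSucc 99999999, .ofNat 100000000, .negSucc 99999999, .ofNat 100000000, .ofNat 0, .ofNat 90000⟩,
  ⟨.ofNat 800000000, .negSucc 799999999, .ofNat 700000000, .negSucc 6399999999, .ofNat 5600000000, .negSucc 5599999999, .ofNat 5443232506⟩,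
  ⟨.negSucc 1199999999, .negSucc 1599999999, .ofNat 1900000000, .ofNat 19200000000, .negSucc 22799999999, .negSucc 30399999999, .ofNat 3341298908⟩,
  ⟨.negSucc 3499999999, .negSucc 3499999999, .negSucc 3499999999, .ofNat 2500000000, .ofNat 2500000000, .ofNat 2500000000, .negSucc 2964501886⟩,
  ⟨.ofNat 10400000000, .negSucc 3199999999, .negSucc 7199999999, .negSucc 5199999999, .negSucc 11699999999, .ofNat 3600000000, .ofNat 12800000100⟩,
  ⟨.ofNat 3200000000, .ofNat 2000000000, .negSucc 3599999999, .ofNat 4000000000, .negSucc 7199999999, .negSucc 4499999999, .ofNat 8596132904⟩,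
  ⟨.negSucc 2099999999, .ofNat 52500000000, .negSucc 77699999999, .negSucc 2499999999, .ofNat 3700000000, .negSucc 92499999999, .ofNat 26462568490⟩,
  ⟨.ofNat 4200000000, .ofNat 4200000000, .negSucc 7199999999, .ofNat 4900000000, .negSucc 8399999999, .negSucc 8399999999, .ofNat 10698066502⟩,
  ⟨.ofNat 1800000000, .ofNat 1800000000, .negSucc 2399999999, .ofNat 8100000000, .negSucc 10799999999, .negSucc 10799999999, .ofNat 6494199305⟩,
  ⟨.negSucc 1799999999, .negSucc 1799999999, .ofNat 1600000000, .ofNat 8100000000, .negSucc 7199999999, .negSucc 7199999999, .ofNat 2290332109⟩,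
  ⟨.ofNat 6600000000, .ofNat 600000000, .negSucc 5999999999, .ofNat 1100000000, .negSucc 10999999999, .negSucc 999999999, .ofNat 10698066502⟩,
  ⟨.ofNat 2700000000, .ofNat 1800000000, .negSucc 2999999999, .ofNat 5400000000, .negSucc 8999999999, .negSucc 5999999999, .ofNat 7545166105⟩]

/-- Vertices of the polytope `rows3`. -/
noncomputable def vtx3 : List Vtx := [
  ⟨4000000, 4000000, 4000000, 1372583, 1372583, 1372583, 2000000, 5514788471040, 2217444835610⟩,
  ⟨4000000, 4001356, 4000000, 1372583, 1372583, 1372583, 2000000, 7718123536896, 8745846066⟩,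
  ⟨4000000, 4000000, 4000000, 1372583, 1372583, 1373939, 2000000, 7713811726592, 31340232987⟩,
  ⟨4000000, 4000000, 4001800, 1372583, 1372583, 1372583, 2000000, 8817635164416, 25841960220⟩,
  ⟨4000000, 4000000, 4000000, 1372583, 1374383, 1372583, 2000000, 8817618321664, 30383737373⟩,
  ⟨4000000, 4001356, 4003156, 1372583, 1372583, 1372583, 2000000, 8826241942272, 1112497999368⟩,
  ⟨4000000, 4000000, 4001800, 1372583, 1372583, 1373939, 2000000, 8826225099008, 2212030776606⟩,
  ⟨4000000, 4000000, 4000000, 1372583, 1374383, 1375739, 2000000, 8826208256256, 2216555842847⟩,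
  ⟨1133949421, 1134112141, 1134328141, 164709960, 164709960, 164709960, 240000000, 8826258785283, 45565394030098⟩,
  ⟨1600000000, 3006549151, 1600000000, 549033200, 1955039951, 549033200, 800000000, 9925753504256, 1142682225706⟩,
  ⟨1600000000, 3005076351, 1600000000, 549033200, 1954829551, 549033200, 800000000, 9930048471552, 4436920044577⟩,
  ⟨1600000000, 3271535373, 1600000000, 2147787332, 3820042705, 549033200, 800000000, 9930065379840, 25477914890274⟩,
  ⟨1600000000, 3006365051, 1601262400, 549033200, 1954855851, 549033200, 800000000, 9930082157312, 5536381472782⟩,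
  ⟨1600000000, 3006549151, 1600000000, 549033200, 1956302351, 550295600, 800000000, 9930082025984, 7735404989455⟩,
  ⟨193468373792, 271834630929, 193550429792, 35687158000, 114018159137, 35687158000, 52000000000, 9930082223363, 8989954543376⟩,
  ⟨2531554577, 3938103728, 1600000000, 549033200, 2887856928, 1481850177, 800000000, 9930082222850, 39780608708878⟩,
  ⟨8000000000, 20091048773, 12266710752, 7005564752, 14833502773, 2745166000, 4000000000, 9930082223360, 88162979025166⟩,
  ⟨27200000000, 66016208799, 27200000000, 20512219324, 59340668123, 20533680124, 13600000000, 9930082222592, 26594622902287⟩,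
  ⟨982930267091, 983106818291, 1354448460332, 549817588641, 178710306600, 178710306600, 260400000000, 11029593851140, 9085002011219⟩,
  ⟨10000000000, 10000000000, 10000000000, 16317519363, 16322019363, 3431457500, 5000000000, 12129071661312, 4759181661972⟩,
  ⟨156425980346, 96000000000, 96000000000, 198946372127, 198989572127, 32941992000, 48000000000, 12129088635393, 43250640901911⟩,
  ⟨15000000000, 15000000000, 15000000000, 18029303113, 18036053113, 18041138113, 7500000000, 12129105215744, 8074858928150⟩,
  ⟨234638970519, 144000000000, 144000000000, 185166505954, 185231305954, 275919092473, 72000000000, 12129105478145, 44363054127384⟩,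
  ⟨48000000000, 78212990173, 48000000000, 84366690977, 114601281150, 16470996000, 24000000000, 12129088635392, 12485790292500⟩,
  ⟨144000000000, 234638970519, 144000000000, 185166505954, 275870276473, 185280121954, 72000000000, 12129105478144, 19087221922070⟩,
  ⟨144000000000, 144000000000, 234638970519, 275805476473, 185231305954, 185280121954, 72000000000, 12129105477888, 102664181717014⟩,
  ⟨854553541, 416000000, 416000000, 142748632, 142748632, 142748632, 208000000, 13215681675777, 116458200178⟩,
  ⟨199700945, 112000000, 112000000, 38432324, 38432324, 126171237, 56000000, 13224271610369, 2311220108917⟩,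
  ⟨65744857, 32000000, 32014400, 10980664, 10980664, 10980664, 16000000, 13228583420673, 3410709280630⟩,
  ⟨854764141, 416000000, 416000000, 142748632, 142935832, 142748632, 208000000, 13228583354881, 4510238317601⟩,
  ⟨199726865, 112000000, 112050400, 38432324, 38432324, 126197157, 56000000, 13228616975105, 6713505687072⟩,
  ⟨199730105, 112000000, 112000000, 38432324, 38482724, 126250797, 56000000, 13228616909313, 7813034679844⟩,
  ⟨8815294277, 6183488327, 6185000327, 1152969720, 1152969720, 3785914710, 1680000000, 13228617106435, 9317799306278⟩,
  ⟨1772986098097, 969030993312, 618400000000, 212201331800, 563110605112, 212201331800, 309200000000, 13232928785154, 11120528400931⟩,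
  ⟨6926477126995, 3176514050556, 2063200000000, 1380064014044, 2494306504600, 707978311400, 1031600000000, 13232928851202, 12263006217507⟩,
  ⟨13763233475655, 8289242832800, 6073028540384, 1468938326600, 3687078979016, 1468938326600, 2140400000000, 13232928851203, 15918040163618⟩,
  ⟨225007859489, 148938390540, 92480000000, 31734118960, 88234125500, 164334945169, 46240000000, 13228617106178, 17021578192928⟩,
  ⟨1973387901337, 1146378532956, 625600000000, 214671981200, 735732034156, 382693406861, 312800000000, 13232928850690, 16648201380387⟩,
  ⟨4560618181, 1920000000, 3204267785, 1942243625, 658839840, 3300108901, 960000000, 13228617106433, 106087791339552⟩,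
  ⟨205956916549, 60320000000, 60320000000, 71170007704, 71197151704, 20698551640, 30160000000, 13228600263169, 22536182595106⟩,
  ⟨249370973913, 109760000000, 109760000000, 94122068060, 94171460060, 233819642613, 54880000000, 13228617105921, 24739667977764⟩,
  ⟨64912626199, 64921033399, 45956475057, 8510014600, 8510014600, 8510014600, 12400000000, 14323816924163, 9351075084440⟩,
  ⟨582853652729, 937304038781, 403200000000, 138356366400, 492670067652, 138356366400, 201600000000, 15431935263490, 10149983824685⟩,
  ⟨3476800000000, 7970460526955, 3476800000000, 2270971059974, 5685531035355, 1193049143600, 1738400000000, 15431935263232, 10106799402794⟩,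
  ⟨6252800000000, 14218809915009, 6252800000000, 7628939732216, 14259690375055, 2145621745600, 3126400000000, 15431918486016, 12305805881148⟩,
  ⟨81326531682103, 114317023140699, 53766462986192, 13670377646800, 46647363887796, 13670377646800, 19919200000000, 15431935329539, 15660476935727⟩,
  ⟨2121034622705, 3099992831801, 1113600000000, 382127107200, 1650875784775, 672295086079, 556800000000, 15431935329026, 16768612053037⟩,
  ⟨140643200000000, 370074826474223, 173844627309168, 131237379710606, 277645064775823, 48261116346400, 70321600000000, 15431935329536, 17803380469805⟩,
  ⟨11291200000000, 29276694340247, 11291200000000, 9919135028630, 23931283122670, 5949616499223, 5645600000000, 15431935328768, 18902892097326⟩,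
  ⟨97920000000, 229253396357, 97920000000, 171294733418, 164901033317, 33600831840, 48960000000, 15423328551424, 106842331033409⟩,
  ⟨1385920323, 1386157623, 700000000, 240202025, 240202025, 240202025, 350000000, 16522823336706, 1664370817335⟩,
  ⟨17991991473839, 12271378445121, 5835200000000, 2002324080400, 5579988160952, 2002324080400, 2917600000000, 16544365347586, 36535226741813⟩,
  ⟨137222741110850, 85733816637417, 42442400000000, 19620379649674, 44953489150424, 14563929179800, 21221200000000, 16544365413634, 37643344885301⟩,
  ⟨343018116688555, 236344769236485, 121432667919664, 37042171937600, 101421379699576, 37042171937600, 53974400000000, 16544365413635, 38747168257588⟩,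
  ⟨19556705656636, 13727999971694, 6188000000000, 2123385901000, 6232240278852, 2404299815993, 3094000000000, 16544365413122, 40954798224437⟩,
  ⟨13344532734, 13346566734, 7709418293, 2058874500, 2058874500, 2058874500, 3000000000, 16548626760707, 45297032640569⟩,
  ⟨700418321243, 733027129749, 445046018087, 92512094200, 125029508306, 92512094200, 134800000000, 16548626826499, 45348600384582⟩,
  ⟨148800829417, 148828356217, 81200000000, 48376454416, 27863434900, 27863434900, 40600000000, 16548626760706, 168442402347575⟩,
  ⟨80179541687093, 65847407528247, 27462400000000, 9423605844800, 28059999463734, 9423605844800, 13731200000000, 16552955282178, 46399525698621⟩,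
  ⟨603368324773, 682062412497, 284900000000, 97762224175, 176359730799, 97762224175, 142450000000, 16552921727746, 46395214020926⟩,
  ⟨703114452972293, 572107308082740, 238571200000000, 89473633472498, 251529863661339, 81864693352400, 119285600000000, 16552955348226, 48602944257853⟩,
  ⟨1830646768057609, 1528448842304403, 645143306986928, 214415582695600, 639328191618990, 214415582695600, 312426400000000, 16552955348227, 49706700521276⟩,
  ⟨89632530999383, 104694971154069, 48194617954372, 12469093005200, 27519214713486, 12469093005200, 18168800000000, 16552921793795, 49719568711745⟩,
  ⟨79114719758575, 64988476373489, 26790400000000, 9193011900800, 27775407496615, 9615730796361, 13395200000000, 16552955347714, 50810540670013⟩,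
  ⟨10845641870720, 11866274910964, 4222400000000, 1448898614800, 3456185090975, 2436983444331, 2111200000000, 16552921793282, 51192776048958⟩,
  ⟨22332706810114, 33114056694141, 13798400000000, 22520389248358, 15511534543227, 4734862316800, 6899200000000, 16552921793794, 54190612889662⟩,
  ⟨2092643656349, 896400000000, 1569661913004, 980454383304, 307595850300, 307595850300, 448200000000, 17635270263809, 108419527042116⟩,
  ⟨4936606894105, 4937438393305, 5647126120756, 2706707869764, 841667895600, 841667895600, 1226400000000, 17635253552388, 20462371759976⟩,
  ⟨2990222314939, 1834170667426, 2732626428508, 1307223251682, 409304250600, 409304250600, 596400000000, 17635270329604, 20466647591529⟩,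
  ⟨204822255824, 79200000000, 79200000000, 156444855344, 96081476627, 27177143400, 39600000000, 17648121610753, 162099018768200⟩,
  ⟨4275590275783, 5131217597384, 3052613095802, 2808977680590, 1599380846401, 744489019200, 1084800000000, 17656829117957, 62261075419463⟩,
  ⟨13679419702948, 16371826374983, 7862400000000, 14293652700366, 7153716654839, 4463975336404, 3931200000000, 17656829117954, 163429030076998⟩,
  ⟨1357921433389, 953712880298, 604800000000, 1099511746182, 686134065111, 207534549600, 302400000000, 17656829052162, 164124820784966⟩,
  ⟨305471628496, 465073142733, 201600000000, 366503915394, 228711355037, 69178183200, 100800000000, 17656728388866, 71950510933830⟩,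
  ⟨16200000000, 16200000000, 16200000000, 16172929709, 5558961150, 5558961150, 8100000000, 18713239748864, 327831866219⟩,
  ⟨16200000000, 16205491800, 16200000000, 16174150109, 5558961150, 5558961150, 8100000000, 18721846592000, 1418620653167⟩,
  ⟨16200000000, 16200000000, 16200000000, 16177811309, 5558961150, 5564452950, 8100000000, 18721829683456, 2518332427174⟩,
  ⟨19400000000, 19400000000, 30021258559, 17269556109, 6657027550, 6657027550, 9700000000, 18726141559040, 3617693453922⟩,
  ⟨19400000000, 19406576600, 30027970759, 17269691709, 6657027550, 6657027550, 9700000000, 18726175179776, 5820977729617⟩,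
  ⟨19400000000, 19400000000, 30026140159, 17274437709, 6657027550, 6663604150, 9700000000, 18726175113472, 6924785241696⟩,
  ⟨299200000000, 531565584713, 678614621522, 481847761122, 334933364313, 102669208400, 149600000000, 18726175245568, 18010312957267⟩,
  ⟨1192037623727, 1192264550327, 1666517733056, 703653717779, 229701765050, 229701765050, 334700000000, 18734782022916, 20127934468691⟩,
  ⟨79025426674013, 78159142460134, 109478098892804, 45767009252670, 14467024820000, 15347601273879, 21080000000000, 18734782023172, 20205261181267⟩,
  ⟨42356230994398, 43244636449877, 59796659244092, 25346951976894, 8805321662679, 7924745208800, 11547200000000, 18734782023173, 20136558416210⟩,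
  ⟨765000000000, 765000000000, 765000000000, 1455814166861, 1041110545678, 262506498750, 382500000000, 18739026329856, 21210030496598⟩,
  ⟨988000000000, 988000000000, 1403047871183, 2110228358484, 1695625087301, 339028001000, 494000000000, 18739076858112, 21222848879191⟩,
  ⟨3988862498823, 2448000000000, 2448000000000, 5855039744806, 4292326833671, 840020796000, 1224000000000, 18739043303937, 22459799131995⟩,
  ⟨12593627294828, 10608000000000, 15299443533405, 24329295886736, 19642625953331, 3640090116000, 5304000000000, 18739076924673, 22455537458778⟩,
  ⟨765000000000, 765000000000, 765000000000, 1455814166861, 651678854714, 651938189714, 382500000000, 18739059884288, 23417577233497⟩,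
  ⟨3988862498823, 2448000000000, 2448000000000, 5855039744806, 1795327629424, 3337020000247, 1224000000000, 18739060146689, 24907963981660⟩,
  ⟨8976000000000, 9968813647414, 13633015514937, 20433586727636, 16773424060113, 3080076252000, 4488000000000, 18739076924672, 25633897143895⟩,
  ⟨2448000000000, 3988862498823, 2448000000000, 5855039744806, 4292326833671, 840020796000, 1224000000000, 18739043303936, 25706794605142⟩,
  ⟨2448000000000, 3988862498823, 2448000000000, 5855039744806, 3336190128247, 1796157501424, 1224000000000, 18739060146688, 26806423412569⟩,
  ⟨333600000000, 333600000000, 667170195123, 680145991636, 346725916513, 346839006913, 166800000000, 18726175244544, 27897394843744⟩,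
  ⟨7344000000000, 7344000000000, 11966587496469, 16537877568536, 11918594872067, 4505689682828, 3672000000000, 18739076923648, 27888822082135⟩,
  ⟨14688000000000, 14688000000000, 23933174992938, 33075755137072, 16421794938895, 16426774170895, 7344000000000, 18739060146432, 27888805502041⟩,
  ⟨531452494313, 299200000000, 678575568722, 481910137122, 102669208400, 335023131513, 149600000000, 18726175245313, 42505836911954⟩,
  ⟨201600000000, 424108229269, 201600000000, 448433742322, 291618070069, 69178183200, 100800000000, 18721863434752, 54268176126064⟩,
  ⟨1049485965127, 526800000000, 912209715636, 565941836736, 180769181100, 180769181100, 263400000000, 18734781891585, 72900147504209⟩,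
  ⟨1280871841411, 736200000000, 973780756488, 809078460499, 252623901150, 252623901150, 368100000000, 18760585249793, 72990476035174⟩,
  ⟨2944733652642, 1150200000000, 2083309462728, 1646483207239, 713891334511, 394686241650, 575100000000, 18760585446657, 72990492681577⟩,
  ⟨28656682869161, 11775600000000, 22065973743708, 14325821817408, 4040747093700, 4998362372283, 5887800000000, 18760585446401, 72991532868714⟩,
  ⟨5402686480833, 5403964239633, 5417240689404, 4163640681898, 1293384960900, 1293384960900, 1884600000000, 18760585381124, 74017040197480⟩,
  ⟨43080045747813, 40909412535716, 48674953139364, 27389247532650, 7491008980800, 9669042698497, 10915200000000, 18760585381380, 74022342256232⟩,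
  ⟨15585392568476, 17766433351773, 17916252925932, 12473889208362, 5221873778497, 3043840060800, 4435200000000, 18760585381381, 74025647302247⟩,
  ⟨20104858550318, 8352910546275, 14642534178612, 11372777290106, 5086601017769, 2628770961600, 3830400000000, 18760585446917, 75125091755114⟩,
  ⟨52915642160623, 26179759299250, 45401234392044, 26288135614394, 7075939881600, 9533769937769, 10310400000000, 18760585446916, 75121870464361⟩,
  ⟨22376623491, 16200000000, 16200000000, 17545512707, 5558961150, 5558961150, 8100000000, 18760501297665, 190536265589615⟩,
  ⟨713445675169, 266400000000, 485768594871, 412394392798, 193145677927, 91414027800, 133200000000, 18760551761153, 192790032330857⟩,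
  ⟨67247793943, 28800000000, 28800000000, 61711055878, 37349727559, 9882597600, 14400000000, 18760518140417, 76237471902832⟩,
  ⟨605230145487, 259200000000, 259200000000, 555399502902, 265424623655, 159666302776, 129600000000, 18760635646465, 76628351955892⟩,
  ⟨38571131691, 38582115291, 32400000000, 35091025414, 11117922300, 11117922300, 16200000000, 18760534918146, 199335534293094⟩,
  ⟨34285450392, 61762343551, 28800000000, 61711055878, 37349727559, 9882597600, 14400000000, 18760534983938, 80682796693352⟩,
  ⟨225833992043, 150751465961, 150784945961, 25530043800, 25530043800, 25530043800, 37200000000, 19825670030339, 9352131410577⟩,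
  ⟨295920666391, 185238068827, 136800000000, 46942338600, 46942338600, 46942338600, 68400000000, 19842833056514, 29151914718070⟩,
  ⟨988446963927, 457600000000, 457600000000, 253899632854, 157023495200, 157023495200, 228800000000, 19842833056257, 29207732123506⟩,
  ⟨976051167527, 445200000000, 445200000000, 643414402540, 152768487900, 683770578227, 222600000000, 19842866610689, 30332996844661⟩,
  ⟨164587354121, 136930739330, 75600000000, 25941818700, 25941818700, 53624061891, 37800000000, 19842866610946, 30255670326393⟩,
  ⟨13590309229, 8528580679, 8530740679, 1647099600, 1647099600, 1647099600, 2400000000, 19842883453955, 31273577380471⟩,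
  ⟨750023871099, 308800000000, 405882057654, 202906505254, 105963407600, 105963407600, 154400000000, 19842883453953, 31578537164406⟩,
  ⟨3342333174491, 2205973141703, 2206471021703, 379656457800, 379656457800, 467387385318, 553200000000, 19842883519491, 35671741201021⟩,
  ⟨2250963122219, 1874034733757, 1349904166322, 283301131200, 283301131200, 660509398062, 412800000000, 19842866742275, 35744738802556⟩,
  ⟨2989018160355, 1921840346585, 1805299576561, 330792503000, 447767073024, 330792503000, 482000000000, 19842883519747, 38970510964862⟩,
  ⟨8390184822446, 7742678490857, 3100800000000, 1064026341600, 2112634674244, 2761192177033, 1550400000000, 19842866742018, 40198888325241⟩,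
  ⟨7768335319000, 3328800000000, 3864034554077, 5336002507628, 1142263572600, 5582927354800, 1664400000000, 19842866742273, 42578115592313⟩,
  ⟨7498369458797, 2584800000000, 4785109443406, 3086109418006, 886963134600, 2141406499646, 1292400000000, 19842883519489, 42582393978488⟩,
  ⟨22920213605755, 6764000000000, 7496312419326, 8068079932510, 7338811313184, 2321037853000, 3382000000000, 19842883519745, 43510157245818⟩,
  ⟨41668789372215, 12240800000000, 12240800000000, 14871889878158, 14145085818832, 4200378496600, 6120400000000, 19842849899009, 43514251476614⟩,
  ⟨65570299493339, 28344000000000, 28344000000000, 46861151064856, 11867061354308, 49102969463647, 14172000000000, 19842866741761, 44631143513211⟩,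
  ⟨748432860989, 579629510419, 492216119697, 88119828600, 88119828600, 88119828600, 128400000000, 19847144866819, 45567615077265⟩,
  ⟨5671602236571, 5334533053831, 3535868199178, 720331558400, 720331558400, 1058112369940, 1049600000000, 19847161709571, 45601841122491⟩,
  ⟨44496392903, 38665945477, 21000000000, 7206060750, 7206060750, 7206060750, 10500000000, 19855717958402, 55467431005577⟩,
  ⟨136261019355, 130445284529, 64400000000, 22098586300, 22098586300, 27936152726, 32200000000, 19855751512834, 55480299785866⟩,
  ⟨1261483858980, 872979717304, 431900000000, 148204649425, 360250391226, 148204649425, 215950000000, 19855835464450, 56566926050951⟩,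
  ⟨106617110701110, 53478526755481, 32429600000000, 24713643418690, 34888396937304, 11128079414200, 16214800000000, 19855835530498, 57722574047367⟩,
  ⟨40973154932385, 28465956204971, 15213860667415, 4443600204200, 11581431936864, 4443600204200, 6474800000000, 19855835530499, 58800443066502⟩,
  ⟨7609454424289, 5704427827043, 2475200000000, 849354360400, 2303360255216, 1151255782722, 1237600000000, 19855835529986, 59904316769927⟩,
  ⟨21089553195, 18475815801, 10503175013, 3294199200, 3294199200, 3294199200, 4800000000, 19855852241923, 61029397203853⟩,
  ⟨200403732813, 192583064031, 102963019903, 30677230050, 30677230050, 38528205432, 44700000000, 19855852372995, 61033708883086⟩,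
  ⟨7248455645815, 5817181048829, 3656309737335, 840844345800, 1488097347636, 840844345800, 1225200000000, 19855852307715, 62128975875221⟩,
  ⟨60358169872191, 59324516373461, 31955415952310, 7693053198400, 10810516159714, 11851769767244, 11209600000000, 19855852373507, 62133405190804⟩,
  ⟨2114776872136, 1786850408933, 999600000000, 391779942402, 343008491700, 343008491700, 499800000000, 19855852241922, 63292845233545⟩,
  ⟨5723199374694, 5395854059191, 2713900000000, 1175397609179, 931263250925, 1259528578528, 1356950000000, 19855852372994, 63318631748746⟩,
  ⟨120431470561, 120543773807, 44800000000, 15372929600, 31312051579, 31214935533, 22400000000, 19855751643906, 70899315545228⟩,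
  ⟨485629701043, 228800000000, 228800000000, 178512501950, 78511747600, 78511747600, 114400000000, 19847128023553, 207204633525645⟩,
  ⟨1003047977895, 587532132618, 675210483340, 201453339722, 113924389000, 113924389000, 166000000000, 19847178487044, 209394717409426⟩,
  ⟨2376981558899, 703200000000, 792853632762, 841701549398, 752364356636, 241300091400, 351600000000, 19847178487041, 212749389054865⟩,
  ⟨2425292046500, 712800000000, 712800000000, 867675650018, 823169593637, 244594290600, 356400000000, 19847144866305, 76414189015701⟩,
  ⟨685302750071967, 642588106528097, 269326400000000, 206852800950520, 169724073439318, 212530018632788, 134663200000000, 19855852373506, 78716274577036⟩,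
  ⟨37782253642145, 16300102485154, 11474400000000, 11172850017810, 12479302892706, 3937391593800, 5737200000000, 19855852307714, 79798454817931⟩,
  ⟨495126480543, 238300000000, 238300000000, 483478820975, 81771632225, 338678896468, 119150000000, 19847161577985, 216004921116046⟩,
  ⟨33777843642969, 15923200000000, 15923200000000, 33907440298928, 5934408708527, 23794450316296, 7961600000000, 19847161709057, 218255534245780⟩,
  ⟨163783830698, 163807425098, 135750002314, 53888193025, 23882944200, 23882944200, 34800000000, 20946673337604, 45753189383072⟩,
  ⟨166492097158, 166526268358, 100800000000, 83747555615, 34589091600, 34589091600, 50400000000, 20946673271810, 63452718865048⟩,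
  ⟨3345037015378, 3715720311179, 2041200000000, 2211233066598, 1070420433901, 700429104900, 1020600000000, 20955364001026, 63332071809697⟩,
  ⟨11899911277, 4920000000, 8484484931, 5250548021, 1688277090, 1688277090, 2460000000, 20959574950913, 73360955060125⟩,
  ⟨3206863658, 3207351818, 2944946229, 1342137284, 494129880, 494129880, 720000000, 20959558239492, 74322760018848⟩,
  ⟨2561170436, 1450434883, 2122020485, 1000573522, 329419920, 329419920, 480000000, 20959575016708, 75585461922991⟩,
  ⟨266053508234, 122400000000, 122400000000, 169649872748, 85978153405, 42001039800, 61200000000, 20959658836481, 76676670332836⟩,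
  ⟨291733880982, 103200000000, 156094262708, 163780976124, 87529949131, 35412641400, 51600000000, 20959658902785, 76698177418144⟩,
  ⟨374501695566, 420686173513, 289049493573, 207301553026, 107889692947, 61766235000, 90000000000, 20959658968581, 77621276680611⟩,
  ⟨1994434215178, 2225326075391, 1227202112493, 1324951152114, 645550905013, 415069099200, 604800000000, 20959692916485, 77629934118050⟩,
  ⟨38706784714100, 43180817029237, 23587200000000, 26348685120186, 12771109038653, 8305072784316, 11793600000000, 20959692916482, 78729496077473⟩,
  ⟨7155317357844, 7995373219373, 4118400000000, 7880776961642, 3560465103605, 2721805379676, 2059200000000, 20959658968578, 78918811165344⟩,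
  ⟨1492333178746, 1648388908982, 907200000000, 995808853668, 484652126329, 311301824400, 453600000000, 20959692915970, 79828923818657⟩,
  ⟨989673345092, 1102185589783, 604800000000, 659960988558, 319841767091, 207534549600, 302400000000, 20959692522754, 80928821256865⟩,
  ⟨255376774773, 145800000000, 145800000000, 267352273751, 50030650350, 159656851323, 72900000000, 20963853074945, 84407627524278⟩,
  ⟨11491481176034, 5832000000000, 5832000000000, 13246911320268, 2639431106557, 8300889330591, 2916000000000, 20963853206017, 98709918886071⟩,
  ⟨19702876934546, 9602400000000, 11517015277671, 20433804397952, 3295022749800, 13398754897946, 4801200000000, 20963853206529, 106350531487659⟩,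
  ⟨28557367187296, 10552800000000, 21734631028572, 14798230739172, 3621148470600, 6400805606615, 5276400000000, 20963869983745, 106354809942188⟩,
  ⟨3480819479471, 1391400000000, 2655488188017, 1740915054567, 477452996550, 631826716164, 695700000000, 20964004332545, 111719241134252⟩,
  ⟨3682471884332, 3062687551169, 3429927524655, 2741654405366, 625074298200, 1245476153763, 910800000000, 20964004267524, 113922542450359⟩,
  ⟨7162825649556, 3252876403687, 5885216585145, 3567488344058, 936376122600, 1346930724309, 1364400000000, 20964004333060, 117225389009584⟩,
  ⟨9409454643, 5400000000, 5400000000, 5415041981, 1852987050, 1852987050, 2700000000, 20959524553217, 118458127653813⟩,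
  ⟨230648313609, 145800000000, 145800000000, 190419283463, 50030650350, 79289352540, 72900000000, 20964004069889, 118393570241206⟩,
  ⟨27573443892, 9600000000, 16806290903, 13929214284, 6727243381, 3294199200, 4800000000, 20959575016705, 119578862268573⟩,
  ⟨8390797567324, 3074400000000, 5983429353381, 4486689570868, 1579043697487, 1442847740055, 1537200000000, 20964004333057, 119501722200748⟩,
  ⟨13934521433986, 6012000000000, 6012000000000, 12918696638632, 5976287394001, 3950402310456, 3006000000000, 20963953869313, 121799496086452⟩,
  ⟨2688828072547, 1157400000000, 1157400000000, 2464799006389, 1169248093558, 715208327232, 578700000000, 20964004659713, 121627864904628⟩,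
  ⟨35379564181838, 15112800000000, 15331882344597, 32224650434216, 15310967595164, 9322054514940, 7556400000000, 20964004660737, 121632160002740⟩,
  ⟨866107160348, 382514160911, 374400000000, 802243726414, 379784829319, 234235397748, 187200000000, 20964004660738, 121649340330675⟩,
  ⟨550891543, 551013583, 360000000, 335534321, 123532470, 123532470, 180000000, 20959558173698, 122705835107740⟩,
  ⟨424203935472, 347239037619, 291600000000, 401445617896, 100061300700, 177125050953, 145800000000, 20964004267010, 122825976231851⟩,
  ⟨624080486268, 624540834991, 374400000000, 802243726414, 307176827095, 306843399972, 187200000000, 20964004267522, 123848195618475⟩,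
  ⟨1505894013193, 581400000000, 890485903326, 508329212376, 199504939050, 199504939050, 290700000000, 20968164885505, 131510786769599⟩,
  ⟨21949165378402, 10293600000000, 10956115773827, 21638516212004, 3532205092200, 15191260001002, 5146800000000, 20968148173825, 137064129873851⟩,
  ⟨31556536567232, 10773600000000, 20738393542474, 13656860474674, 3696915052200, 7035076403855, 5386800000000, 20968164951041, 138167918838720⟩,
  ⟨25073701667250, 11925892451062, 12558867110429, 24451833757276, 4024687872600, 17176473151988, 5864400000000, 20968248903172, 143592463058375⟩,
  ⟨130504301158, 64800000000, 64800000000, 56185081051, 22235844600, 22235844600, 32400000000, 20946639651329, 159076002479513⟩,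
  ⟨2494446951384, 1009200000000, 1411555130659, 867579593208, 346302690900, 346302690900, 504600000000, 20968248771585, 159140228219583⟩,
  ⟨910488594908, 503936421645, 650602556021, 253587208376, 107061474000, 107061474000, 156000000000, 20946690114820, 160106058596545⟩,
  ⟨2955504422032, 1230575911649, 1793966665595, 944194271346, 381303557400, 381303557400, 555600000000, 20968248968452, 160248329257154⟩,
  ⟨196708538637156, 87064987595227, 131040107305985, 66670351371958, 22725033181200, 33393788774984, 33112800000000, 20968248968708, 160248362680259⟩,
  ⟨99627480860, 33600000000, 56481697732, 47192036375, 24325458643, 11529697200, 16800000000, 20946690114817, 161282997273534⟩,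
  ⟨10081868704046, 3826800000000, 5849020512033, 3453024519782, 1432526067749, 1313150156100, 1913400000000, 20968248968449, 161360725787583⟩,
  ⟨537100407875308, 178646400000000, 323366854075359, 226781203703386, 82141140508027, 102170652238860, 89323200000000, 20968248968705, 161360759997120⟩,
  ⟨255010636316, 123600000000, 123600000000, 250183331117, 42412814700, 173865351416, 61800000000, 20946673205761, 165642875880857⟩,
  ⟨5642672196768, 2672400000000, 2779549590253, 5547661882536, 917022702300, 3888200842668, 1336200000000, 20968248902657, 165771673978811⟩,
  ⟨6315430451578, 3026400000000, 3026400000000, 6554823249871, 1177222934094, 4467279335272, 1513200000000, 20946673336833, 166746497796003⟩,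
  ⟨84449138329638, 39650400000000, 41761318571719, 83593046043396, 13802958696862, 58615138512100, 19825200000000, 20968248903169, 166879775933883⟩]

lemma geo3 : vtx3.all (geoV rows3 vtx3) = true := by decide +kernel

lemma ev3 : vtx3.all (evV 1000000000 71067812 71067812 71067812) = true := by decide +kernel

/-- Constraints for tetrahedra with 4 small balls. -/
noncomputable def rows4 : List Row := [
  ⟨.negSucc 99999999, .ofNat 0, .ofNat 0, .ofNat 0, .ofNat 0, .ofNat 0, .negSucc 68629149⟩,
  ⟨.ofNat 0, .negSucc 99999999, .ofNat 0, .ofNat 0, .ofNat 0, .ofNat 0, .negSucc 68629149⟩,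
  ⟨.ofNat 0, .ofNat 0, .negSucc 99999999, .ofNat 0, .ofNat 0, .ofNat 0, .negSucc 68629149⟩,
  ⟨.ofNat 0, .ofNat 0, .ofNat 0, .negSucc 99999999, .ofNat 0, .ofNat 0, .negSucc 68629149⟩,
  ⟨.ofNat 0, .ofNat 0, .ofNat 0, .ofNat 0, .negSucc 99999999, .ofNat 0, .negSucc 68629149⟩,
  ⟨.ofNat 0, .ofNat 0, .ofNat 0, .ofNat 0, .ofNat 0, .negSucc 99999999, .negSucc 68629149⟩,
  ⟨.ofNat 1600000000, .ofNat 1600000000, .ofNat 1600000000, .ofNat 1600000000, .ofNat 1600000000, .ofNat 1600000000, .ofNat 17569062526⟩,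
  ⟨.ofNat 0, .negSucc 99999999, .negSucc 99999999, .ofNat 100000000, .ofNat 100000000, .ofNat 0, .ofNat 67800⟩,
  ⟨.negSucc 99999999, .ofNat 100000000, .ofNat 0, .ofNat 0, .negSucc 99999999, .ofNat 100000000, .ofNat 90000⟩,
  ⟨.ofNat 0, .negSucc 99999999, .ofNat 100000000, .negSucc 99999999, .ofNat 100000000, .ofNat 0, .ofNat 112200⟩,
  ⟨.ofNat 27200000000, .negSucc 11199999999, .negSucc 15999999999, .negSucc 11899999999, .negSucc 16999999999, .ofNat 7000000000, .ofNat 17569062526⟩,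
  ⟨.ofNat 19200000000, .ofNat 19200000000, .negSucc 38399999999, .ofNat 14400000000, .negSucc 28799999999, .negSucc 28799999999, .ofNat 17569062526⟩,
  ⟨.negSucc 11499999999, .negSucc 12499999999, .ofNat 13500000000, .ofNat 57500000000, .negSucc 62099999999, .negSucc 67499999999, .ofNat 17569062526⟩,
  ⟨.negSucc 52799999999, .ofNat 211200000000, .negSucc 281599999999, .negSucc 57599999999, .ofNat 76800000000, .negSucc 307199999999, .ofNat 17569062526⟩,
  ⟨.ofNat 18000000000, .ofNat 7500000000, .negSucc 23999999999, .ofNat 6000000000, .negSucc 19199999999, .negSucc 7999999999, .ofNat 17569062526⟩]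

/-- Vertices of the polytope `rows4`. -/
noncomputable def vtx4 : List Vtx := [
  ⟨1372583, 1372583, 1372583, 1372583, 1372583, 1372583, 2000000, 5514788471040, 4406653747982⟩,
  ⟨1372583, 1372583, 1372583, 1373939, 1372583, 1372583, 2000000, 7718123471104, 25805456655⟩,
  ⟨1372583, 1372583, 1372583, 1372583, 1373939, 1372583, 2000000, 7718106693888, 30082153232⟩,
  ⟨1372583, 1374383, 1372583, 1372583, 1372583, 1372583, 2000000, 8817635164672, 18186832462⟩,
  ⟨1372583, 1372583, 1372583, 1372583, 1372583, 1374383, 2000000, 8813323354368, 30166156049⟩,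
  ⟨1372583, 1374383, 1372583, 1375739, 1372583, 1372583, 2000000, 8826241942016, 1112501199135⟩,
  ⟨1372583, 1372583, 1372583, 1373939, 1372583, 1374383, 2000000, 8826225033472, 1116811166994⟩,
  ⟨1372583, 1372583, 1372583, 1372583, 1373939, 1375739, 2000000, 8826208256256, 2216304655891⟩,
  ⟨1372583, 1372583, 1374827, 1372583, 1372583, 1372583, 2000000, 9917146792192, 47397931541⟩,
  ⟨1372583, 1372583, 1373027, 1372583, 1374383, 1372583, 2000000, 9925753504000, 2233603473174⟩,
  ⟨1372583, 1374383, 1376627, 1372583, 1372583, 1372583, 2000000, 9930048537344, 3333083374860⟩,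
  ⟨1372583, 1372583, 1374827, 1372583, 1372583, 1374383, 2000000, 9930031694080, 4432626846231⟩,
  ⟨7135094063, 7137254063, 7139946863, 1647099600, 1647099600, 1647099600, 2400000000, 9930065380355, 86964667236647⟩,
  ⟨1372583, 1372583, 1373027, 1372583, 1374383, 1376183, 2000000, 9930082025728, 7735423287834⟩,
  ⟨6408246897, 2333391100, 2333391100, 2333391100, 2333391100, 2333391100, 3400000000, 11016658420225, 73283867984⟩,
  ⟨3204627711, 1166695550, 1166695550, 1167848150, 1166695550, 1166695550, 1700000000, 11025265197569, 1159944218961⟩,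
  ⟨6409687647, 2333391100, 2333391100, 2333391100, 2335696300, 2333391100, 3400000000, 11025265132033, 2259472553554⟩,
  ⟨14015928919, 5867792325, 5867792325, 5867792325, 5867792325, 14023623919, 8550000000, 11029543322113, 4458496005971⟩,
  ⟨14017945969, 5867792325, 5867792325, 5873589225, 5867792325, 14025640969, 8550000000, 11029593719297, 6661780741204⟩,
  ⟨14017623919, 5867792325, 5867792325, 5867792325, 5873589225, 14031115819, 8550000000, 11029593653761, 7765587270164⟩,
  ⟨105944128607, 78487712905, 26353593600, 26353593600, 78513748105, 106004723807, 38400000000, 11029593850626, 74042385323291⟩,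
  ⟨6410490897, 2333391100, 2337205900, 2333391100, 2333391100, 2333391100, 3400000000, 11033855132417, 8856609892888⟩,
  ⟨6410603397, 2333391100, 2334145900, 2333391100, 2336451100, 2333391100, 3400000000, 11033888752385, 9964678163288⟩,
  ⟨14020416919, 5867792325, 5877385425, 5867792325, 5867792325, 14028111919, 8550000000, 11033905464065, 12167996382489⟩,
  ⟨153937877447, 105012679883, 105058457483, 28000693200, 28000693200, 28000693200, 40800000000, 11033871975427, 13576745605677⟩,
  ⟨1350666198277, 959340217765, 959800686565, 281654031600, 281654031600, 673349372112, 410400000000, 11033905595395, 13585385724701⟩,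
  ⟨14019066919, 5867792325, 5869690425, 5867792325, 5875487325, 14034456919, 8550000000, 11033905660673, 14375626153499⟩,
  ⟨1377244723091, 1020202982965, 342707539200, 342596716800, 1020652262965, 1378143283091, 499200000000, 11033905661443, 74854235183646⟩,
  ⟨2734959503593, 681899234400, 2037551225930, 2038224886730, 681899234400, 2735853743593, 993600000000, 11029593850881, 51875102727773⟩,
  ⟨2735018543593, 681899234400, 2038386425930, 2037271606730, 681899234400, 2735912783593, 993600000000, 11033905595393, 53997135666713⟩,
  ⟨2734731263593, 681899234400, 2037332345930, 2037111766730, 682793474400, 2736519743593, 993600000000, 11033905661441, 56196192868891⟩,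
  ⟨41706521663, 41730281663, 18118095600, 41748180863, 18118095600, 18118095600, 26400000000, 12129105413122, 5907163399736⟩,
  ⟨24363348250, 24363348250, 61472225963, 61496294963, 24363348250, 24363348250, 35500000000, 13224288452864, 1250408276265⟩,
  ⟨24363348250, 24395298250, 61451975963, 61507994963, 24363348250, 24363348250, 35500000000, 13228617040896, 5635620090936⟩,
  ⟨24363348250, 24363348250, 61502600963, 61526669963, 24363348250, 24395298250, 35500000000, 13228616974592, 6735148884271⟩,
  ⟨24363348250, 24363348250, 61523975963, 61484144963, 24363348250, 24363348250, 35500000000, 13232878387456, 8934171878698⟩,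
  ⟨24363348250, 24363348250, 61526045963, 61518164963, 24395298250, 24363348250, 35500000000, 13232912007424, 10033633441067⟩,
  ⟨24363348250, 24395298250, 61555475963, 61483694963, 24363348250, 24363348250, 35500000000, 13232928785408, 11137439905319⟩,
  ⟨24363348250, 24363348250, 61554350963, 61514519963, 24363348250, 24395298250, 35500000000, 13232928719104, 12241246627121⟩,
  ⟨3993362661914, 3995047461914, 6355163906753, 3642753748839, 1284737688000, 1284737688000, 1872000000000, 13232928851204, 13439710081334⟩,
  ⟨24363348250, 24363348250, 61586795963, 61578914963, 24395298250, 24427248250, 35500000000, 13232928915712, 14440286533427⟩,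
  ⟨27454679141532, 5525847585125, 17494359911181, 17499818997681, 5525847585125, 5525847585125, 8051750000000, 13237206975489, 16630821038945⟩,
  ⟨27461513291532, 5525847585125, 17507204261181, 17498170197681, 5525847585125, 5525847585125, 8051750000000, 13237240529921, 23240759061293⟩,
  ⟨27471324371532, 5525847585125, 17509262876181, 17507475387681, 5533094160125, 5525847585125, 8051750000000, 13237240661249, 24344565264940⟩,
  ⟨3657375728452350, 808899529270501, 2307948169740626, 2307734852959826, 809764327030501, 659448168785600, 960886400000000, 13237240661509, 109080931543858⟩,
  ⟨1731112649681702, 462591491908901, 1167154316091029, 1016737011094128, 312685388064000, 312685388064000, 455616000000000, 13237240595716, 26557463277612⟩,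
  ⟨1904450805665807, 357288845232000, 1294878336039586, 1295231308263586, 357288845232000, 507483424276901, 520608000000000, 13237207041025, 30988997046885⟩,
  ⟨2177941486957, 823549800000, 3585960360293, 3586773960293, 823549800000, 2179021486957, 1200000000000, 13228617106433, 30984718398310⟩,
  ⟨1904644356065807, 357288845232000, 1295394345639586, 1294810223463586, 357288845232000, 507194949076901, 520608000000000, 13237240595457, 32097065120301⟩,
  ⟨2177624686957, 823549800000, 3587357160293, 3586010760293, 823549800000, 2178704686957, 1200000000000, 13232928850945, 32088508478247⟩,
  ⟨1904887258145807, 357288845232000, 1295031719079586, 1294916144103586, 357757392432000, 506740205716901, 520608000000000, 13237240661505, 33205167074092⟩,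
  ⟨2176338766957, 823549800000, 3587023080293, 3586756680293, 824629800000, 2178498766957, 1200000000000, 13232928916993, 33188054378551⟩,
  ⟨799392339200, 2155386746157, 3439964806907, 3441802861307, 2154338426157, 799392339200, 1164800000000, 13228617106688, 80492890240826⟩,
  ⟨799392339200, 2153664506157, 3441687046907, 3441428461307, 2154712826157, 799392339200, 1164800000000, 13232912073984, 81588107097900⟩,
  ⟨799392339200, 2154753146157, 3442695046907, 3440339821307, 2153704826157, 799392339200, 1164800000000, 13232928851200, 82687602013991⟩,
  ⟨799392339200, 2152181306157, 3442121926907, 3441863341307, 2153229626157, 801488979200, 1164800000000, 13232928916992, 83787114752051⟩,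
  ⟨41271792861850, 41292280461850, 27303412407359, 52988387155209, 15622739706000, 15622739706000, 22764000000000, 13241518851332, 34228326197306⟩,
  ⟨99837282757201, 99872209957201, 77879240665462, 95281677124266, 26633600532000, 26633600532000, 38808000000000, 13241518785796, 115618006723386⟩,
  ⟨245684277173350, 301653664683747, 186850835239372, 351204295111922, 137380738193597, 81518253403200, 118780800000000, 13241518851589, 84887549327469⟩,
  ⟨32941992000, 82895334821, 32941992000, 32941992000, 82927878821, 32941992000, 48000000000, 14323800015360, 2457765494638⟩,
  ⟨32941992000, 82915533221, 32941992000, 32941992000, 82872333221, 32941992000, 48000000000, 14328094982656, 3552982155333⟩,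
  ⟨32941992000, 82930682021, 32941992000, 33017736000, 82887482021, 32941992000, 48000000000, 14328128668160, 5751971924294⟩,
  ⟨32941992000, 82976128421, 32941992000, 32941992000, 83008672421, 33017736000, 48000000000, 14328128537088, 7950995112515⟩,
  ⟨32941992000, 82902912421, 32952648000, 32941992000, 82946112421, 32941992000, 48000000000, 14332423635712, 10150085806703⟩,
  ⟨32941992000, 83010432421, 33039048000, 32941992000, 82967232421, 32941992000, 48000000000, 14332440412928, 11253875624769⟩,
  ⟨534358300807, 971009509527, 534919608007, 190514520400, 626915889120, 190514520400, 277600000000, 14332440478979, 13500965471307⟩,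
  ⟨32941992000, 82995072421, 32952648000, 32941992000, 83038272421, 33028392000, 48000000000, 14332440544000, 14561000311876⟩,
  ⟨377482326938, 659946781567, 148238964000, 148238964000, 660093229567, 377823174938, 216000000000, 14328128733954, 22477480544324⟩,
  ⟨377412470938, 659944709567, 148286916000, 148238964000, 660139109567, 377801270938, 216000000000, 14332440544771, 29976510415436⟩,
  ⟨871628562902, 1011866748377, 299772127200, 299772127200, 439617192675, 299772127200, 436800000000, 14341030347522, 127803017545287⟩,
  ⟨478540403851, 670933827746, 192710653200, 478983506251, 384851357095, 192710653200, 280800000000, 14341030479106, 34348854495309⟩,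
  ⟨46406399311958, 56706592512105, 24795707474796, 10630380818400, 20916633378547, 10630380818400, 15489600000000, 14341030413571, 132222619580749⟩,
  ⟨704943839462, 927936143779, 207534549600, 568493012268, 567182708311, 344462563994, 302400000000, 14341030479362, 135529781610061⟩,
  ⟨215221014400, 947104788741, 559336014007, 559830874807, 946822548741, 215221014400, 313600000000, 14328128734464, 57493694532685⟩,
  ⟨215221014400, 946983828741, 559456974007, 559387354807, 947266068741, 215221014400, 313600000000, 14332423701760, 58588911324286⟩,
  ⟨215221014400, 947306388741, 559698894007, 559064794807, 947024148741, 215221014400, 313600000000, 14332440478976, 59688406240321⟩,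
  ⟨215221014400, 947107668741, 559050894007, 558981274807, 947389908741, 215785494400, 313600000000, 14332440544768, 60787918586436⟩,
  ⟨28860128673247, 44807059777147, 16223892104130, 35045025325777, 25995867120300, 10062131456400, 14661600000000, 14341030479365, 64087342401096⟩,
  ⟨8097114721, 8100939721, 2916738875, 2916738875, 2916738875, 2916738875, 4250000000, 15427606676226, 3643532402255⟩,
  ⟨656568112576, 656744512576, 435358132283, 134513134000, 134513134000, 134513134000, 196000000000, 15427623519235, 13577706240105⟩,
  ⟨362936682113, 223833973208, 115983263500, 115983263500, 115983263500, 115983263500, 169000000000, 15436196610818, 15729568141657⟩,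
  ⟨1413018031443, 663293392166, 447805203750, 663735787166, 447805203750, 447805203750, 652500000000, 15436230231042, 16902044013153⟩,
  ⟨130310800230, 81030098429, 27074199675, 27074199675, 81056845529, 27074199675, 39450000000, 15436230230786, 18065980346712⟩,
  ⟨3899608945903, 3065682317473, 1221770442875, 1221770442875, 1221770442875, 2057299296305, 1780250000000, 15436246942466, 19028052956251⟩,
  ⟨5869976052054, 3621372059223, 1778009703625, 3623128587723, 1778009703625, 4028945371456, 2590750000000, 15436247139330, 20204890576221⟩,
  ⟨973892289786297, 735566548753292, 225525269497600, 487830501818394, 473484116995698, 712105610988703, 328614400000000, 15436247139842, 22519978808413⟩,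
  ⟨26069247051794, 24279349799832, 5752769869600, 5752769869600, 14196370285463, 15993811697425, 8382400000000, 15436247073538, 22481323906395⟩,
  ⟨175019126933985, 118034646001108, 32504412539600, 32504412539600, 118066757708308, 43941248640788, 47362400000000, 15436230296322, 22477012096348⟩,
  ⟨130349286705, 81056971529, 27082957575, 27074199675, 81092476529, 27074199675, 39450000000, 15436263916803, 24667378834531⟩,
  ⟨7235811543162, 5455056665032, 4546029257951, 1325915178000, 1325915178000, 1325915178000, 1932000000000, 15436213453827, 26728929647204⟩,
  ⟨22523805055901, 15153978306244, 7871062350396, 4064492779600, 11354053668248, 4064492779600, 5922400000000, 15436263851267, 26870814366819⟩,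
  ⟨287955853707568, 245250946632448, 166912926028219, 57146120622000, 57146120622000, 99925968897120, 83268000000000, 15436247073795, 27828591744605⟩,
  ⟨175031114401185, 118028673668308, 32514926992400, 32504412539600, 118071299828308, 43920176933588, 47362400000000, 15436263917059, 30182200727651⟩,
  ⟨1123726548511659, 605276634643236, 505592676598098, 853490003341334, 257633829100000, 776421602968423, 375400000000000, 15436247139844, 31226112726101⟩,
  ⟨430452830564, 430658030564, 156474462000, 173192088491, 156474462000, 156474462000, 228000000000, 15440541975554, 34421468066921⟩,
  ⟨357966935807, 272266227116, 131767968000, 272396403116, 131767968000, 131767968000, 192000000000, 15440525198338, 34434336192359⟩,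
  ⟨7472680272167, 6703555493948, 2849482308000, 6706370549948, 2849482308000, 3622343886219, 4152000000000, 15440542106626, 34447237741416⟩,
  ⟨533146790176356, 152366869098535, 304352196282483, 351790889903893, 105031938461625, 105031938461625, 153042750000000, 15444870628612, 45429603722594⟩,
  ⟨331610684410159146, 95034696175477552, 191465066108831135, 215944793560388722, 70614551385615965, 60311318981328000, 87880032000000000, 15444870628869, 48805531902309⟩,
  ⟨54393445909209, 28789990751828, 17399093684392, 17395928319592, 28802823311828, 9785418723600, 14258400000000, 15436263917061, 48921327589468⟩,
  ⟨16040225774545061, 5213131805236580, 9716430609131621, 9949030644618608, 2922772749868000, 2922772749868000, 4258792000000000, 15444870563076, 49862060107106⟩,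
  ⟨120780109697076561, 35446672753578876, 70726388759023554, 83573375683882430, 22622034552880000, 28803973995452779, 32962720000000000, 15444870628868, 50978684690786⟩,
  ⟨270912760695189, 220890924797808, 172888179382437, 319941272684245, 73910849384000, 124029611681381, 107696000000000, 15444837074436, 52078180001901⟩,
  ⟨69305151533306, 44964156997028, 40270767856705, 66040489307733, 19213416834000, 19213416834000, 27996000000000, 15444887405828, 61982307412076⟩,
  ⟨692333432321443, 582944006308192, 437120991920795, 823192452930987, 197067231642000, 306715090855251, 287148000000000, 15444887471876, 61986686069613⟩,
  ⟨2178660957508, 2179298157508, 1485759456336, 958802832403, 485894382000, 485894382000, 708000000000, 15440542041348, 63013249772408⟩,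
  ⟨404126871239803, 299214312375620, 274063101785453, 334444672767334, 93703496244000, 93703496244000, 136536000000000, 15444887340292, 63124818848620⟩,
  ⟨2154634716925649, 1840293421933100, 1413523475696048, 2443618437184674, 583369736328000, 898476060120549, 850032000000000, 15444887471620, 63124852598893⟩,
  ⟨2699822679053226, 1754686995431728, 1619466330678239, 2502822500524402, 871953131953565, 629916771024000, 917856000000000, 15444887406085, 64318786398061⟩,
  ⟨64320023049837481, 54788375186740284, 41008637167647172, 76902641354589086, 18911931156406370, 28466888961903567, 25899936000000000, 15444887471878, 64301673769832⟩,
  ⟨8665488275379, 5650510844956, 1740984277200, 1740984277200, 5652230795356, 1740984277200, 2536800000000, 15449115132674, 65225343727471⟩,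
  ⟨8667318265779, 5651246819356, 1741547446800, 1740984277200, 5653529939356, 1740984277200, 2536800000000, 15449148818691, 69649042535294⟩,
  ⟨58926195288160, 41102951170864, 14851399194723, 10857680563200, 37126983476941, 10857680563200, 15820800000000, 15449148753155, 71856856986494⟩,
  ⟨137673479895545, 93459499493236, 25585496153200, 25585496153200, 93484775875636, 33579193816246, 37280800000000, 15449115198210, 74042861059187⟩,
  ⟨207363184777186, 237689135459256, 48711323570400, 48711323570400, 133584143090357, 103322072248287, 70977600000000, 15449131975426, 74038549839225⟩,
  ⟨137683213322745, 93452998859636, 25593772490800, 25585496153200, 93486551579636, 33565908981046, 37280800000000, 15449148818947, 75163830873982⟩,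
  ⟨656963780841, 673988127332, 233888143200, 233888143200, 250605769691, 233888143200, 340800000000, 15440541975298, 76203280457336⟩,
  ⟨30846881443494, 31435444923896, 9306112740000, 9306112740000, 16188243948935, 9306112740000, 13560000000000, 15449182241538, 76366371780474⟩,
  ⟨106759059464732, 122280915479456, 33475652270400, 33475652270400, 55259380173657, 39781423998933, 48777600000000, 15449182438146, 76366438825337⟩,
  ⟨24370654496359, 21232450582192, 6168388002000, 11253852886987, 16153079561205, 6168388002000, 8988000000000, 15449182373122, 77375689030783⟩,
  ⟨3995275751617, 4469320362020, 2325362600174, 866374389600, 1339282840003, 866374389600, 1262400000000, 15440542041347, 78406682442089⟩,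
  ⟨5510730825947276, 6580304121805440, 2555352962819322, 1254147754228800, 2616878579074009, 1548949967695845, 1827427200000000, 15449182438915, 78582642275965⟩,
  ⟨106327088139074, 114902547370136, 48416493258915, 22911155436000, 51110049964865, 22911155436000, 33384000000000, 15449182307587, 78582608394623⟩,
  ⟨17974594737605, 21395955969428, 5003888584800, 13706998184684, 12697789803144, 9282990651321, 7291200000000, 15440542107138, 79531998011501⟩,
  ⟨920801619926455, 977950791475264, 230542883912400, 537248969385967, 671472463558497, 350669440793958, 335925600000000, 15449182373378, 79695022225279⟩,
  ⟨222379897071405, 275069011823248, 59629946818800, 131919125073829, 158846045713864, 106235129442021, 86887200000000, 15449182438914, 79695038936697⟩,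
  ⟨100238959786231, 66308621204992, 22524423281523, 22518429814323, 66332919044992, 18528223400400, 26997600000000, 15449148818949, 81791200292723⟩,
  ⟨298402526702441, 256496656817768, 85521302606793, 139933934443355, 202148733843606, 65500209793200, 95440800000000, 15449182373381, 85128373761916⟩]

lemma geo4 : vtx4.all (geoV rows4 vtx4) = true := by decide +kernel

lemma ev4 : vtx4.all (evV 71067812 71067812 71067812 71067812) = true := by decide +kernel

lemma sqrt2_fine : 1.4142135623730 < √2 ∧ √2 < 1.4142135623731 := by
  constructor
  · exact Real.lt_sqrt_of_sq_lt (by norm_num)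
  · rw [Real.sqrt_lt' (by norm_num)]; norm_num

/-- The metric information on a weighted tetrahedron with a small support sphere: `x` are the
squared edge lengths. -/
structure FM (ra rb rc rd : ℝ) (x : Fin 6 → ℝ) : Prop where
  l0 : (ra + rb) ^ 2 ≤ x 0
  l1 : (ra + rc) ^ 2 ≤ x 1
  l2 : (ra + rd) ^ 2 ≤ x 2
  l3 : (rb + rc) ^ 2 ≤ x 3
  l4 : (rb + rd) ^ 2 ≤ x 4
  l5 : (rc + rd) ^ 2 ≤ x 5
  cut : ∀ k0 k1 k2 k3 : ℝ, 0 ≤ k0 + k1 + k2 + k3 →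
    0 ≤ 2 * (k0 * ra + k1 * rb + k2 * rc + k3 * rd) + (k0 + k1 + k2 + k3) * (√2 - 1) →
    k0 * k1 * x 0 + k0 * k2 * x 1 + k0 * k3 * x 2 + k1 * k2 * x 3 + k1 * k3 * x 4 + k2 * k3 * x 5
      ≤ (k0 + k1 + k2 + k3) * (k0 * (ra + (√2 - 1)) ^ 2 + k1 * (rb + (√2 - 1)) ^ 2
        + k2 * (rc + (√2 - 1)) ^ 2 + k3 * (rd + (√2 - 1)) ^ 2)

lemma cut_id (P Q S T : E3) (k0 k1 k2 k3 : ℝ) :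
    k0 * k1 * ‖P - Q‖ ^ 2 + k0 * k2 * ‖P - S‖ ^ 2 + k0 * k3 * ‖P - T‖ ^ 2 + k1 * k2 * ‖Q - S‖ ^ 2
      + k1 * k3 * ‖Q - T‖ ^ 2 + k2 * k3 * ‖S - T‖ ^ 2
    = (k0 + k1 + k2 + k3) * (k0 * ‖P‖ ^ 2 + k1 * ‖Q‖ ^ 2 + k2 * ‖S‖ ^ 2 + k3 * ‖T‖ ^ 2)
      - ‖k0 • P + k1 • Q + k2 • S + k3 • T‖ ^ 2 := by
  simp only [EuclideanSpace.norm_sq_eq, Real.norm_eq_abs, sq_abs, Fin.sum_univ_three,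
    PiLp.sub_apply, PiLp.add_apply, PiLp.smul_apply, smul_eq_mul]
  ring

lemma FM_of {A B C D : E3} {ra rb rc rd : ℝ} (ha : 0 < ra) (hb : 0 < rb) (hc : 0 < rc) (hd : 0 < rd)
    (hAB : ra + rb ≤ dist A B) (hAC : ra + rc ≤ dist A C) (hAD : ra + rd ≤ dist A D)
    (hBC : rb + rc ≤ dist B C) (hBD : rb + rd ≤ dist B D) (hCD : rc + rd ≤ dist C D)
    (hs : ∃ O : E3, ∃ R : ℝ, 0 < R ∧ R ≤ √2 - 1 ∧
      dist O A = ra + R ∧ dist O B = rb + R ∧ dist O C = rc + R ∧ dist O D = rd + R) :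
    FM ra rb rc rd (edges A B C D) := by
  refine ⟨?_, ?_, ?_, ?_, ?_, ?_, ?_⟩
  · exact pow_le_pow_left₀ (by positivity) hAB 2
  · exact pow_le_pow_left₀ (by positivity) hAC 2
  · exact pow_le_pow_left₀ (by positivity) hAD 2
  · exact pow_le_pow_left₀ (by positivity) hBC 2
  · exact pow_le_pow_left₀ (by positivity) hBD 2
  · exact pow_le_pow_left₀ (by positivity) hCD 2
  obtain ⟨O, R, h0, h1, hA, hB, hC, hD⟩ := hs
  intro k0 k1 k2 k3 hk hr
  have key := cut_id (O - A) (O - B) (O - C) (O - D) k0 k1 k2 k3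
  simp only [sub_sub_sub_cancel_left] at key
  rw [norm_sub_rev B A, norm_sub_rev C A, norm_sub_rev D A, norm_sub_rev C B, norm_sub_rev D B, norm_sub_rev D C,
    ← dist_eq_norm O A, ← dist_eq_norm O B, ← dist_eq_norm O C, ← dist_eq_norm O D, hA, hB, hC, hD,
    ← dist_eq_norm A B, ← dist_eq_norm A C, ← dist_eq_norm A D, ← dist_eq_norm B C, ← dist_eq_norm B D,
    ← dist_eq_norm C D] at key
  have e : k0 * k1 * edges A B C D 0 + k0 * k2 * edges A B C D 1 + k0 * k3 * edges A B C D 2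
      + k1 * k2 * edges A B C D 3 + k1 * k3 * edges A B C D 4 + k2 * k3 * edges A B C D 5
      ≤ (k0 + k1 + k2 + k3) * (k0 * (ra + R) ^ 2 + k1 * (rb + R) ^ 2 + k2 * (rc + R) ^ 2
        + k3 * (rd + R) ^ 2) := by
    have : 0 ≤ ‖k0 • (O - A) + k1 • (O - B) + k2 • (O - C) + k3 • (O - D)‖ ^ 2 := by positivity
    simp only [edges, Matrix.cons_val]
    linarith
  refine e.trans (mul_le_mul_of_nonneg_left ?_ hk)
  have : 0 ≤ (√2 - 1 - R) * (2 * (k0 * ra + k1 * rb + k2 * rc + k3 * rd)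
      + (k0 + k1 + k2 + k3) * (√2 - 1) + (k0 + k1 + k2 + k3) * R) := by
    apply mul_nonneg (by linarith)
    have := mul_nonneg hk h0.le
    linarith
  generalize √2 - 1 = r at *
  have e2 : (k0 * (ra + r) ^ 2 + k1 * (rb + r) ^ 2 + k2 * (rc + r) ^ 2 + k3 * (rd + r) ^ 2)
      - (k0 * (ra + R) ^ 2 + k1 * (rb + R) ^ 2 + k2 * (rc + R) ^ 2 + k3 * (rd + R) ^ 2)
      = (r - R) * (2 * (k0 * ra + k1 * rb + k2 * rc + k3 * rd)
      + (k0 + k1 + k2 + k3) * r + (k0 + k1 + k2 + k3) * R) := by ring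
  linarith

/-- The point to which the polytope data apply. -/
lemma in_hull {R : List Row} {V : List Vtx} (hV : V ≠ []) (h : V.all (geoV R V) = true)
    {S : Set (Fin 6 → ℝ)} (hS : Convex ℝ S) {ξ : ℝ} (hvS : ∀ v ∈ V, 0 < v.w → v.pt + sh ξ ∈ S)
    {x : Fin 6 → ℝ} (hx : ∀ r ∈ R, r.vec ⬝ᵥ (x - sh ξ) ≤ r.b) : x ∈ S := by
  have h1 := geo_sound R V hV h _ hx
  have h2 : convexHull ℝ {y | ∃ v ∈ V, v.pt = y} ⊆ (fun y => y + sh ξ) ⁻¹' S := by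
    apply convexHull_min
    · rintro y ⟨v, hv, rfl⟩
      exact hvS v hv (geoV_w (List.all_eq_true.mp h v hv))
    · exact hS.translate_preimage_left (sh ξ)
  have := h2 h1
  simpa using this

lemma in_hull' {R : List Row} {V : List Vtx} (hV : V ≠ []) (h : V.all (geoV R V) = true)
    {w0 w1 w2 w3 : ℕ} (he : V.all (evV w0 w1 w2 w3) = true)
    {ra rb rc rd : ℝ} (ha : 0 ≤ ra) (hb : 0 ≤ rb) (hc : 0 ≤ rc) (hd : 0 ≤ rd)
    (wa : ra ^ 3 ≤ (w0 : ℝ) / 10 ^ 9)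
    (wb : rb ^ 3 ≤ (w1 : ℝ) / 10 ^ 9) (wc : rc ^ 3 ≤ (w2 : ℝ) / 10 ^ 9)
    (wd : rd ^ 3 ≤ (w3 : ℝ) / 10 ^ 9)
    {x : Fin 6 → ℝ} (hx : ∀ r ∈ R, r.m0 * x 0 + r.m1 * x 1 + r.m2 * x 2 + r.m3 * x 3 + r.m4 * x 4
      + r.m5 * x 5 ≤ r.b) : Psi ra rb rc rd x ≤ Psi 1 1 1 (√2 - 1) X0 := by
  have : x ∈ subPsi ra rb rc rd (ENNReal.ofReal 0.40605) := by
    apply in_hull hV h (convex_sub ra rb rc rd _) (ξ := 0)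
    · intro v hv hw
      exact evV_sound ha hb hc hd wa wb wc wd hw (List.all_eq_true.mp he v hv) le_rfl (by norm_num)
    · intro r hr
      have e : x - sh 0 = x := by ext i; fin_cases i <;> simp [sh]
      rw [e, Row.dot]
      exact hx r hr
  exact this.2.trans Psi_X0_lower

lemma w_big : (1 : ℝ) ^ 3 ≤ ((1000000000 : ℕ) : ℝ) / 10 ^ 9 := by norm_num

lemma r_pos : 0 < √2 - 1 := by linarith [sqrt2_fine.1]

lemma r_cube : (√2 - 1) ^ 3 = 5 * √2 - 7 := by
  have : √2 ^ 2 = 2 := Real.sq_sqrt (by norm_num)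
  have e : (√2 - 1) ^ 3 = √2 * √2 ^ 2 - 3 * √2 ^ 2 + 3 * √2 - 1 := by ring
  rw [e, this]; ring

lemma r_sq : (√2 - 1) ^ 2 = 3 - 2 * √2 := by
  have : √2 ^ 2 = 2 := Real.sq_sqrt (by norm_num)
  have e : (√2 - 1) ^ 2 = √2 ^ 2 - 2 * √2 + 1 := by ring
  rw [e, this]; ring

lemma w_small : (√2 - 1) ^ 3 ≤ ((71067812 : ℕ) : ℝ) / 10 ^ 9 := by
  rw [r_cube]; push_cast; linarith [sqrt2_fine.2]

lemma sq_bb : ((1 : ℝ) + 1) ^ 2 = 4 := by norm_num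
lemma sq_br : (1 + (√2 - 1)) ^ 2 = 2 := by
  have : √2 ^ 2 = 2 := Real.sq_sqrt (by norm_num)
  have e : 1 + (√2 - 1) = √2 := by ring
  rw [e, this]
lemma sq_rr : ((√2 - 1) + (√2 - 1)) ^ 2 = 12 - 8 * √2 := by
  have := r_sq
  have e : ((√2 - 1) + (√2 - 1)) ^ 2 = 4 * (√2 - 1) ^ 2 := by ring
  rw [e, this]; ring

lemma type0 {x : Fin 6 → ℝ} (h : FM 1 1 1 1 x)
    (h01 : x 3 + x 4 ≤ x 1 + x 2)
    (h12 : x 1 + x 5 ≤ x 0 + x 4)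
    (h23 : x 2 + x 4 ≤ x 1 + x 3) :
    Psi 1 1 1 1 x ≤ Psi 1 1 1 (√2 - 1) X0 := by
  obtain ⟨s1, s2⟩ := sqrt2_fine
  obtain ⟨l0, l1, l2, l3, l4, l5, cut⟩ := h
  simp only [sq_bb, sq_br, sq_rr] at l0 l1 l2 l3 l4 l5 cut
  apply in_hull' (by simp [vtx0]) geo0 ev0 zero_le_one zero_le_one zero_le_one zero_le_one w_big w_big w_big w_big
  simp only [rows0, List.forall_mem_cons, List.not_mem_nil, false_imp_iff, implies_true, and_true,
    Int.ofNat_eq_natCast, Int.cast_natCast, Nat.cast_ofNat, Int.cast_negSucc, Nat.cast_zero]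
  refine ⟨?_, ?_, ?_, ?_, ?_, ?_, ?_, ?_, ?_, ?_, ?_⟩
  · norm_num; linarith
  · norm_num; linarith
  · norm_num; linarith
  · norm_num; linarith
  · norm_num; linarith
  · norm_num; linarith
  · have := cut 4 4 4 4 (by norm_num) (by linarith)
    norm_num at this ⊢; linarith
  · norm_num; linarith
  · norm_num; linarith
  · norm_num; linarith
  · have := cut 8 8 0 0 (by norm_num) (by linarith)
    norm_num at this ⊢; linarith

lemma type2 {x : Fin 6 → ℝ} (h : FM 1 1 (√2 - 1) (√2 - 1) x)
    (h01 : x 3 + x 4 ≤ x 1 + x 2)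
    (h23 : x 2 + x 4 ≤ x 1 + x 3) :
    Psi 1 1 (√2 - 1) (√2 - 1) x ≤ Psi 1 1 1 (√2 - 1) X0 := by
  obtain ⟨s1, s2⟩ := sqrt2_fine
  obtain ⟨l0, l1, l2, l3, l4, l5, cut⟩ := h
  simp only [sq_bb, sq_br, sq_rr] at l0 l1 l2 l3 l4 l5 cut
  apply in_hull' (by simp [vtx2]) geo2 ev2 zero_le_one zero_le_one r_pos.le r_pos.le w_big w_big w_small w_small
  simp only [rows2, List.forall_mem_cons, List.not_mem_nil, false_imp_iff, implies_true, and_true,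
    Int.ofNat_eq_natCast, Int.cast_natCast, Nat.cast_ofNat, Int.cast_negSucc, Nat.cast_zero]
  refine ⟨?_, ?_, ?_, ?_, ?_, ?_, ?_, ?_, ?_, ?_, ?_, ?_, ?_, ?_, ?_, ?_, ?_, ?_⟩
  · norm_num; linarith
  · norm_num; linarith
  · norm_num; linarith
  · norm_num; linarith
  · norm_num; linarith
  · norm_num; linarith
  · have := cut 4 4 4 4 (by norm_num) (by linarith)
    norm_num at this ⊢; linarith
  · norm_num; linarith
  · norm_num; linarith
  · have := cut 0 0 8 8 (by norm_num) (by linarith)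
    norm_num at this ⊢; linarith
  · have := cut 17 (-9) 23 (-15) (by norm_num) (by linarith)
    norm_num at this ⊢; linarith
  · have := cut 19 18 4 (-25) (by norm_num) (by linarith)
    norm_num at this ⊢; linarith
  · have := cut 34 34 (-26) (-26) (by norm_num) (by linarith)
    norm_num at this ⊢; linarith
  · have := cut (-20) 43 78 (-85) (by norm_num) (by linarith)
    norm_num at this ⊢; linarith
  · have := cut 10 4 17 (-15) (by norm_num) (by linarith)
    norm_num at this ⊢; linarith
  · have := cut 8 9 17 (-18) (by norm_num) (by linarith)
    norm_num at this ⊢; linarith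
  · have := cut 14 11 13 (-22) (by norm_num) (by linarith)
    norm_num at this ⊢; linarith
  · have := cut 14 (-2) 25 (-21) (by norm_num) (by linarith)
    norm_num at this ⊢; linarith

lemma type3 {x : Fin 6 → ℝ} (h : FM 1 (√2 - 1) (√2 - 1) (√2 - 1) x)
    (h12 : x 1 + x 5 ≤ x 0 + x 4)
    (h23 : x 2 + x 4 ≤ x 1 + x 3) :
    Psi 1 (√2 - 1) (√2 - 1) (√2 - 1) x ≤ Psi 1 1 1 (√2 - 1) X0 := by
  obtain ⟨s1, s2⟩ := sqrt2_fine
  obtain ⟨l0, l1, l2, l3, l4, l5, cut⟩ := h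
  simp only [sq_bb, sq_br, sq_rr] at l0 l1 l2 l3 l4 l5 cut
  apply in_hull' (by simp [vtx3]) geo3 ev3 zero_le_one r_pos.le r_pos.le r_pos.le w_big w_small w_small w_small
  simp only [rows3, List.forall_mem_cons, List.not_mem_nil, false_imp_iff, implies_true, and_true,
    Int.ofNat_eq_natCast, Int.cast_natCast, Nat.cast_ofNat, Int.cast_negSucc, Nat.cast_zero]
  refine ⟨?_, ?_, ?_, ?_, ?_, ?_, ?_, ?_, ?_, ?_, ?_, ?_, ?_, ?_, ?_, ?_, ?_, ?_, ?_, ?_⟩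
  · norm_num; linarith
  · norm_num; linarith
  · norm_num; linarith
  · norm_num; linarith
  · norm_num; linarith
  · norm_num; linarith
  · have := cut 2 2 2 2 (by norm_num) (by linarith)
    norm_num at this ⊢; linarith
  · norm_num; linarith
  · norm_num; linarith
  · have := cut 1 8 (-8) 7 (by norm_num) (by linarith)
    norm_num at this ⊢; linarith
  · have := cut (-1) 12 16 (-19) (by norm_num) (by linarith)
    norm_num at this ⊢; linarith
  · have := cut (-7) 5 5 5 (by norm_num) (by linarith)
    norm_num at this ⊢; linarith
  · have := cut 8 13 (-4) (-9) (by norm_num) (by linarith)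
    norm_num at this ⊢; linarith
  · have := cut 4 8 5 (-9) (by norm_num) (by linarith)
    norm_num at this ⊢; linarith
  · have := cut 21 (-1) 25 (-37) (by norm_num) (by linarith)
    norm_num at this ⊢; linarith
  · have := cut 6 7 7 (-12) (by norm_num) (by linarith)
    norm_num at this ⊢; linarith
  · have := cut 2 9 9 (-12) (by norm_num) (by linarith)
    norm_num at this ⊢; linarith
  · have := cut (-2) 9 9 (-8) (by norm_num) (by linarith)
    norm_num at this ⊢; linarith
  · have := cut 6 11 1 (-10) (by norm_num) (by linarith)
    norm_num at this ⊢; linarith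
  · have := cut 3 9 6 (-10) (by norm_num) (by linarith)
    norm_num at this ⊢; linarith

lemma type4 {x : Fin 6 → ℝ} (h : FM (√2 - 1) (√2 - 1) (√2 - 1) (√2 - 1) x)
    (h01 : x 3 + x 4 ≤ x 1 + x 2)
    (h12 : x 1 + x 5 ≤ x 0 + x 4)
    (h23 : x 2 + x 4 ≤ x 1 + x 3) :
    Psi (√2 - 1) (√2 - 1) (√2 - 1) (√2 - 1) x ≤ Psi 1 1 1 (√2 - 1) X0 := by
  obtain ⟨s1, s2⟩ := sqrt2_fine
  obtain ⟨l0, l1, l2, l3, l4, l5, cut⟩ := h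
  simp only [sq_bb, sq_br, sq_rr] at l0 l1 l2 l3 l4 l5 cut
  apply in_hull' (by simp [vtx4]) geo4 ev4 r_pos.le r_pos.le r_pos.le r_pos.le w_small w_small w_small w_small
  simp only [rows4, List.forall_mem_cons, List.not_mem_nil, false_imp_iff, implies_true, and_true,
    Int.ofNat_eq_natCast, Int.cast_natCast, Nat.cast_ofNat, Int.cast_negSucc, Nat.cast_zero]
  refine ⟨?_, ?_, ?_, ?_, ?_, ?_, ?_, ?_, ?_, ?_, ?_, ?_, ?_, ?_, ?_⟩
  · norm_num; linarith
  · norm_num; linarith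
  · norm_num; linarith
  · norm_num; linarith
  · norm_num; linarith
  · norm_num; linarith
  · have := cut 4 4 4 4 (by norm_num) (by linarith)
    norm_num at this ⊢; linarith
  · norm_num; linarith
  · norm_num; linarith
  · norm_num; linarith
  · have := cut 16 17 (-7) (-10) (by norm_num) (by linarith)
    norm_num at this ⊢; linarith
  · have := cut 16 12 12 (-24) (by norm_num) (by linarith)
    norm_num at this ⊢; linarith
  · have := cut (-5) 23 25 (-27) (by norm_num) (by linarith)
    norm_num at this ⊢; linarith
  · have := cut 44 (-12) 48 (-64) (by norm_num) (by linarith)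
    norm_num at this ⊢; linarith
  · have := cut 15 12 5 (-16) (by norm_num) (by linarith)
    norm_num at this ⊢; linarith

lemma T0_cut {x : Fin 6 → ℝ} (h : FM 1 1 1 (√2 - 1) x) :
    4096 * (x 0 - 32 * (3 - √2) / 7) + 768 * (x 1 - 4) - 4481 * (x 2 - 2) + 768 * (x 3 - 4)
      - 4481 * (x 4 - 2) - 841 * (x 5 - 2) ≤ 0 := by
  obtain ⟨s1, s2⟩ := sqrt2_fine
  have hs : √2 ^ 2 = 2 := Real.sq_sqrt (by norm_num)
  obtain ⟨l0, l1, l2, l3, l4, l5, cut⟩ := h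
  simp only [sq_bb, sq_br, sq_rr] at l0 l1 l2 l3 l4 l5 cut
  have c := cut (√2 - 1 / 2) (√2 - 1 / 2) (3 - 2 * √2) (-1) (by linarith) (by linarith)
  have e0 : (√2 - 1 / 2) * (√2 - 1 / 2) = 9 / 4 - √2 := by
    linear_combination hs
  have e1 : (√2 - 1 / 2) * (3 - 2 * √2) = 4 * √2 - 11 / 2 := by
    linear_combination (-2) * hs
  rw [e0, e1] at c
  have p1 := mul_nonneg (show 0 ≤ 4096 * (4 * √2 - 11 / 2) - 768 * (9 / 4 - √2) by linarith)
    (sub_nonneg.mpr l1)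
  have p3 := mul_nonneg (show 0 ≤ 4096 * (4 * √2 - 11 / 2) - 768 * (9 / 4 - √2) by linarith)
    (sub_nonneg.mpr l3)
  have p2 := mul_nonneg (show 0 ≤ 4096 * (1 / 2 - √2) + 4481 * (9 / 4 - √2) by linarith)
    (sub_nonneg.mpr l2)
  have p4 := mul_nonneg (show 0 ≤ 4096 * (1 / 2 - √2) + 4481 * (9 / 4 - √2) by linarith)
    (sub_nonneg.mpr l4)
  have p5 := mul_nonneg (show 0 ≤ 4096 * (2 * √2 - 3) + 841 * (9 / 4 - √2) by linarith)
    (sub_nonneg.mpr l5)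
  have hm : (9 / 4 - √2) * (4096 * (x 0 - 32 * (3 - √2) / 7) + 768 * (x 1 - 4) - 4481 * (x 2 - 2)
      + 768 * (x 3 - 4) - 4481 * (x 4 - 2) - 841 * (x 5 - 2)) ≤ 0 := by
    have e2 : (9 / 4 - √2) * (32 * (3 - √2) / 7) = 40 - 24 * √2 := by
      linear_combination (32 / 7) * hs
    nlinarith [e2]
  by_contra hc
  push Not at hc
  have := mul_pos (show 0 < 9 / 4 - √2 by linarith) hc
  linarith

lemma X0_eq {ξ : ℝ} (hξ : ξ = 32 * (3 - √2) / 7 - 724930942 / 10 ^ 8) : vtxT.pt + sh ξ = X0 := by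
  subst hξ
  ext i; fin_cases i <;> norm_num [Vtx.pt, vtxT, sh, X0]

lemma type1 {x : Fin 6 → ℝ} (h : FM 1 1 1 (√2 - 1) x)
    (h02 : x 3 + x 5 ≤ x 0 + x 2)
    (h12 : x 1 + x 5 ≤ x 0 + x 4) :
    Psi 1 1 1 (√2 - 1) x ≤ Psi 1 1 1 (√2 - 1) X0 := by
  have hT := T0_cut h
  obtain ⟨s1, s2⟩ := sqrt2_fine
  obtain ⟨l0, l1, l2, l3, l4, l5, cut⟩ := h
  simp only [sq_bb, sq_br, sq_rr] at l0 l1 l2 l3 l4 l5 cut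
  obtain ⟨ξ, hξ⟩ : ∃ ξ : ℝ, ξ = 32 * (3 - √2) / 7 - 724930942 / 10 ^ 8 := ⟨_, rfl⟩
  have hξ0 : 0 ≤ ξ := by rw [hξ]; norm_num; linarith
  have hξ1 : ξ ≤ 1 / 10 ^ 8 := by rw [hξ]; norm_num; linarith
  have main : x ∈ subPsi 1 1 1 (√2 - 1) (Psi 1 1 1 (√2 - 1) X0) := by
    apply in_hull (R := rows1) (V := vtxT :: vtx1) (by simp) geo1 (convex_sub _ _ _ _ _) (ξ := ξ)
    · intro v hv hw
      rcases List.mem_cons.mp hv with rfl | hv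
      · rw [X0_eq hξ]; exact ⟨X0_ok, le_rfl⟩
      · have := evV_sound zero_le_one zero_le_one zero_le_one r_pos.le w_big w_big w_big w_small hw
          (List.all_eq_true.mp ev1 v hv) hξ0 hξ1
        exact ⟨this.1, this.2.trans Psi_X0_lower⟩
    · obtain ⟨y0, hy0⟩ : ∃ y0, y0 = x 0 - ξ := ⟨_, rfl⟩
      have e0 : (x - sh ξ) 0 = y0 := by simp [sh, hy0]
      have e1 : (x - sh ξ) 1 = x 1 := by simp [sh]
      have e2 : (x - sh ξ) 2 = x 2 := by simp [sh]
      have e3 : (x - sh ξ) 3 = x 3 := by simp [sh]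
      have e4 : (x - sh ξ) 4 = x 4 := by simp [sh]
      have e5 : (x - sh ξ) 5 = x 5 := by simp [sh]
      have hx0 : y0 ≤ x 0 := by linarith
      have hx1 : x 0 - 1 / 10 ^ 8 ≤ y0 := by linarith
      have hT' : x 0 - 32 * (3 - √2) / 7 = y0 - 724930942 / 10 ^ 8 := by linarith
      rw [hT'] at hT
      simp only [rows1, List.forall_mem_cons, List.not_mem_nil, false_imp_iff, implies_true, and_true,
        Int.ofNat_eq_natCast, Int.cast_natCast, Nat.cast_ofNat, Int.cast_negSucc, Nat.cast_zero,
        Row.dot, e0, e1, e2, e3, e4, e5]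
      norm_num at hx1 hT
      refine ⟨?_, ?_, ?_, ?_, ?_, ?_, ?_, ?_, ?_, ?_, ?_, ?_, ?_, ?_, ?_, ?_⟩
      · norm_num; linarith
      · norm_num; linarith
      · norm_num; linarith
      · norm_num; linarith
      · norm_num; linarith
      · norm_num; linarith
      · have := cut 2 2 2 2 (by norm_num) (by linarith)
        norm_num at this ⊢; linarith
      · norm_num; linarith
      · norm_num; linarith
      · norm_num; linarith
      · have := cut 3 0 0 5 (by norm_num) (by linarith)
        norm_num at this ⊢; linarith
      · have := cut 0 3 0 5 (by norm_num) (by linarith)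
        norm_num at this ⊢; linarith
      · have := cut 0 0 3 5 (by norm_num) (by linarith)
        norm_num at this ⊢; linarith
      · have := cut 1 7 7 (-7) (by norm_num) (by linarith)
        norm_num at this ⊢; linarith
      · have := cut 7 1 7 (-7) (by norm_num) (by linarith)
        norm_num at this ⊢; linarith
      · have := cut 7 7 5 (-11) (by norm_num) (by linarith)
        norm_num at this ⊢; linarith
  exact main.2

/-- The full set of hypotheses, with the sum of squared distances `f` to the four vertices. -/
structure Hyp (f : E3 → ℝ) (A B C D : E3) (ra rb rc rd : ℝ) : Prop where
  ha : 0 < ra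
  hb : 0 < rb
  hc : 0 < rc
  hd : 0 < rd
  haff : AffineIndependent ℝ ![A, B, C, D]
  hAB : ra + rb ≤ dist A B
  hAC : ra + rc ≤ dist A C
  hAD : ra + rd ≤ dist A D
  hBC : rb + rc ≤ dist B C
  hBD : rb + rd ≤ dist B D
  hCD : rc + rd ≤ dist C D
  hs : ∃ O : E3, ∃ R : ℝ, 0 < R ∧ R ≤ √2 - 1 ∧
      dist O A = ra + R ∧ dist O B = rb + R ∧ dist O C = rc + R ∧ dist O D = rd + R
  hf : ∀ X, f X = dist X A ^ 2 + dist X B ^ 2 + dist X C ^ 2 + dist X D ^ 2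

/-- The claim for given vertices. -/
def Gc (K : ℝ) (f : E3 → ℝ) (A B C D : E3) (ra rb rc rd : ℝ) : Prop :=
  Hyp f A B C D ra rb rc rd → density A B C D ra rb rc rd ≤ K

lemma Gc1 {K : ℝ} {f : E3 → ℝ} {A B C D : E3} {ra rb rc rd : ℝ} (h : Gc K f B A C D rb ra rc rd) :
    Gc K f A B C D ra rb rc rd := by
  rintro ⟨ha, hb, hc, hd, haff, hAB, hAC, hAD, hBC, hBD, hCD, ⟨O, R, h0, h1, oA, oB, oC, oD⟩, hf⟩
  have := h ⟨hb, ha, hc, hd, aff_swap1 haff, by rw [add_comm, dist_comm]; exact hAB, hBC, hBD, hAC, hAD,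
    hCD, ⟨O, R, h0, h1, oB, oA, oC, oD⟩, fun X => by rw [hf]; ring⟩
  have e : density B A C D rb ra rc rd = density A B C D ra rb rc rd := by
    unfold density
    rw [tetra_swap1, Set.union_comm (closedBall B rb)]
  rwa [e] at this

lemma Gc2 {K : ℝ} {f : E3 → ℝ} {A B C D : E3} {ra rb rc rd : ℝ} (h : Gc K f A C B D ra rc rb rd) :
    Gc K f A B C D ra rb rc rd := by
  rintro ⟨ha, hb, hc, hd, haff, hAB, hAC, hAD, hBC, hBD, hCD, ⟨O, R, h0, h1, oA, oB, oC, oD⟩, hf⟩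
  have := h ⟨ha, hc, hb, hd, aff_swap2 haff, hAC, hAB, hAD, by rw [add_comm, dist_comm]; exact hBC, hCD,
    hBD, ⟨O, R, h0, h1, oA, oC, oB, oD⟩, fun X => by rw [hf]; ring⟩
  have e : density A C B D ra rc rb rd = density A B C D ra rb rc rd := by
    unfold density
    rw [tetra_swap2, Set.union_right_comm (closedBall A ra)]
  rwa [e] at this

lemma Gc3 {K : ℝ} {f : E3 → ℝ} {A B C D : E3} {ra rb rc rd : ℝ} (h : Gc K f A B D C ra rb rd rc) :
    Gc K f A B C D ra rb rc rd := by
  rintro ⟨ha, hb, hc, hd, haff, hAB, hAC, hAD, hBC, hBD, hCD, ⟨O, R, h0, h1, oA, oB, oC, oD⟩, hf⟩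
  have := h ⟨ha, hb, hd, hc, aff_swap3 haff, hAB, hAD, hAC, hBD, hBC, by rw [add_comm, dist_comm]; exact hCD,
    ⟨O, R, h0, h1, oA, oB, oD, oC⟩, fun X => by rw [hf]; ring⟩
  have e : density A B D C ra rb rd rc = density A B C D ra rb rc rd := by
    unfold density
    rw [tetra_swap3, Set.union_right_comm (closedBall A ra ∪ closedBall B rb)]
  rwa [e] at this

/-- Sorting the last three vertices. -/
lemma sortBCD {K : ℝ} {f : E3 → ℝ} {q r : ℝ} {A : E3}
    (h : ∀ B C D, f C ≤ f B → f D ≤ f C → Gc K f A B C D q r r r) (B C D : E3) :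
    Gc K f A B C D q r r r := by
  have h1 : ∀ B C D, f C ≤ f B → Gc K f A B C D q r r r := by
    intro B C D hCB
    rcases le_total (f D) (f C) with h1 | h1
    · exact h B C D hCB h1
    rcases le_total (f D) (f B) with h2 | h2
    · exact Gc3 (h B D C h2 h1)
    · exact Gc3 (Gc2 (h D B C h2 hCB))
  rcases le_total (f C) (f B) with h2 | h2
  · exact h1 B C D h2
  · exact Gc2 (h1 C B D h2)

/-- Sorting all vertices. -/
lemma sortAll {K : ℝ} {f : E3 → ℝ} {r : ℝ}
    (h : ∀ A B C D, f B ≤ f A → f C ≤ f B → f D ≤ f C → Gc K f A B C D r r r r) (A B C D : E3) :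
    Gc K f A B C D r r r r := by
  refine sortBCD (fun B C D hC hD => ?_) B C D
  rcases le_total (f B) (f A) with h1 | h1
  · exact h A B C D h1 hC hD
  rcases le_total (f C) (f A) with h2 | h2
  · exact Gc1 (h B A C D h1 h2 hD)
  rcases le_total (f D) (f A) with h3 | h3
  · exact Gc1 (Gc2 (h B C A D hC h2 h3))
  · exact Gc1 (Gc2 (Gc3 (h B C D A hC hD h3)))

lemma Hyp.fm {f : E3 → ℝ} {A B C D : E3} {ra rb rc rd : ℝ} (h : Hyp f A B C D ra rb rc rd) :
    FM ra rb rc rd (edges A B C D) :=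
  FM_of h.ha h.hb h.hc h.hd h.hAB h.hAC h.hAD h.hBC h.hBD h.hCD h.hs

section
variable {f : E3 → ℝ} {A B C D : E3} {ra rb rc rd : ℝ}

lemma Hyp.fA (h : Hyp f A B C D ra rb rc rd) :
    f A = edges A B C D 0 + edges A B C D 1 + edges A B C D 2 := by
  rw [h.hf]; simp [edges]
lemma Hyp.fB (h : Hyp f A B C D ra rb rc rd) :
    f B = edges A B C D 0 + edges A B C D 3 + edges A B C D 4 := by
  rw [h.hf]; simp [edges, dist_comm]
lemma Hyp.fC (h : Hyp f A B C D ra rb rc rd) :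
    f C = edges A B C D 1 + edges A B C D 3 + edges A B C D 5 := by
  rw [h.hf]; simp [edges, dist_comm]
lemma Hyp.fD (h : Hyp f A B C D ra rb rc rd) :
    f D = edges A B C D 2 + edges A B C D 4 + edges A B C D 5 := by
  rw [h.hf]; simp [edges, dist_comm]
end

/-- `K` is an upper bound for all configurations with small value of `Psi`. -/
def Bd (K : ℝ) : Prop := ∀ (A B C D : E3) (ra rb rc rd : ℝ), 0 < ra → 0 < rb → 0 < rc → 0 < rd →
  AffineIndependent ℝ ![A, B, C, D] →
  Psi ra rb rc rd (edges A B C D) ≤ Psi 1 1 1 (√2 - 1) X0 → density A B C D ra rb rc rd ≤ K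

lemma Hyp.fin {K : ℝ} (hK : Bd K) {f : E3 → ℝ} {A B C D : E3} {ra rb rc rd : ℝ}
    (h : Hyp f A B C D ra rb rc rd)
    (hP : Psi ra rb rc rd (edges A B C D) ≤ Psi 1 1 1 (√2 - 1) X0) :
    density A B C D ra rb rc rd ≤ K :=
  hK A B C D ra rb rc rd h.ha h.hb h.hc h.hd h.haff hP

section
variable {K : ℝ} (hK : Bd K) (f : E3 → ℝ) (A B C D : E3)

lemma G0 (hK : Bd K) : Gc K f A B C D 1 1 1 1 := by
  refine sortAll (fun A B C D hB hC hD h => ?_) A B C D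
  rw [h.fA, h.fB] at hB
  rw [h.fB, h.fC] at hC
  rw [h.fC, h.fD] at hD
  exact h.fin hK (type0 h.fm (by linarith) (by linarith) (by linarith))

lemma G4 (hK : Bd K) : Gc K f A B C D (√2 - 1) (√2 - 1) (√2 - 1) (√2 - 1) := by
  refine sortAll (fun A B C D hB hC hD h => ?_) A B C D
  rw [h.fA, h.fB] at hB
  rw [h.fB, h.fC] at hC
  rw [h.fC, h.fD] at hD
  exact h.fin hK (type4 h.fm (by linarith) (by linarith) (by linarith))

lemma G3 (hK : Bd K) : Gc K f A B C D 1 (√2 - 1) (√2 - 1) (√2 - 1) := by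
  refine sortBCD (fun B C D hC hD h => ?_) B C D
  rw [h.fB, h.fC] at hC
  rw [h.fC, h.fD] at hD
  exact h.fin hK (type3 h.fm (by linarith) (by linarith))

lemma G2 (hK : Bd K) : Gc K f A B C D 1 1 (√2 - 1) (√2 - 1) := by
  have key : ∀ A B C D, f B ≤ f A → f D ≤ f C → Gc K f A B C D 1 1 (√2 - 1) (√2 - 1) := by
    intro A B C D hB hD h
    rw [h.fA, h.fB] at hB
    rw [h.fC, h.fD] at hD
    exact h.fin hK (type2 h.fm (by linarith) (by linarith))
  rcases le_total (f B) (f A) with h1 | h1 <;> rcases le_total (f D) (f C) with h2 | h2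
  · exact key A B C D h1 h2
  · exact Gc3 (key A B D C h1 h2)
  · exact Gc1 (key B A C D h1 h2)
  · exact Gc1 (Gc3 (key B A D C h1 h2))

lemma G1 (hK : Bd K) : Gc K f A B C D 1 1 1 (√2 - 1) := by
  have key : ∀ A B C D, f C ≤ f A → f C ≤ f B → Gc K f A B C D 1 1 1 (√2 - 1) := by
    intro A B C D hA hB h
    rw [h.fA, h.fC] at hA
    rw [h.fB, h.fC] at hB
    exact h.fin hK (type1 h.fm (by linarith) (by linarith))
  rcases le_total (f C) (f B) with h1 | h1
  · rcases le_total (f C) (f A) with h2 | h2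
    · exact key A B C D h2 h1
    · exact Gc1 (Gc2 (key B C A D (h2.trans h1) h2))
  · rcases le_total (f B) (f A) with h2 | h2
    · exact Gc2 (key A C B D h2 h1)
    · exact Gc1 (Gc2 (key B C A D h2 (h2.trans h1)))
end

lemma Gall {K : ℝ} (hK : Bd K) (f : E3 → ℝ) (A B C D : E3) {rA rB rC rD : ℝ}
    (hrA : rA = 1 ∨ rA = √2 - 1) (hrB : rB = 1 ∨ rB = √2 - 1)
    (hrC : rC = 1 ∨ rC = √2 - 1) (hrD : rD = 1 ∨ rD = √2 - 1) : Gc K f A B C D rA rB rC rD := by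
  rcases hrA with rfl | rfl <;> rcases hrB with rfl | rfl <;> rcases hrC with rfl | rfl <;>
    rcases hrD with rfl | rfl
  · exact G0 f A B C D hK
  · exact G1 f A B C D hK
  · exact Gc3 (G1 f _ _ _ _ hK)
  · exact G2 f A B C D hK
  · exact Gc2 (Gc3 (G1 f _ _ _ _ hK))
  · exact Gc2 (G2 f _ _ _ _ hK)
  · exact Gc3 (Gc2 (G2 f _ _ _ _ hK))
  · exact G3 f _ _ _ _ hK
  · exact Gc1 (Gc2 (Gc3 (G1 f _ _ _ _ hK)))
  · exact Gc1 (Gc2 (G2 f _ _ _ _ hK))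
  · exact Gc1 (Gc3 (Gc2 (G2 f _ _ _ _ hK)))
  · exact Gc1 (G3 f _ _ _ _ hK)
  · exact Gc2 (Gc1 (Gc3 (Gc2 (G2 f _ _ _ _ hK))))
  · exact Gc2 (Gc1 (G3 f _ _ _ _ hK))
  · exact Gc3 (Gc2 (Gc1 (G3 f _ _ _ _ hK)))
  · exact G4 f _ _ _ _ hK

end FMproof

/-- Every FM-tetrahedron (of any type) is at most as dense as the densest
tetrahedron of type 111r (five tight edges, one 11-edge of length 4·√(2r/(1+2r))). -/
theorem densest_overall
    (A B C D A₀ B₀ C₀ D₀ : EuclideanSpace ℝ (Fin 3)) (rA rB rC rD : ℝ)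
    (hrA : rA = 1 ∨ rA = Real.sqrt 2 - 1) (hrB : rB = 1 ∨ rB = Real.sqrt 2 - 1)
    (hrC : rC = 1 ∨ rC = Real.sqrt 2 - 1) (hrD : rD = 1 ∨ rD = Real.sqrt 2 - 1)
    (haff : AffineIndependent ℝ ![A, B, C, D])
    (hAB : rA + rB ≤ dist A B) (hAC : rA + rC ≤ dist A C) (hAD : rA + rD ≤ dist A D)
    (hBC : rB + rC ≤ dist B C) (hBD : rB + rD ≤ dist B D) (hCD : rC + rD ≤ dist C D)
    (hsupp : ∃ O : EuclideanSpace ℝ (Fin 3), ∃ R : ℝ, 0 < R ∧ R ≤ Real.sqrt 2 - 1 ∧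
      dist O A = rA + R ∧ dist O B = rB + R ∧ dist O C = rC + R ∧ dist O D = rD + R)
    (haff₀ : AffineIndependent ℝ ![A₀, B₀, C₀, D₀])
    (hAB₀ : dist A₀ B₀ =
      4 * Real.sqrt (2 * (Real.sqrt 2 - 1) / (1 + 2 * (Real.sqrt 2 - 1))))
    (hAC₀ : dist A₀ C₀ = 2) (hBC₀ : dist B₀ C₀ = 2)
    (hAD₀ : dist A₀ D₀ = 1 + (Real.sqrt 2 - 1)) (hBD₀ : dist B₀ D₀ = 1 + (Real.sqrt 2 - 1))
    (hCD₀ : dist C₀ D₀ = 1 + (Real.sqrt 2 - 1)) :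
    density A B C D rA rB rC rD ≤ density A₀ B₀ C₀ D₀ 1 1 1 (Real.sqrt 2 - 1) := by
  have hpos : ∀ r : ℝ, (r = 1 ∨ r = Real.sqrt 2 - 1) → 0 < r := by
    rintro r (rfl | rfl)
    · exact one_pos
    · exact r_pos
  have hK : Bd (density A₀ B₀ C₀ D₀ 1 1 1 (Real.sqrt 2 - 1)) := by
    intro A B C D ra rb rc rd ha hb hc hd haff hPsi
    exact density_le_of_Psi A B C D A₀ B₀ C₀ D₀ ra rb rc rd ha hb hc hd haff haff₀ hAB₀ hAC₀ hBC₀ hAD₀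
      hBD₀ hCD₀ hPsi
  exact Gall hK (fun X => dist X A ^ 2 + dist X B ^ 2 + dist X C ^ 2 + dist X D ^ 2) A B C D hrA hrB hrC hrD
    ⟨hpos _ hrA, hpos _ hrB, hpos _ hrC, hpos _ hrD, haff, hAB, hAC, hAD, hBC, hBD, hCD, hsupp,
      fun _ => rfl⟩
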